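/- arXiv:2206.07354 — 2 statements merged into one kernel-verified Lean document; each statement's English description precedes it below -/
import Mathlib

section
/- For every μ, ε > 0 there exists ν > 0 such that for every t ∈ ℕ there exists s ∈ ℕ with the following property: if 𝒜 is an ε-wicked reduced hypergraph with index set I, J ⊆ I has size at least s, and Φ, Ψ are (ν, 1/3+ε)-holes on J with Φ ≡_{ε,J} Ψ, then there exists a subset J⋆ ⊆ J of size at least t such that Φ ∪ Ψ is a (μ, 1/3+ε)-hole on J⋆. -/
open Finset Classical

noncomputable section

/-- A reduced hypergraph: a finite (linearly ordered, here `ℕ`) index set `I`,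
pairwise disjoint nonempty finite vertex classes `P i j` for distinct `i j ∈ I`,
and for each triple of distinct indices a tripartite 3-uniform constituent,
encoded by a symmetric edge predicate on vertices. -/
structure ReducedHG where
  I : Finset ℕ
  P : ℕ → ℕ → Finset ℕ
  Psymm : ∀ i j, P i j = P j i
  Pnonempty : ∀ i j, i ∈ I → j ∈ I → i ≠ j → (P i j).Nonempty
  Pdisjoint : ∀ i j k l, i ≠ j → k ≠ l → ({i, j} : Finset ℕ) ≠ ({k, l} : Finset ℕ) →
      Disjoint (P i j) (P k l)
  Edge : ℕ → ℕ → ℕ → Prop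
  EdgeSymm : ∀ a b c, Edge a b c → Edge b a c
  EdgeSymm' : ∀ a b c, Edge a b c → Edge a c b
  EdgeValid : ∀ a b c, Edge a b c → ∃ i j k, i ∈ I ∧ j ∈ I ∧ k ∈ I ∧
      i ≠ j ∧ i ≠ k ∧ j ≠ k ∧ a ∈ P i j ∧ b ∈ P i k ∧ c ∈ P j k

namespace ReducedHG

variable (A : ReducedHG)

/-- The neighbourhood, inside the vertex class `P j k`, of two vertices `a`, `b`. -/
def nbhd (j k : ℕ) (a b : ℕ) : Finset ℕ := (A.P j k).filter fun c => A.Edge a b c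

/-- The number of crossing edges between three vertex sets. -/
def ecount (X Y Z : Finset ℕ) : ℕ :=
  ((X ×ˢ Y ×ˢ Z).filter fun t => A.Edge t.1 t.2.1 t.2.2).card

/-- `(d, ee)`-density: every pair of vertices sharing an index has large degree. -/
def EEDense (d : ℝ) : Prop :=
  ∀ i j k, i ∈ A.I → j ∈ A.I → k ∈ A.I → i ≠ j → i ≠ k → j ≠ k →
    ∀ a ∈ A.P i j, ∀ b ∈ A.P i k,
      d * ((A.P j k).card : ℝ) ≤ ((A.nbhd j k a b).card : ℝ)

/-- `(μ, vvv)`-density: every constituent has many edges. -/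
def VVVDense (μ : ℝ) : Prop :=
  ∀ i j k, i ∈ A.I → j ∈ A.I → k ∈ A.I → i ≠ j → i ≠ k → j ≠ k →
    μ * (((A.P i j).card : ℝ) * ((A.P i k).card : ℝ) * ((A.P j k).card : ℝ)) ≤
      (A.ecount (A.P i j) (A.P i k) (A.P j k) : ℝ)

/-- The reduced hypergraph supports a `K₅⁽³⁾`. -/
def SupportsK5 : Prop :=
  ∃ J ⊆ A.I, J.card = 5 ∧ ∃ f : ℕ → ℕ → ℕ,
    (∀ i ∈ J, ∀ j ∈ J, f i j = f j i) ∧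
    (∀ i ∈ J, ∀ j ∈ J, i ≠ j → f i j ∈ A.P i j) ∧
    (∀ i ∈ J, ∀ j ∈ J, ∀ k ∈ J, i ≠ j → i ≠ k → j ≠ k →
      A.Edge (f i j) (f i k) (f j k))

/-- `ε`-wicked: `(1/3 + ε, ee)`-dense and not supporting a `K₅⁽³⁾`. -/
def Wicked (ε : ℝ) : Prop := A.EEDense (1/3 + ε) ∧ ¬ A.SupportsK5

/-- A `J`-transversal: one vertex in each class `P i j`, `ij ∈ J⁽²⁾`. -/
def IsTransversal (J : Finset ℕ) (Q : ℕ → ℕ → ℕ) : Prop :=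
  (∀ i ∈ J, ∀ j ∈ J, Q i j = Q j i) ∧ ∀ i ∈ J, ∀ j ∈ J, i ≠ j → Q i j ∈ A.P i j

/-- A `(K, L)`-transversal: one vertex in each class `P k l`, `(k, l) ∈ K × L`. -/
def IsTransversal2 (K L : Finset ℕ) (Q : ℕ → ℕ → ℕ) : Prop :=
  ∀ k ∈ K, ∀ l ∈ L, Q k l ∈ A.P k l

/-- An inhabited triple of `J`-transversals. -/
def InhabitedTriple (J : Finset ℕ) (Q R S : ℕ → ℕ → ℕ) : Prop :=
  ∀ i ∈ J, ∀ j ∈ J, ∀ k ∈ J, i < j → j < k → A.Edge (Q i j) (R i k) (S j k)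

/-- An inhabited triple consisting of a `(K,L)`-, a `(K,M)`- and an `(L,M)`-transversal. -/
def InhabitedTriple2 (K L M : Finset ℕ) (Q R S : ℕ → ℕ → ℕ) : Prop :=
  ∀ k ∈ K, ∀ l ∈ L, ∀ m ∈ M, A.Edge (Q k l) (R k m) (S l m)

/-- `Φ` is a `μ`-hole on `J`. -/
def IsHole (μ : ℝ) (J : Finset ℕ) (Φ : Finset ℕ) : Prop :=
  (∀ i ∈ J, ∀ j ∈ J, i ≠ j → (Φ ∩ A.P i j).Nonempty) ∧
  ∀ i ∈ J, ∀ j ∈ J, ∀ k ∈ J, i ≠ j → i ≠ k → j ≠ k →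
    (A.ecount (Φ ∩ A.P i j) (Φ ∩ A.P i k) (Φ ∩ A.P j k) : ℝ) ≤
      μ * (((A.P i j).card : ℝ) * ((A.P i k).card : ℝ) * ((A.P j k).card : ℝ))

/-- `Φ` is a `(μ, ϑ)`-hole on `J` (a `μ`-hole of width at least `ϑ`). -/
def IsHoleW (μ ϑ : ℝ) (J : Finset ℕ) (Φ : Finset ℕ) : Prop :=
  A.IsHole μ J Φ ∧ ∀ i ∈ J, ∀ j ∈ J, i ≠ j →
    ϑ * ((A.P i j).card : ℝ) ≤ (((Φ ∩ A.P i j)).card : ℝ)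

/-- Two holes are `ε`-intersecting on `J`. -/
def HolesIntersecting (ε : ℝ) (J : Finset ℕ) (Φ Ψ : Finset ℕ) : Prop :=
  ∀ i ∈ J, ∀ j ∈ J, i ≠ j →
    ε * ((A.P i j).card : ℝ) ≤ ((Φ ∩ Ψ ∩ A.P i j).card : ℝ)

/-- Two holes are `ε`-disjoint on `J`. -/
def HolesDisjoint (ε : ℝ) (J : Finset ℕ) (Φ Ψ : Finset ℕ) : Prop :=
  ∀ i ∈ J, ∀ j ∈ J, i ≠ j →
    ((Φ ∩ Ψ ∩ A.P i j).card : ℝ) < ε * ((A.P i j).card : ℝ)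

/-- The link on `K` of the family `k ↦ f k`, where `f k` is a vertex in a class `P k ·`:
`⋃_{k ≠ k' ∈ K} N(f k, f k')`. -/
def link (K : Finset ℕ) (f : ℕ → ℕ) : Finset ℕ :=
  ((K ×ˢ K).filter fun p => p.1 ≠ p.2).biUnion fun p => A.nbhd p.1 p.2 (f p.1) (f p.2)

/-- The pair consisting of a transversal `T` on `Sh × B` and a transversal `U` on `Sh × C`
has `δ`-intersecting links. -/
def IntersectingLinks (δ : ℝ) (Sh B C : Finset ℕ) (T U : ℕ → ℕ → ℕ) : Prop :=
  ∀ a ∈ Sh, ∀ a' ∈ Sh, a ≠ a' → ∀ b ∈ B, ∀ c ∈ C,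
    δ * ((A.P a a').card : ℝ) ≤
      (((A.nbhd a a' (T a b) (T a' b)) ∩ (A.nbhd a a' (U a c) (U a' c))).card : ℝ)

/-- The pair consisting of a transversal `T` on `Sh × B` and a transversal `U` on `Sh × C`
has `δ`-disjoint links. -/
def DisjointLinks (δ : ℝ) (Sh B C : Finset ℕ) (T U : ℕ → ℕ → ℕ) : Prop :=
  ∀ a ∈ Sh, ∀ a' ∈ Sh, a ≠ a' → ∀ b ∈ B, ∀ c ∈ C,
    (((A.nbhd a a' (T a b) (T a' b)) ∩ (A.nbhd a a' (U a c) (U a' c))).card : ℝ) <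
      δ * ((A.P a a').card : ℝ)

/-- A bicolouring of the reduced hypergraph: both colours appear in every vertex class and
no edge is monochromatic. -/
def IsBicolouring (φ : ℕ → Bool) : Prop :=
  (∀ i ∈ A.I, ∀ j ∈ A.I, i ≠ j →
    (∃ v ∈ A.P i j, φ v = true) ∧ (∃ v ∈ A.P i j, φ v = false)) ∧
  ∀ a b c, A.Edge a b c → ¬ (φ a = φ b ∧ φ b = φ c)

/-- The minimum monochromatic codegree density is at least `x`: `τ₂(A, φ) ≥ x`. -/
def Tau2Ge (φ : ℕ → Bool) (x : ℝ) : Prop :=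
  ∀ i j k, i ∈ A.I → j ∈ A.I → k ∈ A.I → i ≠ j → i ≠ k → j ≠ k →
    ∀ a ∈ A.P i j, ∀ b ∈ A.P i k, φ a = φ b →
      x * ((A.P j k).card : ℝ) ≤ ((A.nbhd j k a b).card : ℝ)

/-- The `γ`-bad left cherries (both vertices in one hole, many neighbours outside
the other hole). -/
def badLeft (Φ Ψ : Finset ℕ) (γ : ℝ) (i j k : ℕ) : Finset (ℕ × ℕ) :=
  (A.P i j ×ˢ A.P i k).filter fun p =>
    (p.1 ∈ Φ ∧ p.2 ∈ Φ ∧ γ * ((A.P j k).card : ℝ) ≤ (((A.nbhd j k p.1 p.2) \ Ψ).card : ℝ)) ∨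
    (p.1 ∈ Ψ ∧ p.2 ∈ Ψ ∧ γ * ((A.P j k).card : ℝ) ≤ (((A.nbhd j k p.1 p.2) \ Φ).card : ℝ))

/-- The `γ`-bad middle cherries. -/
def badMid (Φ Ψ : Finset ℕ) (γ : ℝ) (i j k : ℕ) : Finset (ℕ × ℕ) :=
  (A.P i j ×ˢ A.P j k).filter fun p =>
    (p.1 ∈ Φ ∧ p.2 ∈ Φ ∧ γ * ((A.P i k).card : ℝ) ≤ (((A.nbhd i k p.1 p.2) \ Ψ).card : ℝ)) ∨
    (p.1 ∈ Ψ ∧ p.2 ∈ Ψ ∧ γ * ((A.P i k).card : ℝ) ≤ (((A.nbhd i k p.1 p.2) \ Φ).card : ℝ))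

/-- The `γ`-bad right cherries. -/
def badRight (Φ Ψ : Finset ℕ) (γ : ℝ) (i j k : ℕ) : Finset (ℕ × ℕ) :=
  (A.P i k ×ˢ A.P j k).filter fun p =>
    (p.1 ∈ Φ ∧ p.2 ∈ Φ ∧ γ * ((A.P i j).card : ℝ) ≤ (((A.nbhd i j p.1 p.2) \ Ψ).card : ℝ)) ∨
    (p.1 ∈ Ψ ∧ p.2 ∈ Ψ ∧ γ * ((A.P i j).card : ℝ) ≤ (((A.nbhd i j p.1 p.2) \ Φ).card : ℝ))

end ReducedHG


lemma rs_step {γ β : Type} (hom : γ → β → Finset ℕ → Prop)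
    (mono : ∀ χ c H H', H' ⊆ H → hom χ c H → hom χ c H') (ok : γ → Finset β → Prop)
    (base : ∀ c n : ℕ, ∃ N : ℕ, ∀ S : Finset β, S.card ≤ c → ∀ χ, ok χ S → ∀ J : Finset ℕ,
      N ≤ J.card → ∃ H ⊆ J, n ≤ H.card ∧ ∃ b ∈ S, hom χ b H) :
    ∀ c n : ℕ, ∃ N : ℕ, ∀ S : Finset β, S.card ≤ c → ∀ χ : ℕ → γ, (∀ a, ok (χ a) S) →
      ∀ J : Finset ℕ, N ≤ J.card → ∃ H ⊆ J, n ≤ H.card ∧ ∃ b ∈ S,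
        ∀ a ∈ H, hom (χ a) b (H.filter (fun x => a < x)) := by
  intro c n
  have key : ∀ n : ℕ, ∃ N : ℕ, ∀ S : Finset β, S.card ≤ c → ∀ χ : ℕ → γ, (∀ a, ok (χ a) S) →
      ∀ J : Finset ℕ, N ≤ J.card → ∃ H ⊆ J, n ≤ H.card ∧ ∃ g : ℕ → β, (∀ a ∈ H, g a ∈ S) ∧
        ∀ a ∈ H, hom (χ a) (g a) (H.filter (fun x => a < x)) := by
    intro n
    induction n with
    | zero =>
      obtain ⟨N, hN⟩ := base c 0
      refine ⟨N, fun S hS χ hχ J hJ => ⟨∅, by simp, by simp, ?_⟩⟩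
      obtain ⟨H, -, -, b, -, -⟩ := hN S hS (χ 0) (hχ 0) J hJ
      exact ⟨fun _ => b, by simp, by simp⟩
    | succ n ih =>
      obtain ⟨N1, h1⟩ := ih
      obtain ⟨N2, h2⟩ := base c N1
      refine ⟨N2 + 1, fun S hS χ hχ J hJ => ?_⟩
      have hne : J.Nonempty := by
        rw [← Finset.card_pos]; omega
      set a := J.min' hne with ha
      have haJ : a ∈ J := J.min'_mem hne
      obtain ⟨H1, hH1, hc1, b, hb, hom1⟩ := h2 S hS (χ a) (hχ a) (J.erase a)
        (by rw [Finset.card_erase_of_mem haJ]; omega)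
      obtain ⟨H2, hH2, hc2, g, hg, hom2⟩ := h1 S hS χ hχ H1 hc1
      have hlt : ∀ x ∈ H2, a < x := by
        intro x hx
        have := hH1 (hH2 hx)
        rw [Finset.mem_erase] at this
        exact lt_of_le_of_ne (J.min'_le x this.2) (Ne.symm this.1)
      have hna : a ∉ H2 := fun h => lt_irrefl _ (hlt a h)
      refine ⟨insert a H2, ?_, ?_, Function.update g a b, ?_, ?_⟩
      · intro x hx
        rw [Finset.mem_insert] at hx
        rcases hx with rfl | hx
        · exact haJ
        · exact Finset.mem_of_mem_erase (hH1 (hH2 hx))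
      · rw [Finset.card_insert_of_notMem hna]; omega
      · intro x hx
        rw [Finset.mem_insert] at hx
        by_cases hxa : x = a
        · subst hxa; simpa using hb
        · rw [Function.update_of_ne hxa]
          exact hg x (hx.resolve_left hxa)
      · intro x hx
        rw [Finset.mem_insert] at hx
        by_cases hxa : x = a
        · rw [hxa, Function.update_self]
          refine mono _ _ _ _ ?_ hom1
          intro y hy
          simp only [Finset.mem_filter, Finset.mem_insert] at hy
          rcases hy.1 with h | h
          · omega
          · exact hH2 h
        · rw [Function.update_of_ne hxa]
          have hx2 := hx.resolve_left hxa
          refine mono _ _ _ _ ?_ (hom2 x hx2)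
          intro y hy
          simp only [Finset.mem_filter, Finset.mem_insert] at hy ⊢
          refine ⟨hy.1.resolve_left ?_, hy.2⟩
          have := hlt x hx2
          omega
  obtain ⟨N, hN⟩ := key (c * n + 1)
  refine ⟨N, fun S hS χ hχ J hJ => ?_⟩
  obtain ⟨H, hH, hc, g, hg, hh⟩ := hN S hS χ hχ J hJ
  have hlt : S.card * n < H.card := by
    have := Nat.mul_le_mul_right n hS
    omega
  obtain ⟨b, hb, hbn⟩ := Finset.exists_lt_card_fiber_of_mul_lt_card_of_maps_to hg hlt
  refine ⟨H.filter (fun x => g x = b), (Finset.filter_subset _ _).trans hH, hbn.le, b, hb, ?_⟩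
  intro a ha
  rw [Finset.mem_filter] at ha
  have := hh a ha.1
  rw [ha.2] at this
  refine mono _ _ _ _ ?_ this
  intro y hy
  simp only [Finset.mem_filter] at hy ⊢
  exact ⟨hy.1.1, hy.2⟩

lemma rs_one {β : Type} : ∀ c n : ℕ, ∃ N : ℕ, ∀ S : Finset β, S.card ≤ c →
    ∀ χ : ℕ → β, (∀ a, χ a ∈ S) → ∀ J : Finset ℕ, N ≤ J.card →
    ∃ H ⊆ J, n ≤ H.card ∧ ∃ b ∈ S, ∀ a ∈ H, χ a = b :=
  rs_step (fun (χ : β) c _ => χ = c) (fun _ _ _ _ _ h => h) (fun χ S => χ ∈ S)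
    (fun _ n => ⟨n, fun _ _ χ h J hJ => ⟨J, subset_rfl, hJ, χ, h, rfl⟩⟩)

lemma rs_two {β : Type} : ∀ c n : ℕ, ∃ N : ℕ, ∀ S : Finset β, S.card ≤ c →
    ∀ χ : ℕ → ℕ → β, (∀ a b, χ a b ∈ S) → ∀ J : Finset ℕ, N ≤ J.card →
    ∃ H ⊆ J, n ≤ H.card ∧ ∃ b ∈ S, ∀ a ∈ H, ∀ a' ∈ H.filter (fun x => a < x), χ a a' = b :=
  rs_step (fun (χ : ℕ → β) c H => ∀ a ∈ H, χ a = c) (fun _ _ _ _ hs h a ha => h a (hs ha))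
    (fun χ S => ∀ a, χ a ∈ S) rs_one

lemma rs_three {β : Type} : ∀ c n : ℕ, ∃ N : ℕ, ∀ S : Finset β, S.card ≤ c →
    ∀ χ : ℕ → ℕ → ℕ → β, (∀ a b d, χ a b d ∈ S) → ∀ J : Finset ℕ, N ≤ J.card →
    ∃ H ⊆ J, n ≤ H.card ∧ ∃ b ∈ S, ∀ a ∈ H, ∀ a' ∈ H.filter (fun x => a < x),
      ∀ a'' ∈ (H.filter (fun x => a < x)).filter (fun x => a' < x), χ a a' a'' = b :=
  rs_step (fun (χ : ℕ → ℕ → β) c H => ∀ a ∈ H, ∀ a' ∈ H.filter (fun x => a < x), χ a a' = c)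
    (fun _ _ _ _ hs h a ha a' ha' => h a (hs ha) a'
      (Finset.mem_filter.2 ⟨hs (Finset.mem_filter.1 ha').1, (Finset.mem_filter.1 ha').2⟩))
    (fun χ S => ∀ a b, χ a b ∈ S) rs_two

lemma block_split (s m : ℕ) : ∀ H : Finset ℕ, s + m ≤ H.card →
    ∃ X ⊆ H, ∃ Y ⊆ H, s ≤ X.card ∧ m ≤ Y.card ∧ ∀ x ∈ X, ∀ y ∈ Y, x < y := by
  induction s with
  | zero => exact fun H h => ⟨∅, by simp, H, subset_rfl, by simp, by omega, by simp⟩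
  | succ s ih =>
    intro H h
    have hne : H.Nonempty := by rw [← Finset.card_pos]; omega
    have ha := H.min'_mem hne
    obtain ⟨X, hX, Y, hY, h1, h2, h3⟩ := ih (H.erase (H.min' hne))
      (by rw [Finset.card_erase_of_mem ha]; omega)
    have hlt : ∀ y ∈ H.erase (H.min' hne), H.min' hne < y := by
      intro y hy
      rw [Finset.mem_erase] at hy
      exact lt_of_le_of_ne (H.min'_le y hy.2) (Ne.symm hy.1)
    refine ⟨insert (H.min' hne) X, ?_, Y, hY.trans (Finset.erase_subset _ _), ?_, h2, ?_⟩
    · exact Finset.insert_subset ha (hX.trans (Finset.erase_subset _ _))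
    · rw [Finset.card_insert_of_notMem]
      · omega
      · exact fun h => lt_irrefl _ (hlt _ (hX h))
    · intro x hx y hy
      rw [Finset.mem_insert] at hx
      rcases hx with rfl | hx
      · exact hlt y (hY hy)
      · exact h3 x hx y hy

lemma disj_of_lt {X Y : Finset ℕ} (h : ∀ x ∈ X, ∀ y ∈ Y, x < y) : Disjoint X Y := by
  rw [Finset.disjoint_left]
  intro a ha hb
  exact lt_irrefl _ (h a ha a hb)

lemma rs_box (t s : ℕ) : ∃ N : ℕ, ∀ J : Finset ℕ, N ≤ J.card → ∀ T : ℕ → ℕ → ℕ → Prop,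
    (∃ H ⊆ J, t ≤ H.card ∧ ∀ x ∈ H, ∀ i ∈ H, ∀ j ∈ H, x ≠ i → x ≠ j → i ≠ j → T x i j) ∨
    (∃ X ⊆ J, ∃ K ⊆ J, ∃ L ⊆ J, Disjoint X K ∧ Disjoint X L ∧ Disjoint K L ∧
      s ≤ X.card ∧ s ≤ K.card ∧ s ≤ L.card ∧ ∀ x ∈ X, ∀ i ∈ K, ∀ j ∈ L, ¬ T x i j) := by
  obtain ⟨N, hN⟩ := rs_three (β := Prop × Prop × Prop × Prop × Prop × Prop)
    (Finset.univ : Finset (Prop × Prop × Prop × Prop × Prop × Prop)).card (t + (s + (s + s)))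
  refine ⟨N, fun J hJ T => ?_⟩
  obtain ⟨H, hHJ, hc, ⟨p1, p2, p3, p4, p5, p6⟩, -, hh⟩ := hN Finset.univ le_rfl
    (fun a b c => (T a b c, T a c b, T b a c, T b c a, T c a b, T c b a))
    (fun _ _ _ => Finset.mem_univ _) J hJ
  have hh' : ∀ a ∈ H, ∀ b ∈ H, ∀ c ∈ H, a < b → b < c → (T a b c = p1 ∧ T a c b = p2 ∧
      T b a c = p3 ∧ T b c a = p4 ∧ T c a b = p5 ∧ T c b a = p6) := by
    intro a ha b hb c hc hab hbc
    have := hh a ha b (Finset.mem_filter.2 ⟨hb, hab⟩) c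
      (Finset.mem_filter.2 ⟨Finset.mem_filter.2 ⟨hc, hab.trans hbc⟩, hbc⟩)
    simpa only [Prod.mk.injEq] using this
  by_cases hall : p1 ∧ p2 ∧ p3 ∧ p4 ∧ p5 ∧ p6
  · left
    obtain ⟨q1, q2, q3, q4, q5, q6⟩ := hall
    refine ⟨H, hHJ, by omega, ?_⟩
    intro x hx i hi j hj h1 h2 h3
    rcases lt_or_gt_of_ne h1 with a | a <;> rcases lt_or_gt_of_ne h2 with b | b <;>
      rcases lt_or_gt_of_ne h3 with c | c
    · rw [(hh' x hx i hi j hj a c).1]; exact q1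
    · rw [(hh' x hx j hj i hi b c).2.1]; exact q2
    · omega
    · rw [(hh' j hj x hx i hi b a).2.2.2.1]; exact q4
    · rw [(hh' i hi x hx j hj a b).2.2.1]; exact q3
    · omega
    · rw [(hh' i hi j hj x hx c b).2.2.2.2.1]; exact q5
    · rw [(hh' j hj i hi x hx c a).2.2.2.2.2]; exact q6
  · right
    obtain ⟨B1, hB1, R, hR, c1, cR, l1⟩ := block_split s (s + s) H (by omega)
    obtain ⟨B2, hB2, B3, hB3, c2, c3, l2⟩ := block_split s s R cR
    have hB2' := hB2.trans hR
    have hB3' := hB3.trans hR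
    have e12 : ∀ x ∈ B1, ∀ y ∈ B2, x < y := fun x hx y hy => l1 x hx y (hB2 hy)
    have e13 : ∀ x ∈ B1, ∀ y ∈ B3, x < y := fun x hx y hy => l1 x hx y (hB3 hy)
    have d12 := disj_of_lt e12
    have d13 := disj_of_lt e13
    have d23 := disj_of_lt l2
    have key := fun a (ha : a ∈ B1) b (hb : b ∈ B2) c (hc : c ∈ B3) =>
      hh' a (hB1 ha) b (hB2' hb) c (hB3' hc) (e12 a ha b hb) (l2 b hb c hc)
    have i1 := hB1.trans hHJ
    have i2 := hB2'.trans hHJ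
    have i3 := hB3'.trans hHJ
    by_cases q1 : p1
    · by_cases q2 : p2
      · by_cases q3 : p3
        · by_cases q4 : p4
          · by_cases q5 : p5
            · have q6 : ¬ p6 := fun q6 => hall ⟨q1, q2, q3, q4, q5, q6⟩
              refine ⟨B3, i3, B2, i2, B1, i1, d23.symm, d13.symm, d12.symm, c3, c2, c1, ?_⟩
              intro x hx i hi j hj
              rw [(key j hj i hi x hx).2.2.2.2.2]; exact q6
            · refine ⟨B3, i3, B1, i1, B2, i2, d13.symm, d23.symm, d12, c3, c1, c2, ?_⟩
              intro x hx i hi j hj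
              rw [(key i hi j hj x hx).2.2.2.2.1]; exact q5
          · refine ⟨B2, i2, B3, i3, B1, i1, d23, d12.symm, d13.symm, c2, c3, c1, ?_⟩
            intro x hx i hi j hj
            rw [(key j hj x hx i hi).2.2.2.1]; exact q4
        · refine ⟨B2, i2, B1, i1, B3, i3, d12.symm, d23, d13, c2, c1, c3, ?_⟩
          intro x hx i hi j hj
          rw [(key i hi x hx j hj).2.2.1]; exact q3
      · refine ⟨B1, i1, B3, i3, B2, i2, d13, d12, d23.symm, c1, c3, c2, ?_⟩
        intro x hx i hi j hj
        rw [(key x hx j hj i hi).2.1]; exact q2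
    · refine ⟨B1, i1, B2, i2, B3, i3, d12, d13, d23, c1, c2, c3, ?_⟩
      intro x hx i hi j hj
      rw [(key x hx i hi j hj).1]; exact q1

lemma sel_step {σ : Type} (p : ℝ) (hp : 0 < p) (m N : ℕ) : ∃ m1 : ℕ, ∃ p' : ℝ, 0 < p' ∧
    ∀ (α : Type) (Ω : Finset α) (S : Finset σ) (X : Finset ℕ) (E : ℕ → σ → α → Prop),
      S.card ≤ N → m1 ≤ X.card →
      (∀ x ∈ X, ∃ s ∈ S, p * (Ω.card : ℝ) ≤ ((Ω.filter (fun ω => E x s ω)).card : ℝ)) →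
      ∃ s ∈ S, ∃ X' ⊆ X, X'.card = m ∧
        p' * (Ω.card : ℝ) ≤ ((Ω.filter (fun ω => ∀ x ∈ X', E x s ω)).card : ℝ) := by
  obtain ⟨n1, hn1⟩ := exists_nat_ge (2 * (m : ℝ) / p)
  set n0 := n1 + m + 1 with hn0
  have hmn : (m : ℝ) ≤ n0 * p / 2 := by
    rw [div_le_iff₀ hp] at hn1
    have : (n1 : ℝ) ≤ n0 := by exact_mod_cast (by omega)
    nlinarith
  refine ⟨N * n0 + 1, p / 2 / 2 ^ n0, by positivity, ?_⟩
  intro α Ω S X E hS hX h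
  have : ∀ x, ∃ s, x ∈ X → s ∈ S ∧
      p * (Ω.card : ℝ) ≤ ((Ω.filter (fun ω => E x s ω)).card : ℝ) := by
    intro x
    by_cases hx : x ∈ X
    · obtain ⟨s, h1, h2⟩ := h x hx
      exact ⟨s, fun _ => ⟨h1, h2⟩⟩
    · have hne : X.Nonempty := by rw [← Finset.card_pos]; omega
      obtain ⟨y, hy⟩ := hne
      obtain ⟨s, -⟩ := h y hy
      exact ⟨s, fun h => absurd h hx⟩
  choose g hg using this
  obtain ⟨s, hs, hfib⟩ := Finset.exists_lt_card_fiber_of_mul_lt_card_of_maps_to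
    (s := X) (t := S) (f := g) (n := n0) (fun x hx => (hg x hx).1)
    (by have := Nat.mul_le_mul_right n0 hS; omega)
  obtain ⟨Y, hYX, hYc⟩ := Finset.exists_subset_card_eq hfib.le
  have hY : ∀ x ∈ Y, x ∈ X ∧ p * (Ω.card : ℝ) ≤ ((Ω.filter (fun ω => E x s ω)).card : ℝ) := by
    intro x hx
    have := hYX hx
    rw [Finset.mem_filter] at this
    have h2 := (hg x this.1).2
    rw [this.2] at h2
    exact ⟨this.1, h2⟩
  refine ⟨s, hs, ?_⟩
  set B := Ω.filter (fun ω => m ≤ (Y.filter (fun x => E x s ω)).card) with hB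
  have hsum : ∑ x ∈ Y, ((Ω.filter (fun ω => E x s ω)).card : ℝ)
      = ∑ ω ∈ Ω, ((Y.filter (fun x => E x s ω)).card : ℝ) := by
    simp only [Finset.card_filter, Nat.cast_sum]
    rw [Finset.sum_comm]
  have hlow : (n0 : ℝ) * (p * Ω.card) ≤ ∑ x ∈ Y, ((Ω.filter (fun ω => E x s ω)).card : ℝ) := by
    have := Finset.card_nsmul_le_sum Y
      (fun x => ((Ω.filter (fun ω => E x s ω)).card : ℝ)) (p * Ω.card) (fun x hx => (hY x hx).2)
    rwa [hYc, nsmul_eq_mul] at this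
  have hup : ∑ ω ∈ Ω, ((Y.filter (fun x => E x s ω)).card : ℝ) ≤ n0 * B.card + m * Ω.card := by
    calc ∑ ω ∈ Ω, ((Y.filter (fun x => E x s ω)).card : ℝ)
        ≤ ∑ ω ∈ Ω, ((n0 : ℝ) * (if m ≤ (Y.filter (fun x => E x s ω)).card then 1 else 0) + m) := by
          apply Finset.sum_le_sum
          intro ω _
          have h1 : ((Y.filter (fun x => E x s ω)).card : ℝ) ≤ n0 := by
            exact_mod_cast (Finset.card_filter_le _ _).trans hYc.le
          split_ifs with hc
          · have : (0 : ℝ) ≤ m := by positivity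
            linarith
          · have : ((Y.filter (fun x => E x s ω)).card : ℝ) ≤ m := by
              exact_mod_cast (not_le.1 hc).le
            linarith
      _ = n0 * B.card + m * Ω.card := by
          rw [Finset.sum_add_distrib, ← Finset.mul_sum, hB, Finset.card_filter]
          simp [mul_comm]
  have hn0pos : (0 : ℝ) < n0 := by exact_mod_cast (by omega)
  have hBlow : p / 2 * Ω.card ≤ B.card := by
    have h1 : (m : ℝ) * Ω.card ≤ n0 * p / 2 * Ω.card :=
      mul_le_mul_of_nonneg_right hmn (by positivity)
    have h2 : (n0 : ℝ) * (p / 2 * Ω.card) ≤ n0 * B.card := by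
      have := hlow.trans (hsum.le.trans hup)
      nlinarith
    exact le_of_mul_le_mul_left h2 hn0pos
  have hBup : (B.card : ℝ) ≤ ∑ X' ∈ Y.powersetCard m,
      ((Ω.filter (fun ω => ∀ x ∈ X', E x s ω)).card : ℝ) := by
    have : B ⊆ (Y.powersetCard m).biUnion
        (fun X' => Ω.filter (fun ω => ∀ x ∈ X', E x s ω)) := by
      intro ω hω
      rw [hB, Finset.mem_filter] at hω
      obtain ⟨X', h1, h2⟩ := Finset.exists_subset_card_eq hω.2
      rw [Finset.mem_biUnion]
      refine ⟨X', Finset.mem_powersetCard.2 ⟨h1.trans (Finset.filter_subset _ _), h2⟩, ?_⟩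
      rw [Finset.mem_filter]
      exact ⟨hω.1, fun x hx => (Finset.mem_filter.1 (h1 hx)).2⟩
    have h2 := (Finset.card_le_card this).trans Finset.card_biUnion_le
    exact_mod_cast h2
  have hne : (Y.powersetCard m).Nonempty := by
    rw [Finset.powersetCard_nonempty, hYc]; omega
  obtain ⟨X', hX', hle⟩ := Finset.exists_le_of_sum_le
    (f := fun _ => p / 2 / 2 ^ n0 * (Ω.card : ℝ)) hne (by
      refine le_trans ?_ hBup
      refine le_trans ?_ hBlow
      rw [Finset.sum_const, nsmul_eq_mul]
      have h1 : ((Y.powersetCard m).card : ℝ) ≤ 2 ^ n0 := by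
        rw [Finset.card_powersetCard, hYc]
        exact_mod_cast Nat.choose_le_two_pow n0 m
      calc ((Y.powersetCard m).card : ℝ) * (p / 2 / 2 ^ n0 * (Ω.card : ℝ))
          ≤ 2 ^ n0 * (p / 2 / 2 ^ n0 * (Ω.card : ℝ)) :=
            mul_le_mul_of_nonneg_right h1 (by positivity)
        _ = p / 2 * Ω.card := by field_simp)
  rw [Finset.mem_powersetCard] at hX'
  exact ⟨X', fun x hx => (hY x (hX'.1 hx)).1, hX'.2, hle⟩

lemma sel_box (p : ℝ) (hp : 0 < p) (r κ l : ℕ) : ∃ m : ℕ, ∃ p' : ℝ, 0 < p' ∧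
    ∀ (α : Type) (Ω : Finset α) (X K L : Finset ℕ) (E : ℕ → ℕ → ℕ → α → Prop),
      m ≤ X.card → m ≤ K.card → m ≤ L.card →
      (∀ x ∈ X, ∀ i ∈ K, ∀ j ∈ L,
        p * (Ω.card : ℝ) ≤ ((Ω.filter (fun ω => E x i j ω)).card : ℝ)) →
      ∃ X' ⊆ X, ∃ K' ⊆ K, ∃ L' ⊆ L, X'.card = r ∧ K'.card = κ ∧ L'.card = l ∧
        p' * (Ω.card : ℝ) ≤
          ((Ω.filter (fun ω => ∀ x ∈ X', ∀ i ∈ K', ∀ j ∈ L', E x i j ω)).card : ℝ) := by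
  obtain ⟨m1, p1, hp1, h1⟩ := sel_step (σ := Unit) p hp l 1
  obtain ⟨m2, p2, hp2, h2⟩ := sel_step (σ := Finset ℕ) p1 hp1 κ (2 ^ m1)
  obtain ⟨m3, p3, hp3, h3⟩ := sel_step (σ := Finset ℕ × Finset ℕ) p2 hp2 r (2 ^ m2 * 2 ^ m1)
  refine ⟨m1 + m2 + m3, p3, hp3, ?_⟩
  intro α Ω X K L E hX hK hL hE
  obtain ⟨K0, hK0, cK0⟩ := Finset.exists_subset_card_eq (show m2 ≤ K.card by omega)
  obtain ⟨L0, hL0, cL0⟩ := Finset.exists_subset_card_eq (show m1 ≤ L.card by omega)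
  have cLp : (L0.powerset.filter (fun T => T.card = l)).card ≤ 2 ^ m1 := by
    rw [← cL0, ← Finset.card_powerset]; exact Finset.card_filter_le _ _
  have cKp : (K0.powerset.filter (fun T => T.card = κ)).card ≤ 2 ^ m2 := by
    rw [← cK0, ← Finset.card_powerset]; exact Finset.card_filter_le _ _
  have s1 : ∀ x ∈ X, ∀ i ∈ K0, ∃ L' ∈ L0.powerset.filter (fun T => T.card = l),
      p1 * (Ω.card : ℝ) ≤ ((Ω.filter (fun ω => ∀ j ∈ L', E x i j ω)).card : ℝ) := by
    intro x hx i hi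
    obtain ⟨_, -, L', hL', c, hh⟩ := h1 α Ω Finset.univ L0 (fun j _ ω => E x i j ω) (by simp)
      cL0.ge (fun j hj => ⟨(), by simp, hE x hx i (hK0 hi) j (hL0 hj)⟩)
    exact ⟨L', by simp [hL', c], hh⟩
  have s2 : ∀ x ∈ X, ∃ q ∈ (K0.powerset.filter (fun T => T.card = κ)) ×ˢ
      (L0.powerset.filter (fun T => T.card = l)),
      p2 * (Ω.card : ℝ) ≤ ((Ω.filter (fun ω => ∀ i ∈ q.1, ∀ j ∈ q.2, E x i j ω)).card : ℝ) := by
    intro x hx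
    obtain ⟨L', hL', K', hK', c, hh⟩ := h2 α Ω _ K0 (fun i T ω => ∀ j ∈ T, E x i j ω) cLp
      cK0.ge (by
        intro i hi
        obtain ⟨T, hT, hh⟩ := s1 x hx i hi
        exact ⟨T, hT, by convert hh⟩)
    exact ⟨(K', L'), Finset.mem_product.2 ⟨by simp [hK', c], hL'⟩, by convert hh⟩
  obtain ⟨⟨K', L'⟩, hq, X', hX', c, hh⟩ := h3 α Ω _ X
    (fun x q ω => ∀ i ∈ q.1, ∀ j ∈ q.2, E x i j ω)
    (by rw [Finset.card_product]; exact Nat.mul_le_mul cKp cLp) (by omega) (by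
        intro i hi
        obtain ⟨T, hT, hh⟩ := s2 i hi
        exact ⟨T, hT, by convert hh⟩)
  simp only [Finset.mem_product, Finset.mem_filter, Finset.mem_powerset] at hq
  exact ⟨X', hX', K', hq.1.1.trans hK0, L', hq.2.1.trans hL0, c, hq.1.2, hq.2.2, by convert hh⟩

lemma pi_marg {ι : Type} [Fintype ι] [DecidableEq ι] (V : ι → Finset ℕ) (p q : ι) (hpq : p ≠ q)
    (R : ℕ → ℕ → Prop) :
    ((Fintype.piFinset V).filter (fun v => R (v p) (v q))).card * ((V p).card * (V q).card) =
    ((V p ×ˢ V q).filter (fun t => R t.1 t.2)).card * (Fintype.piFinset V).card := by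
  have hmaps : ∀ v ∈ (Fintype.piFinset V).filter (fun v => R (v p) (v q)),
      (v p, v q) ∈ (V p ×ˢ V q).filter (fun t => R t.1 t.2) := by
    intro v hv
    simp only [Finset.mem_filter, Fintype.mem_piFinset, Finset.mem_product] at hv ⊢
    exact ⟨⟨hv.1 p, hv.1 q⟩, hv.2⟩
  rw [Finset.card_eq_sum_card_fiberwise hmaps, Finset.sum_mul, ← smul_eq_mul
    (a := ((V p ×ˢ V q).filter (fun t => R t.1 t.2)).card), ← Finset.sum_const]
  apply Finset.sum_congr rfl
  rintro ⟨a, b⟩ hab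
  simp only [Finset.mem_filter, Finset.mem_product] at hab
  have hset : ((Fintype.piFinset V).filter (fun v => R (v p) (v q))).filter
      (fun v => (v p, v q) = (a, b)) =
      Fintype.piFinset (fun i => if i = p then {a} else if i = q then {b} else V i) := by
    ext v
    simp only [Finset.mem_filter, Fintype.mem_piFinset, Prod.mk.injEq]
    constructor
    · rintro ⟨⟨h1, h2⟩, h3, h4⟩ i
      split_ifs with e1 e2
      · subst e1; simp [h3]
      · subst e2; simp [h4]
      · exact h1 i
    · intro h
      have hp := h p
      have hq := h q
      simp only [if_true, Finset.mem_singleton] at hp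
      rw [if_neg (Ne.symm hpq)] at hq
      simp only [if_true, Finset.mem_singleton] at hq
      refine ⟨⟨fun i => ?_, by rw [hp, hq]; exact hab.2⟩, hp, hq⟩
      have hi := h i
      split_ifs at hi with e1 e2
      · subst e1; rw [hp]; exact hab.1.1
      · subst e2; rw [hq]; exact hab.1.2
      · exact hi
  rw [hset, Fintype.card_piFinset, Fintype.card_piFinset]
  have hq' : q ∈ Finset.univ.erase p := by simp [Ne.symm hpq]
  rw [← Finset.mul_prod_erase Finset.univ _ (Finset.mem_univ p),
    ← Finset.mul_prod_erase (Finset.univ.erase p) _ hq',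
    ← Finset.mul_prod_erase Finset.univ (fun i => (V i).card) (Finset.mem_univ p),
    ← Finset.mul_prod_erase (Finset.univ.erase p) (fun i => (V i).card) hq']
  have : ∏ i ∈ (Finset.univ.erase p).erase q,
      (if i = p then ({a} : Finset ℕ) else if i = q then {b} else V i).card =
      ∏ i ∈ (Finset.univ.erase p).erase q, (V i).card := by
    apply Finset.prod_congr rfl
    intro i hi
    simp only [Finset.mem_erase] at hi
    rw [if_neg hi.2.1, if_neg hi.1]
  rw [this, if_pos rfl, if_neg (Ne.symm hpq), if_pos rfl]
  simp only [Finset.card_singleton]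
  ring

lemma sel_main (δ : ℝ) (hδ : 0 < δ) (r κ l : ℕ) : ∃ m : ℕ, ∃ η : ℝ, 0 < η ∧
    ∀ (P : ℕ → ℕ → Finset ℕ) (X K L : Finset ℕ) (G : ℕ → ℕ → ℕ → ℕ → ℕ → Prop)
      (B : ℕ → ℕ → ℕ → ℕ → ℕ → ℕ → Prop),
      m ≤ X.card → m ≤ K.card → m ≤ L.card → Disjoint K L →
      (∀ x ∈ X, ∀ j ∈ K ∪ L, (P x j).Nonempty) →
      (∀ x ∈ X, ∀ i ∈ K, ∀ j ∈ L, δ * (((P x i).card : ℝ) * (P x j).card) ≤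
        (((P x i ×ˢ P x j).filter (fun t => G x i j t.1 t.2)).card : ℝ)) →
      (∀ x ∈ X, ∀ y ∈ X, ∀ j ∈ K ∪ L, ∀ k ∈ K ∪ L, (x ≠ y ∨ j ≠ k) →
        (((P x j ×ˢ P y k).filter (fun t => B x j y k t.1 t.2)).card : ℝ) ≤
          η * (((P x j).card : ℝ) * (P y k).card)) →
      ∃ X' ⊆ X, ∃ K' ⊆ K, ∃ L' ⊆ L, X'.card = r ∧ K'.card = κ ∧ L'.card = l ∧
        ∃ v : ℕ → ℕ → ℕ, (∀ x ∈ X', ∀ j ∈ K' ∪ L', v x j ∈ P x j) ∧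
          (∀ x ∈ X', ∀ i ∈ K', ∀ j ∈ L', G x i j (v x i) (v x j)) ∧
          (∀ x ∈ X', ∀ y ∈ X', ∀ j ∈ K' ∪ L', ∀ k ∈ K' ∪ L', (x ≠ y ∨ j ≠ k) →
            ¬ B x j y k (v x j) (v y k)) := by
  obtain ⟨m, p', hp', hbox⟩ := sel_box δ hδ r κ l
  set W : ℝ := ((m : ℝ) * (m + m)) ^ 2 + 1 with hW
  have hWpos : 0 < W := by positivity
  refine ⟨m, p' / W / 2, by positivity, ?_⟩
  intro P X1 K1 L1 G B hX1 hK1 hL1 hKL1 hne1 hG1 hB1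
  obtain ⟨X, hX, cX⟩ := Finset.exists_subset_card_eq hX1
  obtain ⟨K, hK, cK⟩ := Finset.exists_subset_card_eq hK1
  obtain ⟨L, hL, cL⟩ := Finset.exists_subset_card_eq hL1
  have hKL : Disjoint K L := Disjoint.mono hK hL hKL1
  have hsub : K ∪ L ⊆ K1 ∪ L1 := Finset.union_subset_union hK hL
  let ι : Type := ↥X × ↥(K ∪ L)
  let V : ι → Finset ℕ := fun q => P q.1.1 q.2.1
  set Ω := Fintype.piFinset V with hΩ
  have hVne : ∀ q, (V q).Nonempty := fun q => hne1 _ (hX q.1.2) _ (hsub q.2.2)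
  have hΩpos : (0 : ℝ) < Ω.card := by
    have : Ω.Nonempty := Fintype.piFinset_nonempty.2 hVne
    exact_mod_cast this.card_pos
  have hVpos : ∀ q, (0 : ℝ) < (V q).card := fun q => by exact_mod_cast (hVne q).card_pos
  let ev : (ι → ℕ) → ℕ → ℕ → ℕ := fun v x j =>
    if h : x ∈ X ∧ j ∈ K ∪ L then v (⟨x, h.1⟩, ⟨j, h.2⟩) else 0
  have hmarg : ∀ (p q : ι), p ≠ q → ∀ R : ℕ → ℕ → Prop,
      ((Ω.filter (fun v => R (v p) (v q))).card : ℝ) * ((V p).card * (V q).card) =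
      (((V p ×ˢ V q).filter (fun t => R t.1 t.2)).card : ℝ) * Ω.card := by
    intro p q hpq R
    have := pi_marg V p q hpq R
    rw [← Nat.cast_mul, ← Nat.cast_mul, ← Nat.cast_mul, Nat.cast_inj]
    convert this
  obtain ⟨X', hX', K', hK', L', hL', c1, c2, c3, hbig⟩ := hbox (ι → ℕ) Ω X K L
    (fun x i j v => G x i j (ev v x i) (ev v x j)) cX.ge cK.ge cL.ge (by
      intro x hx i hi j hj
      have hi' : i ∈ K ∪ L := Finset.mem_union_left _ hi
      have hj' : j ∈ K ∪ L := Finset.mem_union_right _ hj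
      have hij : i ≠ j := fun h => Finset.disjoint_left.1 hKL hi (h ▸ hj)
      have h1 := hmarg (⟨x, hx⟩, ⟨i, hi'⟩) (⟨x, hx⟩, ⟨j, hj'⟩)
        (by simpa [ι] using hij) (fun a b => G x i j a b)
      have h2 := hG1 x (hX hx) i (hK hi) j (hL hj)
      have e : ∀ v : ι → ℕ, G x i j (ev v x i) (ev v x j) ↔
          G x i j (v (⟨x, hx⟩, ⟨i, hi'⟩)) (v (⟨x, hx⟩, ⟨j, hj'⟩)) := by
        intro v
        simp only [ev, dif_pos (And.intro hx hi'), dif_pos (And.intro hx hj')]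
      simp only [e]
      have q1 := hVpos (⟨x, hx⟩, ⟨i, hi'⟩)
      have q2 := hVpos (⟨x, hx⟩, ⟨j, hj'⟩)
      refine le_of_mul_le_mul_right ?_ (mul_pos q1 q2)
      rw [h1]
      have h3 := mul_le_mul_of_nonneg_right h2 hΩpos.le
      calc _ = δ * (((P x i).card : ℝ) * (P x j).card) * Ω.card := by simp only [V]; ring
        _ ≤ _ := h3)
  -- the bad set
  set BadS := ((Finset.univ : Finset (ι × ι)).filter (fun t => t.1 ≠ t.2)).biUnion
    (fun t => Ω.filter (fun v => B t.1.1.1 t.1.2.1 t.2.1.1 t.2.2.1 (v t.1) (v t.2))) with hBadS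
  have hBadcard : (BadS.card : ℝ) < p' * Ω.card := by
    have h1 : (BadS.card : ℝ) ≤ ∑ t ∈ (Finset.univ : Finset (ι × ι)).filter (fun t => t.1 ≠ t.2),
        ((Ω.filter (fun v => B t.1.1.1 t.1.2.1 t.2.1.1 t.2.2.1 (v t.1) (v t.2))).card : ℝ) := by
      exact_mod_cast Finset.card_biUnion_le
    have h2 : ∀ t ∈ (Finset.univ : Finset (ι × ι)).filter (fun t => t.1 ≠ t.2),
        ((Ω.filter (fun v => B t.1.1.1 t.1.2.1 t.2.1.1 t.2.2.1 (v t.1) (v t.2))).card : ℝ) ≤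
        p' / W / 2 * Ω.card := by
      rintro ⟨p, q⟩ ht
      have hpq : p ≠ q := by simpa using ht
      have e1 := hmarg p q hpq (fun a b => B p.1.1 p.2.1 q.1.1 q.2.1 a b)
      have hne : (p.1.1 ≠ q.1.1 ∨ p.2.1 ≠ q.2.1) := by
        by_contra hcon
        push Not at hcon
        exact hpq (Prod.ext (Subtype.ext hcon.1) (Subtype.ext hcon.2))
      have e2 := hB1 p.1.1 (hX p.1.2) q.1.1 (hX q.1.2) p.2.1 (hsub p.2.2) q.2.1 (hsub q.2.2) hne
      refine le_of_mul_le_mul_right ?_ (mul_pos (hVpos p) (hVpos q))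
      rw [e1]
      have h3 := mul_le_mul_of_nonneg_right e2 hΩpos.le
      calc _ ≤ _ := h3
        _ = _ := by simp only [V]; ring
    have h3 := Finset.sum_le_card_nsmul _ _ _ h2
    have h4 : (((Finset.univ : Finset (ι × ι)).filter (fun t => t.1 ≠ t.2)).card : ℝ) ≤ W := by
      have : ((Finset.univ : Finset (ι × ι)).filter (fun t => t.1 ≠ t.2)).card ≤
          (m * (m + m)) ^ 2 := by
        refine (Finset.card_filter_le _ _).trans ?_
        rw [Finset.card_univ]
        simp only [ι, Fintype.card_prod, Fintype.card_coe]
        rw [Finset.card_union_of_disjoint hKL, cX, cK, cL, sq]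
      have h5 : (((Finset.univ : Finset (ι × ι)).filter (fun t => t.1 ≠ t.2)).card : ℝ) ≤
          ((m : ℝ) * (m + m)) ^ 2 := by exact_mod_cast this
      linarith
    rw [nsmul_eq_mul] at h3
    calc (BadS.card : ℝ) ≤ _ := h1.trans h3
      _ ≤ W * (p' / W / 2 * Ω.card) := mul_le_mul_of_nonneg_right h4 (by positivity)
      _ = p' * Ω.card / 2 := by field_simp
      _ < p' * Ω.card := by
        have : 0 < p' * Ω.card := by positivity
        linarith
  have hex : ∃ v ∈ Ω.filter (fun ω => ∀ x ∈ X', ∀ i ∈ K', ∀ j ∈ L',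
      G x i j (ev ω x i) (ev ω x j)), v ∉ BadS := by
    apply Finset.exists_mem_notMem_of_card_lt_card
    exact_mod_cast lt_of_lt_of_le hBadcard hbig
  obtain ⟨v, hv, hvB⟩ := hex
  rw [Finset.mem_filter] at hv
  have hvm : ∀ q, v q ∈ V q := Fintype.mem_piFinset.1 hv.1
  have hsub' : K' ∪ L' ⊆ K ∪ L := Finset.union_subset_union hK' hL'
  refine ⟨X', hX'.trans hX, K', hK'.trans hK, L', hL'.trans hL, c1, c2, c3, ev v, ?_, hv.2, ?_⟩
  · intro x hx j hj
    simp only [ev, dif_pos (And.intro (hX' hx) (hsub' hj))]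
    exact hvm (⟨x, hX' hx⟩, ⟨j, hsub' hj⟩)
  · intro x hx y hy j hj k hk hne hb
    apply hvB
    simp only [ev, dif_pos (And.intro (hX' hx) (hsub' hj)),
      dif_pos (And.intro (hX' hy) (hsub' hk))] at hb
    rw [hBadS, Finset.mem_biUnion]
    refine ⟨((⟨x, hX' hx⟩, ⟨j, hsub' hj⟩), (⟨y, hX' hy⟩, ⟨k, hsub' hk⟩)), ?_, ?_⟩
    · simp only [Finset.mem_filter, Finset.mem_univ, true_and]
      intro heq
      have := congrArg (fun q : ι => (q.1.1, q.2.1)) heq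
      simp only [Prod.mk.injEq] at this
      tauto
    · rw [Finset.mem_filter]
      exact ⟨hv.1, hb⟩

lemma k5_fin (A : ReducedHG) (σ : Fin 5 → ℕ) (hσ : Function.Injective σ) (hI : ∀ a, σ a ∈ A.I)
    (g : Fin 5 → Fin 5 → ℕ) (hg : ∀ a b, g a b = g b a)
    (hP : ∀ a b, a < b → g a b ∈ A.P (σ a) (σ b))
    (hE : ∀ a b c, a < b → b < c → A.Edge (g a b) (g a c) (g b c)) : A.SupportsK5 := by
  have inv : ∀ a, Function.invFun σ (σ a) = a := Function.leftInverse_invFun hσ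
  have S1 := A.EdgeSymm
  have S2 := A.EdgeSymm'
  have hE' : ∀ a b c, a ≠ b → a ≠ c → b ≠ c → A.Edge (g a b) (g a c) (g b c) := by
    intro a b c h1 h2 h3
    rcases lt_or_gt_of_ne h1 with h1 | h1 <;> rcases lt_or_gt_of_ne h2 with h2 | h2 <;>
      rcases lt_or_gt_of_ne h3 with h3 | h3
    · exact hE a b c h1 h3
    · have := hE a c b h2 h3
      rw [hg c b] at this; exact S1 _ _ _ this
    · omega
    · have := hE c a b h2 h1
      rw [hg c a, hg c b] at this
      exact S1 _ _ _ (S2 _ _ _ this)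
    · have := hE b a c h1 h2
      rw [hg b a] at this
      exact S2 _ _ _ this
    · omega
    · have := hE b c a h3 h2
      rw [hg b a, hg c a] at this
      exact S2 _ _ _ (S1 _ _ _ this)
    · have := hE c b a h3 h1
      rw [hg c b, hg c a, hg b a] at this
      exact S2 _ _ _ (S1 _ _ _ (S2 _ _ _ this))
  refine ⟨Finset.univ.image σ, ?_, ?_, fun i j => g (Function.invFun σ i) (Function.invFun σ j),
    fun i _ j _ => hg _ _, ?_, ?_⟩
  · intro x hx
    simp only [Finset.mem_image, Finset.mem_univ, true_and] at hx
    obtain ⟨a, rfl⟩ := hx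
    exact hI a
  · rw [Finset.card_image_of_injective _ hσ]; simp
  · intro i hi j hj hij
    simp only [Finset.mem_image, Finset.mem_univ, true_and] at hi hj
    obtain ⟨a, rfl⟩ := hi
    obtain ⟨b, rfl⟩ := hj
    simp only [inv]
    have hab : a ≠ b := fun h => hij (by rw [h])
    rcases lt_or_gt_of_ne hab with h | h
    · exact hP a b h
    · rw [hg, A.Psymm]; exact hP b a h
  · intro i hi j hj k hk h1 h2 h3
    simp only [Finset.mem_image, Finset.mem_univ, true_and] at hi hj hk
    obtain ⟨a, rfl⟩ := hi
    obtain ⟨b, rfl⟩ := hj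
    obtain ⟨c, rfl⟩ := hk
    simp only [inv]
    exact hE' a b c (fun h => h1 (by rw [h])) (fun h => h2 (by rw [h])) (fun h => h3 (by rw [h]))

lemma k5_make (A : ReducedHG) (i j k x y : ℕ) (hi : i ∈ A.I) (hj : j ∈ A.I) (hk : k ∈ A.I)
    (hx : x ∈ A.I) (hy : y ∈ A.I) (hd : [i, j, k, x, y].Nodup)
    (ij ik jk xi xj xk yi yj yk xy : ℕ)
    (m1 : ij ∈ A.P i j) (m2 : ik ∈ A.P i k) (m3 : jk ∈ A.P j k)
    (m4 : xi ∈ A.P x i) (m5 : xj ∈ A.P x j) (m6 : xk ∈ A.P x k)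
    (m7 : yi ∈ A.P y i) (m8 : yj ∈ A.P y j) (m9 : yk ∈ A.P y k) (m10 : xy ∈ A.P x y)
    (e1 : A.Edge ij ik jk)
    (e2 : A.Edge xi xj ij) (e3 : A.Edge xi xk ik) (e4 : A.Edge xj xk jk)
    (e5 : A.Edge yi yj ij) (e6 : A.Edge yi yk ik) (e7 : A.Edge yj yk jk)
    (e8 : A.Edge xi yi xy) (e9 : A.Edge xj yj xy) (e10 : A.Edge xk yk xy) :
    A.SupportsK5 := by
  apply k5_fin A (![x, y, i, j, k]) ?_ ?_ (![![0, xy, xi, xj, xk], ![xy, 0, yi, yj, yk],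
    ![xi, yi, 0, ij, ik], ![xj, yj, ij, 0, jk], ![xk, yk, ik, jk, 0]])
  · intro a b
    fin_cases a <;> fin_cases b <;> rfl
  · intro a b hab
    fin_cases a <;> fin_cases b <;> first | (exact absurd hab (by decide)) | assumption
  · intro a b c hab hbc
    have E2 := A.EdgeSymm'
    have E1 := A.EdgeSymm
    have e8' := E1 _ _ _ (E2 _ _ _ (E1 _ _ _ e8))
    have e8'' := E2 _ _ _ (E1 _ _ _ e8')
    have e9' := E1 _ _ _ (E2 _ _ _ (E1 _ _ _ e9))
    have e9'' := E2 _ _ _ (E1 _ _ _ e9')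
    have e10' := E1 _ _ _ (E2 _ _ _ (E1 _ _ _ e10))
    have e10'' := E2 _ _ _ (E1 _ _ _ e10')
    fin_cases a <;> fin_cases b <;> first | (exact absurd hab (by decide)) | skip
    all_goals fin_cases c <;> first | (exact absurd hbc (by decide)) | assumption | skip
    all_goals first | exact E1 _ _ _ ‹_› | exact E2 _ _ _ ‹_›
  · intro a b hab
    simp only [List.nodup_cons, List.mem_cons, List.not_mem_nil, or_false, not_or] at hd
    fin_cases a <;> fin_cases b <;> simp_all [Fin.ext_iff]
  · intro a
    fin_cases a <;> assumption

lemma ecount_eq (A : ReducedHG) (U V W : Finset ℕ) :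
    A.ecount U V W = ∑ t ∈ U ×ˢ V, (W.filter (fun c => A.Edge t.1 t.2 c)).card := by
  unfold ReducedHG.ecount
  simp only [Finset.card_filter, Finset.sum_product]

lemma ecount_comm12 (A : ReducedHG) (U V W : Finset ℕ) :
    A.ecount U V W = A.ecount V U W := by
  unfold ReducedHG.ecount
  apply Finset.card_bij (fun t _ => (t.2.1, t.1, t.2.2))
  · rintro ⟨a, b, c⟩ h
    simp only [Finset.mem_filter, Finset.mem_product] at h ⊢
    exact ⟨⟨h.1.2.1, h.1.1, h.1.2.2⟩, A.EdgeSymm _ _ _ h.2⟩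
  · rintro ⟨a, b, c⟩ h ⟨a', b', c'⟩ h' he
    simp only [Prod.mk.injEq] at he ⊢
    tauto
  · rintro ⟨a, b, c⟩ h
    simp only [Finset.mem_filter, Finset.mem_product] at h
    exact ⟨(b, a, c), by simp only [Finset.mem_filter, Finset.mem_product]; exact ⟨⟨h.1.2.1, h.1.1, h.1.2.2⟩, A.EdgeSymm _ _ _ h.2⟩, rfl⟩

lemma ecount_comm23 (A : ReducedHG) (U V W : Finset ℕ) :
    A.ecount U V W = A.ecount U W V := by
  unfold ReducedHG.ecount
  apply Finset.card_bij (fun t _ => (t.1, t.2.2, t.2.1))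
  · rintro ⟨a, b, c⟩ h
    simp only [Finset.mem_filter, Finset.mem_product] at h ⊢
    exact ⟨⟨h.1.1, h.1.2.2, h.1.2.1⟩, A.EdgeSymm' _ _ _ h.2⟩
  · rintro ⟨a, b, c⟩ h ⟨a', b', c'⟩ h' he
    simp only [Prod.mk.injEq] at he ⊢
    tauto
  · rintro ⟨a, b, c⟩ h
    simp only [Finset.mem_filter, Finset.mem_product] at h
    exact ⟨(a, c, b), by simp only [Finset.mem_filter, Finset.mem_product]; exact ⟨⟨h.1.1, h.1.2.2, h.1.2.1⟩, A.EdgeSymm' _ _ _ h.2⟩, rfl⟩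

lemma ecount_union_le1 (A : ReducedHG) (U U' V W : Finset ℕ) :
    A.ecount (U ∪ U') V W ≤ A.ecount U V W + A.ecount U' V W := by
  unfold ReducedHG.ecount
  rw [Finset.union_product, Finset.filter_union]
  exact Finset.card_union_le _ _

lemma ecount_markov (A : ReducedHG) (PU PV U V W : Finset ℕ) (ν τ q r p : ℝ)
    (hτ : 0 < τ) (hp : 0 < p)
    (h : (A.ecount U V W : ℝ) ≤ ν * (q * r * p)) :
    (((PU ×ˢ PV).filter (fun t => t.1 ∈ U ∧ t.2 ∈ V ∧
      τ * p < ((W.filter (fun c => A.Edge t.1 t.2 c)).card : ℝ))).card : ℝ) ≤ ν / τ * (q * r) := by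
  set D := (PU ×ˢ PV).filter (fun t => t.1 ∈ U ∧ t.2 ∈ V ∧
      τ * p < ((W.filter (fun c => A.Edge t.1 t.2 c)).card : ℝ)) with hD
  have hsub : D ⊆ U ×ˢ V := by
    intro t ht
    simp only [hD, Finset.mem_filter] at ht
    exact Finset.mem_product.2 ⟨ht.2.1, ht.2.2.1⟩
  have h1 : (D.card : ℝ) * (τ * p) ≤ (A.ecount U V W : ℝ) := by
    rw [ecount_eq, Nat.cast_sum, ← nsmul_eq_mul]
    refine (Finset.card_nsmul_le_sum D
      (fun t => ((W.filter (fun c => A.Edge t.1 t.2 c)).card : ℝ)) (τ * p) ?_).trans ?_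
    · intro t ht
      simp only [hD, Finset.mem_filter] at ht
      exact ht.2.2.2.le
    · exact Finset.sum_le_sum_of_subset_of_nonneg hsub (fun _ _ _ => by positivity)
  have h2 : (D.card : ℝ) * (τ * p) ≤ (ν / τ * (q * r)) * (τ * p) := by
    refine h1.trans (h.trans (le_of_eq ?_))
    field_simp
  exact le_of_mul_le_mul_right h2 (by positivity)

lemma ecount_many (A : ReducedHG) (U V W PU PV PW : Finset ℕ) (δ : ℝ)
    (hU : U ⊆ PU) (hV : V ⊆ PV) (hW : W ⊆ PW) (hp : 0 < (PW.card : ℝ)) (hδ : 0 < δ)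
    (h : δ * ((PU.card : ℝ) * PV.card * PW.card) ≤ (A.ecount U V W : ℝ)) :
    δ / 2 * ((PU.card : ℝ) * PV.card) ≤
    (((PU ×ˢ PV).filter (fun t => t.1 ∈ U ∧ t.2 ∈ V ∧
      δ / 2 * PW.card ≤ ((W.filter (fun c => A.Edge t.1 t.2 c)).card : ℝ))).card : ℝ) := by
  set D := (PU ×ˢ PV).filter (fun t => t.1 ∈ U ∧ t.2 ∈ V ∧
      δ / 2 * PW.card ≤ ((W.filter (fun c => A.Edge t.1 t.2 c)).card : ℝ)) with hD
  have h1 : (A.ecount U V W : ℝ) ≤ D.card * PW.card + δ / 2 * PW.card * (PU.card * PV.card) := by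
    rw [ecount_eq, Nat.cast_sum]
    calc ∑ t ∈ U ×ˢ V, ((W.filter (fun c => A.Edge t.1 t.2 c)).card : ℝ)
        ≤ ∑ t ∈ U ×ˢ V, ((if t ∈ D then (PW.card : ℝ) else 0) + δ / 2 * PW.card) := by
          apply Finset.sum_le_sum
          intro t ht
          rw [Finset.mem_product] at ht
          split_ifs with hc
          · have : ((W.filter (fun c => A.Edge t.1 t.2 c)).card : ℝ) ≤ PW.card := by
              exact_mod_cast Finset.card_le_card ((Finset.filter_subset _ _).trans hW)
            have : 0 ≤ δ / 2 * PW.card := by positivity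
            linarith
          · have : ¬ δ / 2 * PW.card ≤ ((W.filter (fun c => A.Edge t.1 t.2 c)).card : ℝ) := by
              intro hh
              apply hc
              rw [hD, Finset.mem_filter, Finset.mem_product]
              exact ⟨⟨hU ht.1, hV ht.2⟩, ht.1, ht.2, hh⟩
            linarith
      _ ≤ ∑ t ∈ PU ×ˢ PV, ((if t ∈ D then (PW.card : ℝ) else 0) + δ / 2 * PW.card) := by
          apply Finset.sum_le_sum_of_subset_of_nonneg (Finset.product_subset_product hU hV)
          intro t _ _
          split_ifs <;> positivity
      _ = _ := by
          rw [Finset.sum_add_distrib, Finset.sum_const, ← Finset.sum_filter, Finset.sum_const,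
            Finset.filter_mem_eq_inter, Finset.inter_eq_right.2 (Finset.filter_subset _ _)]
          simp only [nsmul_eq_mul, Finset.card_product]
          push_cast
          ring
  have h2 : (δ / 2 * ((PU.card : ℝ) * PV.card)) * PW.card ≤ D.card * PW.card := by
    nlinarith
  exact le_of_mul_le_mul_right h2 hp

lemma ecount_low (A : ReducedHG) (U V W : Finset ℕ) (q r p α1 α2 β τ γ : ℝ)
    (hq : 0 ≤ q) (hr : 0 ≤ r) (hp : 0 ≤ p) (hτ : 0 ≤ τ) (h1 : 0 ≤ α1) (h2 : 0 ≤ α2)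
    (hU : α1 * q ≤ (U.card : ℝ)) (hV : α2 * r ≤ (V.card : ℝ))
    (hB : (((U ×ˢ V).filter (fun t => ¬ τ * p ≤ ((W.filter (fun c => A.Edge t.1 t.2 c)).card : ℝ))).card : ℝ)
      ≤ β * (q * r)) (hγ : γ ≤ α1 * α2 - β) :
    γ * τ * (q * r * p) ≤ (A.ecount U V W : ℝ) := by
  set D := (U ×ˢ V).filter (fun t => τ * p ≤ ((W.filter (fun c => A.Edge t.1 t.2 c)).card : ℝ)) with hD
  have hc : (D.card : ℝ) + (((U ×ˢ V).filter (fun t => ¬ τ * p ≤ ((W.filter (fun c => A.Edge t.1 t.2 c)).card : ℝ))).card : ℝ) = U.card * V.card := by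
    rw [hD, ← Nat.cast_add, Finset.card_filter_add_card_filter_not, Finset.card_product,
      Nat.cast_mul]
  have hUV : α1 * α2 * (q * r) ≤ U.card * V.card := by
    calc α1 * α2 * (q * r) = (α1 * q) * (α2 * r) := by ring
      _ ≤ _ := by gcongr
  have hDl : γ * (q * r) ≤ D.card := by
    have := mul_le_mul_of_nonneg_right hγ (mul_nonneg hq hr)
    nlinarith
  have h3 : (D.card : ℝ) * (τ * p) ≤ (A.ecount U V W : ℝ) := by
    rw [ecount_eq, Nat.cast_sum, ← nsmul_eq_mul]
    refine (Finset.card_nsmul_le_sum D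
      (fun t => ((W.filter (fun c => A.Edge t.1 t.2 c)).card : ℝ)) (τ * p) ?_).trans ?_
    · intro t ht
      simp only [hD, Finset.mem_filter] at ht
      exact ht.2
    · exact Finset.sum_le_sum_of_subset_of_nonneg (Finset.filter_subset _ _)
        (fun _ _ _ => by positivity)
  have h4 := mul_le_mul_of_nonneg_right hDl (mul_nonneg hτ hp)
  calc γ * τ * (q * r * p) = γ * (q * r) * (τ * p) := by ring
    _ ≤ _ := h4.trans h3

lemma incl3 (P S T U : Finset ℕ) (ε : ℝ) (hS : S ⊆ P) (hT : T ⊆ P) (hU : U ⊆ P)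
    (cS : (1/3 + ε) * (P.card : ℝ) ≤ S.card) (cT : (1/3 + ε) * (P.card : ℝ) ≤ T.card)
    (cU : (1/3 + ε) * (P.card : ℝ) ≤ U.card)
    (h1 : ((S ∩ U).card : ℝ) ≤ ε * P.card) (h2 : ((T ∩ U).card : ℝ) ≤ ε * P.card) :
    ε * (P.card : ℝ) ≤ ((S ∩ T).card : ℝ) := by
  have a1 := Finset.card_union_add_card_inter S T
  have a2 := Finset.card_union_add_card_inter (S ∪ T) U
  have a3 : ((S ∪ T) ∩ U).card ≤ (S ∩ U).card + (T ∩ U).card := by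
    rw [Finset.union_inter_distrib_right]; exact Finset.card_union_le _ _
  have a4 : ((S ∪ T) ∪ U).card ≤ P.card :=
    Finset.card_le_card (Finset.union_subset (Finset.union_subset hS hT) hU)
  have a1' : ((S ∪ T).card : ℝ) + (S ∩ T).card = S.card + T.card := by exact_mod_cast a1
  have a2' : (((S ∪ T) ∪ U).card : ℝ) + ((S ∪ T) ∩ U).card = (S ∪ T).card + U.card := by
    exact_mod_cast a2
  have a3' : (((S ∪ T) ∩ U).card : ℝ) ≤ (S ∩ U).card + (T ∩ U).card := by exact_mod_cast a3
  have a4' : (((S ∪ T) ∪ U).card : ℝ) ≤ P.card := by exact_mod_cast a4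
  linarith

lemma nbhd_sub (A : ReducedHG) (j k a b : ℕ) : A.nbhd j k a b ⊆ A.P j k :=
  Finset.filter_subset _ _

lemma nbhd_inter (A : ReducedHG) (j k a b : ℕ) (S : Finset ℕ) (hS : S ⊆ A.P j k) :
    A.nbhd j k a b ∩ S = S.filter (fun c => A.Edge a b c) := by
  ext c
  simp only [ReducedHG.nbhd, Finset.mem_inter, Finset.mem_filter]
  constructor
  · rintro ⟨⟨_, h⟩, h2⟩; exact ⟨h2, h⟩
  · rintro ⟨h, h2⟩; exact ⟨⟨hS h, h2⟩, h⟩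

/-- pigeonhole: many dense subsets, two intersect. -/
lemma pig {α : Type} (X : Finset ℕ) (P : Finset α) (N : ℕ → Finset α) (δ : ℝ)
    (hX : 1 < δ * X.card) (hP : P.Nonempty) (hN : ∀ x ∈ X, N x ⊆ P)
    (hc : ∀ x ∈ X, δ * (P.card : ℝ) ≤ (N x).card) :
    ∃ x ∈ X, ∃ y ∈ X, x ≠ y ∧ ∃ c, c ∈ N x ∧ c ∈ N y := by
  by_contra hcon
  push Not at hcon
  have hdis : ∀ x ∈ X, ∀ y ∈ X, x ≠ y → Disjoint (N x) (N y) := by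
    intro x hx y hy hxy
    rw [Finset.disjoint_left]
    exact hcon x hx y hy hxy
  have h1 := Finset.card_biUnion hdis
  have h2 : (X.biUnion N).card ≤ P.card := Finset.card_le_card (Finset.biUnion_subset.2 hN)
  have h3 : (∑ x ∈ X, ((N x).card : ℝ)) ≤ P.card := by
    rw [← Nat.cast_sum, ← h1]; exact_mod_cast h2
  have h4 := Finset.card_nsmul_le_sum X (fun x => ((N x).card : ℝ)) (δ * P.card) hc
  rw [nsmul_eq_mul] at h4
  have hp : (0 : ℝ) < P.card := by exact_mod_cast hP.card_pos
  nlinarith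

lemma step1 (ε δ : ℝ) (hε : 0 < ε) (hδ : 0 < δ) : ∃ r m : ℕ,
    ∀ A : ReducedHG, A.Wicked ε → ∀ i ∈ A.I, ∀ X M : Finset ℕ, X ⊆ A.I → M ⊆ A.I →
    i ∉ X → i ∉ M → Disjoint X M → r ≤ X.card → m ≤ M.card →
    ∀ (S : ℕ → ℕ → Finset ℕ) (v : ℕ → ℕ → ℕ),
    (∀ x ∈ X, ∀ y ∈ X, x ≠ y → S x y ⊆ A.P x y ∧
      (1/3 + ε) * ((A.P x y).card : ℝ) ≤ (S x y).card) →
    (∀ x ∈ X, ∀ j, (j = i ∨ j ∈ M) → v x j ∈ A.P x j) →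
    (∀ x ∈ X, ∀ y ∈ X, x ≠ y → ∀ j, (j = i ∨ j ∈ M) →
      (((S x y).filter (fun c => A.Edge (v x j) (v y j) c)).card : ℝ) ≤ ε * (A.P x y).card) →
    (∀ x ∈ X, ∀ j ∈ M, ∀ k ∈ M, j < k →
      δ * (((A.P i j).card : ℝ) * (A.P i k).card * (A.P j k).card) ≤
        (A.ecount (A.nbhd i j (v x i) (v x j)) (A.nbhd i k (v x i) (v x k))
          (A.nbhd j k (v x j) (v x k)) : ℝ)) → False := by
  obtain ⟨r, hr⟩ := exists_nat_gt (1 / δ)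
  obtain ⟨n0, hn0⟩ := exists_nat_gt (1 / ε)
  obtain ⟨m, hm⟩ := rs_two (β := Finset (ℕ × ℕ)) (2 ^ (r * r)) (n0 + 2)
  refine ⟨r, m, ?_⟩
  intro A hA i hi X0 M hX0 hM hiX0 hiM hdis0 hrX0 hmM S v hS0 hv0 hdeg0 he0
  obtain ⟨X, hXX, cX⟩ := Finset.exists_subset_card_eq hrX0
  have hX : X ⊆ A.I := hXX.trans hX0
  have hiX : i ∉ X := fun h => hiX0 (hXX h)
  have hdis : Disjoint X M := Disjoint.mono_left hXX hdis0
  let good : ℕ → ℕ → ℕ → ℕ × ℕ × ℕ → Prop := fun j k x t =>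
    t.1 ∈ A.nbhd i j (v x i) (v x j) ∧ t.2.1 ∈ A.nbhd i k (v x i) (v x k) ∧
      t.2.2 ∈ A.nbhd j k (v x j) (v x k) ∧ A.Edge t.1 t.2.1 t.2.2
  let χ : ℕ → ℕ → Finset (ℕ × ℕ) := fun j k => (X ×ˢ X).filter (fun q => q.1 ≠ q.2 ∧
    ∃ t, good j k q.1 t ∧ good j k q.2 t)
  obtain ⟨H, hHM, cH, b, hb, hmono⟩ := hm (X ×ˢ X).powerset
    (by rw [Finset.card_powerset, Finset.card_product, cX]) χ
    (fun a b => Finset.mem_powerset.2 (Finset.filter_subset _ _)) M hmM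
  have hmono' : ∀ j ∈ H, ∀ k ∈ H, j < k → χ j k = b := fun j hj k hk hjk =>
    hmono j hj k (Finset.mem_filter.2 ⟨hk, hjk⟩)
  -- two elements of H
  have : ∃ j ∈ H, ∃ k ∈ H, j < k := by
    obtain ⟨j, hj, k, hk, hjk⟩ := Finset.one_lt_card.1 (show 1 < H.card by omega)
    rcases lt_or_gt_of_ne hjk with h | h
    · exact ⟨j, hj, k, hk, h⟩
    · exact ⟨k, hk, j, hj, h⟩
  obtain ⟨j0, hj0, k0, hk0, hjk0⟩ := this
  have nei : ∀ j ∈ M, i ≠ j := fun j hj h => hiM (h ▸ hj)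
  have nex : ∀ x ∈ X, ∀ j ∈ M, x ≠ j := fun x hx j hj h => Finset.disjoint_left.1 hdis hx (h ▸ hj)
  have nxi : ∀ x ∈ X, x ≠ i := fun x hx h => hiX (h ▸ hx)
  obtain ⟨x, hx, y, hy, hxy, t0, ht0⟩ := pig X (A.P i j0 ×ˢ A.P i k0 ×ˢ A.P j0 k0)
    (fun x => (A.nbhd i j0 (v x i) (v x j0) ×ˢ A.nbhd i k0 (v x i) (v x k0) ×ˢ
          A.nbhd j0 k0 (v x j0) (v x k0)).filter fun t => A.Edge t.1 t.2.1 t.2.2) δ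
    (by rw [cX]; rw [div_lt_iff₀ hδ] at hr; linarith)
    (by
      have a1 := A.Pnonempty i j0 hi (hM (hHM hj0)) (nei _ (hHM hj0))
      have a2 := A.Pnonempty i k0 hi (hM (hHM hk0)) (nei _ (hHM hk0))
      have a3 := A.Pnonempty j0 k0 (hM (hHM hj0)) (hM (hHM hk0)) hjk0.ne
      exact a1.product (a2.product a3))
    (by
      intro x hx
      refine (Finset.filter_subset _ _).trans ?_
      exact Finset.product_subset_product (nbhd_sub _ _ _ _ _)
        (Finset.product_subset_product (nbhd_sub _ _ _ _ _) (nbhd_sub _ _ _ _ _)))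
    (by
      intro x hx
      have := he0 x (hXX hx) j0 (hHM hj0) k0 (hHM hk0) hjk0
      rw [Finset.card_product, Finset.card_product]
      push_cast
      rw [← mul_assoc ((A.P i j0).card : ℝ)]
      exact this)
  have hgoodxy : (x, y) ∈ b := by
    rw [← hmono' j0 hj0 k0 hk0 hjk0]
    simp only [χ, Finset.mem_filter, Finset.mem_product]
    refine ⟨⟨hx, hy⟩, hxy, t0, ?_, ?_⟩
    · have := ht0.1
      simp only [Finset.mem_filter, Finset.mem_product] at this
      exact ⟨this.1.1, this.1.2.1, this.1.2.2, this.2⟩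
    · have := ht0.2
      simp only [Finset.mem_filter, Finset.mem_product] at this
      exact ⟨this.1.1, this.1.2.1, this.1.2.2, this.2⟩
  have hPxy := A.Pnonempty x y (hX hx) (hX hy) hxy
  obtain ⟨hSsub, hSc⟩ := hS0 x (hXX hx) y (hXX hy) hxy
  have hdens : ∀ j, (j = i ∨ j ∈ M) → (1/3 + ε) * ((A.P x y).card : ℝ) ≤
      (A.nbhd x y (v x j) (v y j)).card := by
    intro j hj
    have hjI : j ∈ A.I := by rcases hj with rfl | h; exacts [hi, hM h]
    have hxj : x ≠ j := by rcases hj with rfl | h; exacts [nxi x hx, nex x hx j h]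
    have hyj : y ≠ j := by rcases hj with rfl | h; exacts [nxi y hy, nex y hy j h]
    exact hA.1 j x y hjI (hX hx) (hX hy) hxj.symm hyj.symm hxy _
      (A.Psymm x j ▸ hv0 x (hXX hx) j hj) _ (A.Psymm y j ▸ hv0 y (hXX hy) j hj)
  have hdeg : ∀ j, (j = i ∨ j ∈ M) →
      ((A.nbhd x y (v x j) (v y j) ∩ S x y).card : ℝ) ≤ ε * (A.P x y).card := by
    intro j hj
    rw [nbhd_inter _ _ _ _ _ _ hSsub]
    exact hdeg0 x (hXX hx) y (hXX hy) hxy j hj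
  obtain ⟨j, hj, k, hk, hjk, c, hcj, hck⟩ := pig H (A.P x y)
    (fun j => A.nbhd x y (v x i) (v y i) ∩ A.nbhd x y (v x j) (v y j)) ε
    (by
      rw [div_lt_iff₀ hε] at hn0
      have : (n0 : ℝ) ≤ H.card := by exact_mod_cast (by omega)
      nlinarith)
    hPxy (fun j _ => Finset.inter_subset_left.trans (nbhd_sub _ _ _ _ _))
    (fun j hj => incl3 (A.P x y) _ _ (S x y) ε (nbhd_sub _ _ _ _ _) (nbhd_sub _ _ _ _ _) hSsub
      (hdens i (Or.inl rfl)) (hdens j (Or.inr (hHM hj))) hSc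
      (hdeg i (Or.inl rfl)) (hdeg j (Or.inr (hHM hj))))
  wlog hlt : j < k generalizing j k
  · exact this k hk j hj hjk.symm hck hcj (lt_of_le_of_ne (not_lt.1 hlt) hjk.symm)
  have hxyb := hgoodxy
  rw [← hmono' j hj k hk hlt] at hxyb
  simp only [χ, Finset.mem_filter, Finset.mem_product] at hxyb
  obtain ⟨-, -, ⟨ij, ik, jk⟩, ⟨a1, a2, a3, a4⟩, b1, b2, b3, b4⟩ := hxyb
  simp only [ReducedHG.nbhd, Finset.mem_filter, Finset.mem_inter] at a1 a2 a3 b1 b2 b3 hcj hck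
  have hjM := hHM hj
  have hkM := hHM hk
  apply hA.2
  refine k5_make A i j k x y hi (hM hjM) (hM hkM) (hX hx) (hX hy) ?_ ij ik jk (v x i) (v x j)
    (v x k) (v y i) (v y j) (v y k) c a1.1 a2.1 a3.1 (hv0 x (hXX hx) i (Or.inl rfl))
    (hv0 x (hXX hx) j (Or.inr hjM)) (hv0 x (hXX hx) k (Or.inr hkM))
    (hv0 y (hXX hy) i (Or.inl rfl))
    (hv0 y (hXX hy) j (Or.inr hjM)) (hv0 y (hXX hy) k (Or.inr hkM)) hcj.1.1 a4 a1.2 a2.2 a3.2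
    b1.2 b2.2 b3.2 hcj.1.2 hcj.2.2 hck.2.2
  have n1 := nei j hjM
  have n2 := nei k hkM
  have n3 := nex x hx j hjM
  have n4 := nex x hx k hkM
  have n5 := nex y hy j hjM
  have n6 := nex y hy k hkM
  have n7 := nxi x hx
  have n8 := nxi y hy
  simp only [List.nodup_cons, List.mem_cons, List.not_mem_nil, or_false, not_or, not_false_iff, List.nodup_nil, and_true]
  exact ⟨⟨n1, n2, n7.symm, n8.symm⟩, ⟨hjk, n3.symm, n5.symm⟩, ⟨n4.symm, n6.symm⟩, hxy⟩

lemma ecount_mono (A : ReducedHG) {U V W U' V' W' : Finset ℕ} (h1 : U ⊆ U') (h2 : V ⊆ V')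
    (h3 : W ⊆ W') : A.ecount U V W ≤ A.ecount U' V' W' := by
  unfold ReducedHG.ecount
  apply Finset.card_le_card
  apply Finset.filter_subset_filter
  exact Finset.product_subset_product h1 (Finset.product_subset_product h2 h3)

lemma Ppos (A : ReducedHG) {i j : ℕ} (hi : i ∈ A.I) (hj : j ∈ A.I) (h : i ≠ j) :
    (0 : ℝ) < (A.P i j).card := by
  exact_mod_cast (A.Pnonempty i j hi hj h).card_pos

/-- the degree of most pairs into a link -/
lemma low_of_hole (A : ReducedHG) (ε β ν α1 α2 γ : ℝ) (hε : 0 < ε) (hA : A.EEDense (1/3 + ε))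
    (i j k : ℕ) (hi : i ∈ A.I) (hj : j ∈ A.I) (hk : k ∈ A.I) (hij : i ≠ j) (hik : i ≠ k)
    (hjk : j ≠ k) (U V U' V' W T : Finset ℕ) (hU : U ⊆ U') (hV : V ⊆ V')
    (hU' : U' ⊆ A.P i j) (hV' : V' ⊆ A.P i k) (hW : W ⊆ A.P j k) (hT : T ⊆ A.P j k)
    (cU : α1 * ((A.P i j).card : ℝ) ≤ U.card) (cV : α2 * ((A.P i k).card : ℝ) ≤ V.card)
    (h1 : 0 ≤ α1) (h2 : 0 ≤ α2)
    (cW : (1/3 + ε) * ((A.P j k).card : ℝ) ≤ W.card)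
    (cT : (1/3 + ε) * ((A.P j k).card : ℝ) ≤ T.card)
    (hWT : ((W ∩ T).card : ℝ) ≤ ε * (A.P j k).card)
    (hole : (A.ecount U' V' T : ℝ) ≤ ν *
      (((A.P i j).card : ℝ) * (A.P i k).card * (A.P j k).card))
    (hβ : ν ≤ β * ε) (hγ : γ ≤ α1 * α2 - β) :
    γ * ε * (((A.P i j).card : ℝ) * (A.P i k).card * (A.P j k).card) ≤ (A.ecount U V W : ℝ) := by
  refine ecount_low A U V W _ _ _ α1 α2 β ε γ (by positivity) (by positivity) (by positivity)
    hε.le h1 h2 cU cV ?_ hγ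
  have hm := ecount_markov A (A.P i j) (A.P i k) U' V' T ν ε _ _ _ hε (Ppos A hj hk hjk) hole
  have hνβ : ν / ε ≤ β := by rw [div_le_iff₀ hε]; exact hβ
  refine le_trans ?_ (hm.trans (mul_le_mul_of_nonneg_right hνβ (by positivity)))
  norm_cast
  apply Finset.card_le_card
  intro t ht
  rw [Finset.mem_filter, Finset.mem_product] at ht ⊢
  obtain ⟨⟨ht1, ht2⟩, ht3⟩ := ht
  refine ⟨⟨hU' (hU ht1), hV' (hV ht2)⟩, hU ht1, hV ht2, ?_⟩
  by_contra hcon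
  apply ht3
  rw [← nbhd_inter A j k t.1 t.2 W hW]
  refine incl3 (A.P j k) _ _ T ε (nbhd_sub _ _ _ _ _) hW hT
    (hA i j k hi hj hk hij hik hjk _ (hU' (hU ht1)) _ (hV' (hV ht2))) cW cT ?_ hWT
  rw [nbhd_inter A j k t.1 t.2 T hT]
  exact not_lt.1 hcon

lemma step2 (ε δ : ℝ) (hε : 0 < ε) (hδ : 0 < δ) : ∃ ν : ℝ, 0 < ν ∧ ∃ s : ℕ,
    ∀ A : ReducedHG, A.Wicked ε → ∀ X K L : Finset ℕ, X ⊆ A.I → K ⊆ A.I → L ⊆ A.I →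
    Disjoint X K → Disjoint X L → Disjoint K L → s ≤ X.card → s ≤ K.card → s ≤ L.card →
    ∀ (F G : ℕ → ℕ → Finset ℕ), (∀ a b, F a b ⊆ A.P a b) → (∀ a b, G a b ⊆ A.P a b) →
    (∀ x ∈ X, ∀ y ∈ X, x ≠ y → ∀ j ∈ K ∪ L, (A.ecount (F x j) (F y j) (F x y) : ℝ) ≤
      ν * (((A.P x j).card : ℝ) * (A.P y j).card * (A.P x y).card)) →
    (∀ i ∈ X ∪ K, ∀ j ∈ L, ∀ k ∈ L, j < k → (A.ecount (G i j) (G i k) (G j k) : ℝ) ≤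
      ν * (((A.P i j).card : ℝ) * (A.P i k).card * (A.P j k).card)) →
    (∀ x ∈ X, ∀ y ∈ X, x ≠ y → (1/3 + ε) * ((A.P x y).card : ℝ) ≤ (F x y).card) →
    (∀ j ∈ L, ∀ k ∈ L, j < k → (1/3 + ε) * ((A.P j k).card : ℝ) ≤ (G j k).card) →
    (∀ x ∈ X, ∀ i ∈ K, ∀ j ∈ L,
      δ * (((A.P x i).card : ℝ) * (A.P x j).card * (A.P i j).card) ≤
        (A.ecount (F x i) (F x j ∩ G x j) (G i j) : ℝ)) → False := by
  obtain ⟨r, m, hs1⟩ := step1 ε ((δ / 2 * (δ / 2) / 2) * ε) hε (by positivity)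
  obtain ⟨s, η, hη, hsel⟩ := sel_main (δ / 2) (by positivity) r 1 (m + 1)
  set ν := min (η * ε) ((δ / 2 * (δ / 2) / 2) * ε) with hν
  have hν1 : ν / ε ≤ η := by rw [div_le_iff₀ hε]; exact min_le_left _ _
  have hν2 : ν ≤ (δ / 2 * (δ / 2) / 2) * ε := min_le_right _ _
  refine ⟨ν, lt_min (by positivity) (by positivity), s, ?_⟩
  intro A hA X K L hX hK hL dXK dXL dKL sX sK sL F G hF hG hF1 hG1 wF wG hbig
  have nXK : ∀ x ∈ X, ∀ i ∈ K, x ≠ i := fun x hx i hi h => Finset.disjoint_left.1 dXK hx (h ▸ hi)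
  have nXL : ∀ x ∈ X, ∀ i ∈ L, x ≠ i := fun x hx i hi h => Finset.disjoint_left.1 dXL hx (h ▸ hi)
  have nKL : ∀ x ∈ K, ∀ i ∈ L, x ≠ i := fun x hx i hi h => Finset.disjoint_left.1 dKL hx (h ▸ hi)
  have nXKL : ∀ x ∈ X, ∀ j ∈ K ∪ L, x ≠ j := by
    intro x hx j hj
    rcases Finset.mem_union.1 hj with h | h
    exacts [nXK x hx j h, nXL x hx j h]
  have hKLI : K ∪ L ⊆ A.I := Finset.union_subset hK hL
  obtain ⟨X', hX', K', hK', L', hL', cX', cK', cL', v, hv, hgood, hbad⟩ := hsel A.P X K L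
    (fun x i j u w => u ∈ F x i ∧ w ∈ F x j ∩ G x j ∧
      δ / 2 * (A.P i j).card ≤ (((G i j).filter (fun c => A.Edge u w c)).card : ℝ))
    (fun x j y k u w =>
      (j = k ∧ x ≠ y ∧ u ∈ F x j ∧ w ∈ F y k ∧
        ε * (A.P x y).card < (((F x y).filter (fun c => A.Edge u w c)).card : ℝ)) ∨
      (x = y ∧ j < k ∧ j ∈ L ∧ k ∈ L ∧ u ∈ G x j ∧ w ∈ G y k ∧
        ε * (A.P j k).card < (((G j k).filter (fun c => A.Edge u w c)).card : ℝ)))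
    sX sK sL dKL
    (fun x hx j hj => A.Pnonempty x j (hX hx) (hKLI hj) (nXKL x hx j hj))
    (by
      intro x hx i hi j hj
      have := ecount_many A (F x i) (F x j ∩ G x j) (G i j) (A.P x i) (A.P x j) (A.P i j) δ
        (hF _ _) (Finset.inter_subset_left.trans (hF _ _)) (hG _ _)
        (Ppos A (hK hi) (hL hj) (nKL i hi j hj)) hδ (hbig x hx i hi j hj)
      convert this)
    (by
      intro x hx y hy j hj k hk hne
      by_cases hjk : j = k
      · subst hjk
        have hxy : x ≠ y := by tauto
        have := ecount_markov A (A.P x j) (A.P y j) (F x j) (F y j) (F x y) ν ε _ _ _ hε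
          (Ppos A (hX hx) (hX hy) hxy) (hF1 x hx y hy hxy j hj)
        refine le_trans ?_ (this.trans (mul_le_mul_of_nonneg_right hν1 (by positivity)))
        norm_cast
        apply Finset.card_le_card
        intro t ht
        rw [Finset.mem_filter] at ht ⊢
        refine ⟨ht.1, ?_⟩
        rcases ht.2 with h | h
        · exact h.2.2
        · exact absurd h.2.1 (lt_irrefl _)
      · by_cases hc : x = y ∧ j < k ∧ j ∈ L ∧ k ∈ L
        · obtain ⟨rfl, hlt, hjL, hkL⟩ := hc
          have := ecount_markov A (A.P x j) (A.P x k) (G x j) (G x k) (G j k) ν ε _ _ _ hε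
            (Ppos A (hL hjL) (hL hkL) hjk)
            (hG1 x (Finset.mem_union_left _ hx) j hjL k hkL hlt)
          refine le_trans ?_ (this.trans (mul_le_mul_of_nonneg_right hν1 (by positivity)))
          norm_cast
          apply Finset.card_le_card
          intro t ht
          rw [Finset.mem_filter] at ht ⊢
          refine ⟨ht.1, ?_⟩
          rcases ht.2 with h | h
          · exact absurd h.1 hjk
          · exact h.2.2.2.2
        · refine le_trans (b := ((∅ : Finset (ℕ × ℕ)).card : ℝ)) ?_
            (by simp only [Finset.card_empty, Nat.cast_zero]; positivity)
          norm_cast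
          apply Finset.card_le_card
          intro t ht
          rw [Finset.mem_filter] at ht
          rcases ht.2 with h | h
          · exact absurd h.1 hjk
          · exact absurd ⟨h.1, h.2.1, h.2.2.1, h.2.2.2.1⟩ hc)
  obtain ⟨i, rfl⟩ := Finset.card_eq_one.1 cK'
  have hiK : i ∈ K := hK' (Finset.mem_singleton_self i)
  have hi' : i ∈ ({i} : Finset ℕ) := Finset.mem_singleton_self i
  obtain ⟨j0, hj0⟩ : L'.Nonempty := by rw [← Finset.card_pos]; omega
  have hmem : ∀ j, (j = i ∨ j ∈ L') → j ∈ ({i} : Finset ℕ) ∪ L' := by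
    intro j hj
    simpa using hj
  have hvF : ∀ x ∈ X', ∀ j, (j = i ∨ j ∈ L') → v x j ∈ F x j := by
    intro x hx j hj
    rcases hj with rfl | hj
    · exact (hgood x hx j hi' j0 hj0).1
    · exact (Finset.mem_inter.1 (hgood x hx i hi' j hj).2.1).1
  have hvG : ∀ x ∈ X', ∀ j ∈ L', v x j ∈ G x j := by
    intro x hx j hj
    exact (Finset.mem_inter.1 (hgood x hx i hi' j hj).2.1).2
  refine hs1 A hA i (hK hiK) X' L' (hX'.trans hX) (hL'.trans hL)
    (fun h => nXK i (hX' h) i hiK rfl) (fun h => nKL i hiK i (hL' h) rfl)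
    (Disjoint.mono hX' hL' dXL) cX'.ge (by omega) F v
    (fun x hx y hy hxy => ⟨hF _ _, wF x (hX' hx) y (hX' hy) hxy⟩)
    (fun x hx j hj => hv x hx j (hmem j hj)) ?_ ?_
  · intro x hx y hy hxy j hj
    have := hbad x hx y hy j (hmem j hj) j (hmem j hj) (Or.inl hxy)
    by_contra hcon
    exact this (Or.inl ⟨rfl, hxy, hvF x hx j hj, hvF y hy j hj, not_le.1 hcon⟩)
  · intro x hx j hj k hk hjk
    have hjL := hL' hj
    have hkL := hL' hk
    have hxX := hX' hx
    have hnb := hbad x hx x hx j (hmem j (Or.inr hj)) k (hmem k (Or.inr hk)) (Or.inr hjk.ne)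
    have hW : ((A.nbhd j k (v x j) (v x k) ∩ G j k).card : ℝ) ≤ ε * (A.P j k).card := by
      rw [nbhd_inter _ _ _ _ _ _ (hG j k)]
      by_contra hcon
      exact hnb (Or.inr ⟨rfl, hjk, hjL, hkL, hvG x hx j hj, hvG x hx k hk, not_le.1 hcon⟩)
    have hlow := low_of_hole A ε (δ / 2 * (δ / 2) / 2) ν (δ / 2) (δ / 2) (δ / 2 * (δ / 2) / 2) hε
      hA.1 i j k (hK hiK) (hL hjL) (hL hkL) (nKL i hiK j hjL) (nKL i hiK k hkL) hjk.ne
      ((G i j).filter (fun c => A.Edge (v x i) (v x j) c))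
      ((G i k).filter (fun c => A.Edge (v x i) (v x k) c)) (G i j) (G i k)
      (A.nbhd j k (v x j) (v x k)) (G j k) (Finset.filter_subset _ _) (Finset.filter_subset _ _)
      (hG _ _) (hG _ _) (nbhd_sub _ _ _ _ _) (hG _ _)
      (hgood x hx i hi' j hj).2.2 (hgood x hx i hi' k hk).2.2 (by positivity) (by positivity)
      (hA.1 x j k (hX hxX) (hL hjL) (hL hkL) (nXL x hxX j hjL) (nXL x hxX k hkL) hjk.ne _
        (hF _ _ (hvF x hx j (Or.inr hj))) _ (hF _ _ (hvF x hx k (Or.inr hk))))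
      (wG j hjL k hkL hjk) hW (hG1 i (Finset.mem_union_right _ hiK) j hjL k hkL hjk)
      hν2 (by linarith)
    refine hlow.trans ?_
    norm_cast
    apply ecount_mono
    · exact Finset.filter_subset_filter _ (hG _ _)
    · exact Finset.filter_subset_filter _ (hG _ _)
    · exact subset_rfl

set_option maxHeartbeats 2000000 in
lemma step3 (ε δ : ℝ) (hε : 0 < ε) (hδ : 0 < δ) : ∃ ν : ℝ, 0 < ν ∧ ∃ s : ℕ,
    ∀ A : ReducedHG, A.Wicked ε → ∀ Z K L U : Finset ℕ, U ⊆ A.I → Z ⊆ U → K ⊆ U → L ⊆ U →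
    Disjoint Z K → Disjoint Z L → Disjoint K L → s ≤ Z.card → s ≤ K.card → s ≤ L.card →
    ∀ (F G : ℕ → ℕ → Finset ℕ), (∀ a b, F a b ⊆ A.P a b) → (∀ a b, G a b ⊆ A.P a b) →
    (∀ a b, F a b = F b a) → (∀ a b, G a b = G b a) →
    (∀ a ∈ U, ∀ b ∈ U, ∀ c ∈ U, a ≠ b → a ≠ c → b ≠ c →
      (A.ecount (F a b) (F a c) (F b c) : ℝ) ≤
      ν * (((A.P a b).card : ℝ) * (A.P a c).card * (A.P b c).card)) →
    (∀ a ∈ U, ∀ b ∈ U, ∀ c ∈ U, a ≠ b → a ≠ c → b ≠ c →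
      (A.ecount (G a b) (G a c) (G b c) : ℝ) ≤
      ν * (((A.P a b).card : ℝ) * (A.P a c).card * (A.P b c).card)) →
    (∀ a ∈ U, ∀ b ∈ U, ∀ c ∈ U, a ≠ b → a ≠ c → b ≠ c →
      (A.ecount (F a b) (F a c ∩ G a c) (G b c) : ℝ) ≤
      ν * (((A.P a b).card : ℝ) * (A.P a c).card * (A.P b c).card)) →
    (∀ a ∈ U, ∀ b ∈ U, a ≠ b → (1/3 + ε) * ((A.P a b).card : ℝ) ≤ (F a b).card) →
    (∀ a ∈ U, ∀ b ∈ U, a ≠ b → (1/3 + ε) * ((A.P a b).card : ℝ) ≤ (G a b).card) →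
    (∀ a ∈ U, ∀ b ∈ U, a ≠ b → ε * ((A.P a b).card : ℝ) ≤ (F a b ∩ G a b).card) →
    (∀ z ∈ Z, ∀ i ∈ K, ∀ j ∈ L,
      δ * (((A.P z i).card : ℝ) * (A.P z j).card * (A.P i j).card) ≤
        (A.ecount (F z i) (F z j) (G i j) : ℝ)) → False := by
  obtain ⟨ν2, hν2, s2, hstep2⟩ := step2 ε (ε * δ / 4 * ε) hε (by positivity)
  obtain ⟨r, m, hs1⟩ := step1 ε ν2 hε hν2
  set κ := r * (2 * s2) + 1 with hκ
  obtain ⟨N, hN⟩ := rs_two (β := Finset (ℕ × ℕ)) (2 ^ (κ * r)) (m + s2)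
  obtain ⟨s, η, hη, hsel⟩ := sel_main (δ / 2) (by positivity) r κ (N + 1)
  set ν := min (min (η * ε) ν2) ((ε * δ / 4) * ε) with hν
  have hνa : ν / ε ≤ η := by
    rw [div_le_iff₀ hε]; exact (min_le_left _ _).trans (min_le_left _ _)
  have hνb : ν ≤ ν2 := (min_le_left _ _).trans (min_le_right _ _)
  have hνc : ν ≤ (ε * δ / 4) * ε := min_le_right _ _
  refine ⟨ν, lt_min (lt_min (by positivity) hν2) (by positivity), s, ?_⟩
  intro A hA Z K L U hU hZ hK hL dZK dZL dKL sZ sK sL F G hF hG symF symG holeF holeG hT wF wG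
    hint hbig
  have nZK : ∀ x ∈ Z, ∀ i ∈ K, x ≠ i := fun x hx i hi h => Finset.disjoint_left.1 dZK hx (h ▸ hi)
  have nZL : ∀ x ∈ Z, ∀ i ∈ L, x ≠ i := fun x hx i hi h => Finset.disjoint_left.1 dZL hx (h ▸ hi)
  have nKL : ∀ x ∈ K, ∀ i ∈ L, x ≠ i := fun x hx i hi h => Finset.disjoint_left.1 dKL hx (h ▸ hi)
  have nZKL : ∀ x ∈ Z, ∀ j ∈ K ∪ L, x ≠ j := by
    intro x hx j hj
    rcases Finset.mem_union.1 hj with h | h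
    exacts [nZK x hx j h, nZL x hx j h]
  have hKLU : K ∪ L ⊆ U := Finset.union_subset hK hL
  obtain ⟨Z', hZ', K', hK', L', hL', cZ', cK', cL', v, hv, hgood, hbad⟩ := hsel A.P Z K L
    (fun x i j u w => u ∈ F x i ∧ w ∈ F x j ∧
      δ / 2 * (A.P i j).card ≤ (((G i j).filter (fun c => A.Edge u w c)).card : ℝ))
    (fun x j y k u w =>
      (j = k ∧ x ≠ y ∧ u ∈ F x j ∧ w ∈ F y k ∧
        ε * (A.P x y).card < (((F x y).filter (fun c => A.Edge u w c)).card : ℝ)) ∨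
      (x = y ∧ j ≠ k ∧ u ∈ F x j ∧ w ∈ F y k ∧
        ε * (A.P j k).card < (((F j k).filter (fun c => A.Edge u w c)).card : ℝ)))
    sZ sK sL dKL
    (fun x hx j hj => A.Pnonempty x j (hU (hZ hx)) (hU (hKLU hj)) (nZKL x hx j hj))
    (by
      intro x hx i hi j hj
      have := ecount_many A (F x i) (F x j) (G i j) (A.P x i) (A.P x j) (A.P i j) δ
        (hF _ _) (hF _ _) (hG _ _)
        (Ppos A (hU (hK hi)) (hU (hL hj)) (nKL i hi j hj)) hδ (hbig x hx i hi j hj)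
      convert this)
    (by
      intro x hx y hy j hj k hk hne
      by_cases hjk : j = k
      · subst hjk
        have hxy : x ≠ y := by tauto
        have hh := holeF j (hKLU hj) x (hZ hx) y (hZ hy) (nZKL x hx j hj).symm
          (nZKL y hy j hj).symm hxy
        rw [symF j x, symF j y, A.Psymm j x, A.Psymm j y] at hh
        have := ecount_markov A (A.P x j) (A.P y j) (F x j) (F y j) (F x y) ν ε _ _ _ hε
          (Ppos A (hU (hZ hx)) (hU (hZ hy)) hxy) hh
        refine le_trans ?_ (this.trans (mul_le_mul_of_nonneg_right hνa (by positivity)))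
        norm_cast
        apply Finset.card_le_card
        intro t ht
        rw [Finset.mem_filter] at ht ⊢
        refine ⟨ht.1, ?_⟩
        rcases ht.2 with h | h
        · exact h.2.2
        · exact absurd rfl h.2.1
      · by_cases hc : x = y
        · subst hc
          have := ecount_markov A (A.P x j) (A.P x k) (F x j) (F x k) (F j k) ν ε _ _ _ hε
            (Ppos A (hU (hKLU hj)) (hU (hKLU hk)) hjk)
            (holeF x (hZ hx) j (hKLU hj) k (hKLU hk) (nZKL x hx j hj) (nZKL x hx k hk) hjk)
          refine le_trans ?_ (this.trans (mul_le_mul_of_nonneg_right hνa (by positivity)))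
          norm_cast
          apply Finset.card_le_card
          intro t ht
          rw [Finset.mem_filter] at ht ⊢
          refine ⟨ht.1, ?_⟩
          rcases ht.2 with h | h
          · exact absurd h.1 hjk
          · exact h.2.2
        · refine le_trans (b := ((∅ : Finset (ℕ × ℕ)).card : ℝ)) ?_
            (by simp only [Finset.card_empty, Nat.cast_zero]; positivity)
          norm_cast
          apply Finset.card_le_card
          intro t ht
          rw [Finset.mem_filter] at ht
          rcases ht.2 with h | h
          · exact absurd h.1 hjk
          · exact absurd h.1 hc)
  obtain ⟨i0, hi0⟩ : K'.Nonempty := by rw [← Finset.card_pos]; omega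
  obtain ⟨j0, hj0⟩ : L'.Nonempty := by rw [← Finset.card_pos]; omega
  have hvF : ∀ x ∈ Z', ∀ j ∈ K' ∪ L', v x j ∈ F x j := by
    intro x hx j hj
    rcases Finset.mem_union.1 hj with hj | hj
    · exact (hgood x hx j hj j0 hj0).1
    · exact (hgood x hx i0 hi0 j hj).2.1
  have hb1 : ∀ x ∈ Z', ∀ y ∈ Z', x ≠ y → ∀ j ∈ K' ∪ L',
      (((F x y).filter (fun c => A.Edge (v x j) (v y j) c)).card : ℝ) ≤ ε * (A.P x y).card := by
    intro x hx y hy hxy j hj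
    have := hbad x hx y hy j hj j hj (Or.inl hxy)
    by_contra hcon
    exact this (Or.inl ⟨rfl, hxy, hvF x hx j hj, hvF y hy j hj, not_le.1 hcon⟩)
  have hb2 : ∀ x ∈ Z', ∀ j ∈ K' ∪ L', ∀ k ∈ K' ∪ L', j ≠ k →
      (((F j k).filter (fun c => A.Edge (v x j) (v x k) c)).card : ℝ) ≤ ε * (A.P j k).card := by
    intro x hx j hj k hk hjk
    have := hbad x hx x hx j hj k hk (Or.inr hjk)
    by_contra hcon
    exact this (Or.inr ⟨rfl, hjk, hvF x hx j hj, hvF x hx k hk, not_le.1 hcon⟩)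
  let Λ : ℕ → ℕ → ℕ → Finset ℕ := fun z i j => A.nbhd i j (v z i) (v z j)
  let χ : ℕ → ℕ → Finset (ℕ × ℕ) := fun j k => (K' ×ˢ Z').filter (fun q =>
    ν2 * (((A.P q.1 j).card : ℝ) * (A.P q.1 k).card * (A.P j k).card) ≤
      (A.ecount (Λ q.2 q.1 j) (Λ q.2 q.1 k) (Λ q.2 j k) : ℝ))
  obtain ⟨L2, hL2, cL2, b, hb, hmono⟩ := hN (K' ×ˢ Z').powerset
    (by rw [Finset.card_powerset, Finset.card_product, cK', cZ']) χ
    (fun a b => Finset.mem_powerset.2 (Finset.filter_subset _ _)) L' (by omega)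
  have hmono' : ∀ j ∈ L2, ∀ k ∈ L2, j < k → χ j k = b := fun j hj k hk hjk =>
    hmono j hj k (Finset.mem_filter.2 ⟨hk, hjk⟩)
  have hUI : ∀ {a}, a ∈ U → a ∈ A.I := fun h => hU h
  have hzex : ∀ i, ∃ z, i ∈ K' → z ∈ Z' ∧ (i, z) ∉ b := by
    intro i
    by_cases hi : i ∈ K'
    swap
    · exact ⟨0, fun h => absurd h hi⟩
    by_contra hcon
    push Not at hcon
    have hiK := hK' hi
    have hmem : ∀ j, (j = i ∨ j ∈ L2) → j ∈ K' ∪ L' := by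
      rintro j (rfl | h)
      exacts [Finset.mem_union_left _ hi, Finset.mem_union_right _ (hL2 h)]
    refine hs1 A hA i (hU (hK hiK)) Z' L2 ((hZ'.trans hZ).trans hU)
      (((hL2.trans hL').trans hL).trans hU) (fun h => nZK i (hZ' h) i hiK rfl)
      (fun h => nKL i hiK i (hL' (hL2 h)) rfl)
      (Disjoint.mono hZ' (hL2.trans hL') dZL) cZ'.ge (by omega) F v
      (fun x hx y hy hxy => ⟨hF _ _, wF x (hZ (hZ' hx)) y (hZ (hZ' hy)) hxy⟩)
      (fun x hx j hj => hv x hx j (hmem j hj))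
      (fun x hx y hy hxy j hj => hb1 x hx y hy hxy j (hmem j hj)) ?_
    intro x hx j hj k hk hjk
    have h1 := (hcon x).2 hx
    rw [← hmono' j hj k hk hjk] at h1
    exact (Finset.mem_filter.1 h1).2
  choose zf hzf using hzex
  obtain ⟨z, hz, hfib⟩ := Finset.exists_lt_card_fiber_of_mul_lt_card_of_maps_to
    (s := K') (t := Z') (f := zf) (n := 2 * s2) (fun i hi => (hzf i hi).1)
    (by rw [cZ', cK']; omega)
  set K2 := K'.filter (fun i => zf i = z) with hK2
  obtain ⟨X3, hX3, cX3⟩ := Finset.exists_subset_card_eq (show s2 ≤ K2.card by omega)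
  have cK3 : s2 ≤ (K2 \ X3).card := by
    rw [Finset.card_sdiff_of_subset hX3]; omega
  have hK2K : K2 ⊆ K' := Finset.filter_subset _ _
  have hX3K : X3 ⊆ K := (hX3.trans hK2K).trans hK'
  have hK3K : K2 \ X3 ⊆ K := (Finset.sdiff_subset.trans hK2K).trans hK'
  have hL2L : L2 ⊆ L := hL2.trans hL'
  have hzU : z ∈ U := hZ (hZ' hz)
  have hdens : ∀ j ∈ K' ∪ L', ∀ k ∈ K' ∪ L', j ≠ k →
      (1/3 + ε) * ((A.P j k).card : ℝ) ≤ (Λ z j k).card := by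
    intro j hj k hk hjk
    have hj1 : j ∈ K ∪ L := Finset.union_subset_union hK' hL' hj
    have hk1 : k ∈ K ∪ L := Finset.union_subset_union hK' hL' hk
    exact hA.1 z j k (hU hzU) (hU (hKLU hj1)) (hU (hKLU hk1)) (nZKL z (hZ' hz) j hj1)
      (nZKL z (hZ' hz) k hk1) hjk _ (hv z hz j hj) _ (hv z hz k hk)
  refine hstep2 A hA X3 (K2 \ X3) L2 ((hX3K.trans hK).trans hU) ((hK3K.trans hK).trans hU)
    ((hL2L.trans hL).trans hU) Finset.disjoint_sdiff
    (Disjoint.mono hX3K hL2L dKL) (Disjoint.mono hK3K hL2L dKL) cX3.ge cK3 (by omega)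
    G (Λ z) hG (fun a b => nbhd_sub _ _ _ _ _) ?_ ?_ ?_ ?_ ?_
  · intro x hx y hy hxy j hj
    have hxU := hK (hX3K hx)
    have hyU := hK (hX3K hy)
    have hjU : j ∈ U := by
      rcases Finset.mem_union.1 hj with h | h
      exacts [hK (hK3K h), hL (hL2L h)]
    have hne : ∀ x ∈ X3, x ≠ j := by
      intro x hx
      rcases Finset.mem_union.1 hj with h | h
      · intro he
        exact (Finset.mem_sdiff.1 h).2 (he ▸ hx)
      · exact nKL x (hX3K hx) j (hL2L h)
    have hh := holeG j hjU x hxU y hyU (hne x hx).symm (hne y hy).symm hxy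
    rw [symG j x, symG j y, A.Psymm j x, A.Psymm j y] at hh
    exact hh.trans (mul_le_mul_of_nonneg_right hνb (by positivity))
  · intro i hi j hj k hk hjk
    have hi2 : i ∈ K2 := by
      rcases Finset.mem_union.1 hi with h | h
      exacts [hX3 h, (Finset.mem_sdiff.1 h).1]
    have hi3 := Finset.mem_filter.1 hi2
    have h1 := (hzf i hi3.1).2
    rw [hi3.2, ← hmono' j hj k hk hjk] at h1
    by_contra hcon
    exact h1 (Finset.mem_filter.2 ⟨Finset.mem_product.2 ⟨hi3.1, hz⟩, (not_le.1 hcon).le⟩)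
  · intro x hx y hy hxy
    exact wG x (hK (hX3K hx)) y (hK (hX3K hy)) hxy
  · intro j hj k hk hjk
    exact hdens j (Finset.mem_union_right _ (hL2 hj)) k (Finset.mem_union_right _ (hL2 hk)) hjk.ne
  · intro x hx i hi j hj
    have hxK := hX3K hx
    have hiK := hK3K hi
    have hjL := hL2L hj
    have hxi : x ≠ i := fun he => (Finset.mem_sdiff.1 hi).2 (he ▸ hx)
    have hxj := nKL x hxK j hjL
    have hij := nKL i hiK j hjL
    have hxU := hK hxK
    have hiU := hK hiK
    have hjU := hL hjL
    have hxK' : x ∈ K' := hK2K (hX3 hx)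
    have hiK' : i ∈ K' := hK2K (Finset.mem_sdiff.1 hi).1
    have hiKL : i ∈ K' ∪ L' := Finset.mem_union_left _ hiK'
    have hjKL : j ∈ K' ∪ L' := Finset.mem_union_right _ (hL2 hj)
    have hole : (A.ecount (F x i ∩ G x i) (G x j) (F i j) : ℝ) ≤
        ν * (((A.P x i).card : ℝ) * (A.P x j).card * (A.P i j).card) := by
      have h1 := hT i hiU j hjU x hxU hij hxi.symm hxj.symm
      rw [ecount_comm12, ecount_comm23, symF i x, symG i x, symG j x, A.Psymm i x,
        A.Psymm j x] at h1
      refine h1.trans (le_of_eq ?_)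
      ring
    have hlow := low_of_hole A ε (ε * δ / 4) ν ε (δ / 2) (ε * δ / 4) hε
      hA.1 x i j (hU hxU) (hU hiU) (hU hjU) hxi hxj hij
      (F x i ∩ G x i) ((G x j).filter (fun c => A.Edge (v z x) (v z j) c)) (F x i ∩ G x i) (G x j)
      (Λ z i j) (F i j) subset_rfl (Finset.filter_subset _ _)
      (Finset.inter_subset_left.trans (hF _ _)) (hG _ _) (nbhd_sub _ _ _ _ _) (hF _ _)
      (hint x hxU i hiU hxi) (hgood z hz x hxK' j (hL2 hj)).2.2 hε.le (by positivity)
      (hdens i hiKL j hjKL hij) (wF i hiU j hjU hij)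
      (by
        simp only [Λ]
        rw [nbhd_inter _ _ _ _ _ _ (hF i j)]
        exact hb2 z hz i hiKL j hjKL hij)
      hole hνc (by nlinarith)
    refine hlow.trans ?_
    norm_cast
    apply ecount_mono
    · exact Finset.inter_subset_right
    · intro c hc
      rw [Finset.mem_filter] at hc
      exact Finset.mem_inter.2 ⟨hc.1, Finset.mem_filter.2 ⟨hG _ _ hc.1, hc.2⟩⟩
    · exact subset_rfl

lemma ecount_union_le2 (A : ReducedHG) (U V V' W : Finset ℕ) :
    A.ecount U (V ∪ V') W ≤ A.ecount U V W + A.ecount U V' W := by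
  rw [ecount_comm12 A U, ecount_comm12 A U, ecount_comm12 A U]
  exact ecount_union_le1 _ _ _ _ _

lemma ecount_union_le3 (A : ReducedHG) (U V W W' : Finset ℕ) :
    A.ecount U V (W ∪ W') ≤ A.ecount U V W + A.ecount U V W' := by
  rw [ecount_comm23 A U V (W ∪ W'), ecount_comm23 A U V W, ecount_comm23 A U V W']
  exact ecount_union_le2 _ _ _ _ _

lemma ecount_union8 (A : ReducedHG) (U V W U' V' W' : Finset ℕ) (q : ℝ)
    (h1 : (A.ecount U V W : ℝ) ≤ q) (h2 : (A.ecount U V W' : ℝ) ≤ q)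
    (h3 : (A.ecount U V' W : ℝ) ≤ q) (h4 : (A.ecount U V' W' : ℝ) ≤ q)
    (h5 : (A.ecount U' V W : ℝ) ≤ q) (h6 : (A.ecount U' V W' : ℝ) ≤ q)
    (h7 : (A.ecount U' V' W : ℝ) ≤ q) (h8 : (A.ecount U' V' W' : ℝ) ≤ q) :
    (A.ecount (U ∪ U') (V ∪ V') (W ∪ W') : ℝ) ≤ 8 * q := by
  have a1 := ecount_union_le1 A U U' (V ∪ V') (W ∪ W')
  have a2 := ecount_union_le2 A U V V' (W ∪ W')
  have a3 := ecount_union_le2 A U' V V' (W ∪ W')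
  have b1 := ecount_union_le3 A U V W W'
  have b2 := ecount_union_le3 A U V' W W'
  have b3 := ecount_union_le3 A U' V W W'
  have b4 := ecount_union_le3 A U' V' W W'
  have : A.ecount (U ∪ U') (V ∪ V') (W ∪ W') ≤ A.ecount U V W + A.ecount U V W' +
    A.ecount U V' W + A.ecount U V' W' + A.ecount U' V W + A.ecount U' V W' +
    A.ecount U' V' W + A.ecount U' V' W' := by omega
  have h : (A.ecount (U ∪ U') (V ∪ V') (W ∪ W') : ℝ) ≤ A.ecount U V W + A.ecount U V W' +
    A.ecount U V' W + A.ecount U V' W' + A.ecount U' V W + A.ecount U' V W' +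
    A.ecount U' V' W + A.ecount U' V' W' := by exact_mod_cast this
  linarith

set_option maxHeartbeats 1000000 in
lemma union_core (μ ε : ℝ) (hμ : 0 < μ) (hε : 0 < ε) : ∃ ν : ℝ, 0 < ν ∧ ∀ t : ℕ, ∃ s : ℕ,
      ∀ (A : ReducedHG) (J : Finset ℕ), A.Wicked ε → J ⊆ A.I → s ≤ J.card →
        ∀ F G : ℕ → ℕ → Finset ℕ, (∀ a b, F a b ⊆ A.P a b) → (∀ a b, G a b ⊆ A.P a b) →
    (∀ a b, F a b = F b a) → (∀ a b, G a b = G b a) →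
    (∀ a ∈ J, ∀ b ∈ J, ∀ c ∈ J, a ≠ b → a ≠ c → b ≠ c →
      (A.ecount (F a b) (F a c) (F b c) : ℝ) ≤
      ν * (((A.P a b).card : ℝ) * (A.P a c).card * (A.P b c).card)) →
    (∀ a ∈ J, ∀ b ∈ J, ∀ c ∈ J, a ≠ b → a ≠ c → b ≠ c →
      (A.ecount (G a b) (G a c) (G b c) : ℝ) ≤
      ν * (((A.P a b).card : ℝ) * (A.P a c).card * (A.P b c).card)) →
    (∀ a ∈ J, ∀ b ∈ J, a ≠ b → (1/3 + ε) * ((A.P a b).card : ℝ) ≤ (F a b).card) →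
    (∀ a ∈ J, ∀ b ∈ J, a ≠ b → (1/3 + ε) * ((A.P a b).card : ℝ) ≤ (G a b).card) →
    (∀ a ∈ J, ∀ b ∈ J, a ≠ b → ε * ((A.P a b).card : ℝ) ≤ (F a b ∩ G a b).card) →
    ∃ H ⊆ J, t ≤ H.card ∧ ∀ a ∈ H, ∀ b ∈ H, ∀ c ∈ H, a ≠ b → a ≠ c → b ≠ c →
      (A.ecount (F a b ∪ G a b) (F a c ∪ G a c) (F b c ∪ G b c) : ℝ) ≤
      μ * (((A.P a b).card : ℝ) * (A.P a c).card * (A.P b c).card) := by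
  obtain ⟨ν3, hν3, s3, hs3⟩ := step3 ε (μ / 8) hε (by positivity)
  obtain ⟨ν2, hν2, s2, hs2⟩ := step2 ε ν3 hε hν3
  set ν := min (min ν3 ν2) (μ / 8) with hν
  have l3 : ν ≤ ν3 := (min_le_left _ _).trans (min_le_left _ _)
  have l2 : ν ≤ ν2 := (min_le_left _ _).trans (min_le_right _ _)
  have lμ : ν ≤ μ / 8 := min_le_right _ _
  refine ⟨ν, lt_min (lt_min hν3 hν2) (by positivity), ?_⟩
  intro t
  obtain ⟨n3, hn3⟩ := rs_box t s3
  obtain ⟨n2, hn2⟩ := rs_box n3 s3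
  obtain ⟨n1, hn1⟩ := rs_box n2 s2
  refine ⟨n1, ?_⟩
  intro A J hA hJ cJ F G hF hG symF symG holeF holeG wF wG hint
  -- first cleaning
  have st1 : ∃ J1 ⊆ J, n2 ≤ J1.card ∧ ∀ a ∈ J1, ∀ b ∈ J1, ∀ c ∈ J1, a ≠ b → a ≠ c → b ≠ c →
      (A.ecount (F a b) (F a c ∩ G a c) (G b c) : ℝ) ≤
      ν3 * (((A.P a b).card : ℝ) * (A.P a c).card * (A.P b c).card) := by
    rcases hn1 J cJ (fun a b c => (A.ecount (F a b) (F a c ∩ G a c) (G b c) : ℝ) ≤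
      ν3 * (((A.P a b).card : ℝ) * (A.P a c).card * (A.P b c).card)) with h | h
    · exact h
    · exfalso
      obtain ⟨X, hX, K, hK, L, hL, dXK, dXL, dKL, cX, cK, cL, hT⟩ := h
      refine hs2 A hA X K L (hX.trans hJ) (hK.trans hJ) (hL.trans hJ) dXK dXL dKL cX cK cL F G
        hF hG ?_ ?_ (fun x hx y hy hxy => wF x (hX hx) y (hX hy) hxy)
        (fun x hx y hy hxy => wG x (hL hx) y (hL hy) hxy.ne)
        (fun x hx i hi j hj => (not_le.1 (hT x hx i hi j hj)).le)
      · intro x hx y hy hxy j hj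
        have hjJ : j ∈ J := Finset.union_subset hK hL hj
        have hne : ∀ x ∈ X, j ≠ x := by
          rintro x hx rfl
          rcases Finset.mem_union.1 hj with h | h
          exacts [Finset.disjoint_left.1 dXK hx h, Finset.disjoint_left.1 dXL hx h]
        have hh := holeF j hjJ x (hX hx) y (hX hy) (hne x hx) (hne y hy) hxy
        rw [symF j x, symF j y, A.Psymm j x, A.Psymm j y] at hh
        exact hh.trans (mul_le_mul_of_nonneg_right l2 (by positivity))
      · intro i hi j hj k hk hjk
        have hiJ : i ∈ J := Finset.union_subset hX hK hi
        have hne : ∀ x ∈ L, i ≠ x := by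
          rintro x hx rfl
          rcases Finset.mem_union.1 hi with h | h
          exacts [Finset.disjoint_left.1 dXL h hx, Finset.disjoint_left.1 dKL h hx]
        exact (holeG i hiJ j (hL hj) k (hL hk) (hne j hj) (hne k hk) hjk.ne).trans
          (mul_le_mul_of_nonneg_right l2 (by positivity))
  obtain ⟨J1, hJ1, cJ1, hT1⟩ := st1
  have up : ∀ {F : ℕ → ℕ → Finset ℕ}, (∀ a ∈ J, ∀ b ∈ J, ∀ c ∈ J, a ≠ b → a ≠ c → b ≠ c →
      (A.ecount (F a b) (F a c) (F b c) : ℝ) ≤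
      ν * (((A.P a b).card : ℝ) * (A.P a c).card * (A.P b c).card)) → ∀ ν', ν ≤ ν' →
      ∀ a ∈ J, ∀ b ∈ J, ∀ c ∈ J, a ≠ b → a ≠ c → b ≠ c →
      (A.ecount (F a b) (F a c) (F b c) : ℝ) ≤
      ν' * (((A.P a b).card : ℝ) * (A.P a c).card * (A.P b c).card) := by
    intro F h ν' hν' a ha b hb c hc h1 h2 h3
    exact (h a ha b hb c hc h1 h2 h3).trans (mul_le_mul_of_nonneg_right hν' (by positivity))
  have upF := up holeF
  have upG := up holeG
  -- second cleaning
  have st2 : ∃ J2 ⊆ J1, n3 ≤ J2.card ∧ ∀ a ∈ J2, ∀ b ∈ J2, ∀ c ∈ J2, a ≠ b → a ≠ c → b ≠ c →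
      (A.ecount (F a b) (F a c) (G b c) : ℝ) ≤
      μ / 8 * (((A.P a b).card : ℝ) * (A.P a c).card * (A.P b c).card) := by
    rcases hn2 J1 cJ1 (fun a b c => (A.ecount (F a b) (F a c) (G b c) : ℝ) ≤
      μ / 8 * (((A.P a b).card : ℝ) * (A.P a c).card * (A.P b c).card)) with h | h
    · exact h
    · exfalso
      obtain ⟨X, hX, K, hK, L, hL, dXK, dXL, dKL, cX, cK, cL, hT⟩ := h
      exact hs3 A hA X K L J1 (hJ1.trans hJ) hX hK hL dXK dXL dKL cX cK cL F G hF hG symF symG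
        (fun a ha b hb c hc => upF ν3 l3 a (hJ1 ha) b (hJ1 hb) c (hJ1 hc))
        (fun a ha b hb c hc => upG ν3 l3 a (hJ1 ha) b (hJ1 hb) c (hJ1 hc))
        hT1 (fun a ha b hb => wF a (hJ1 ha) b (hJ1 hb)) (fun a ha b hb => wG a (hJ1 ha) b (hJ1 hb))
        (fun a ha b hb => hint a (hJ1 ha) b (hJ1 hb))
        (fun x hx i hi j hj => (not_le.1 (hT x hx i hi j hj)).le)
  obtain ⟨J2, hJ2, cJ2, hT2⟩ := st2
  have st3 : ∃ J3 ⊆ J2, t ≤ J3.card ∧ ∀ a ∈ J3, ∀ b ∈ J3, ∀ c ∈ J3, a ≠ b → a ≠ c → b ≠ c →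
      (A.ecount (G a b) (G a c) (F b c) : ℝ) ≤
      μ / 8 * (((A.P a b).card : ℝ) * (A.P a c).card * (A.P b c).card) := by
    rcases hn3 J2 cJ2 (fun a b c => (A.ecount (G a b) (G a c) (F b c) : ℝ) ≤
      μ / 8 * (((A.P a b).card : ℝ) * (A.P a c).card * (A.P b c).card)) with h | h
    · exact h
    · exfalso
      obtain ⟨X, hX, K, hK, L, hL, dXK, dXL, dKL, cX, cK, cL, hT⟩ := h
      have hJ2J := hJ2.trans hJ1
      refine hs3 A hA X K L J2 (hJ2J.trans hJ) hX hK hL dXK dXL dKL cX cK cL G F hG hF symG symF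
        (fun a ha b hb c hc => upG ν3 l3 a (hJ2J ha) b (hJ2J hb) c (hJ2J hc))
        (fun a ha b hb c hc => upF ν3 l3 a (hJ2J ha) b (hJ2J hb) c (hJ2J hc))
        ?_ (fun a ha b hb => wG a (hJ2J ha) b (hJ2J hb)) (fun a ha b hb => wF a (hJ2J ha) b (hJ2J hb))
        (fun a ha b hb => by rw [Finset.inter_comm]; exact hint a (hJ2J ha) b (hJ2J hb))
        (fun x hx i hi j hj => (not_le.1 (hT x hx i hi j hj)).le)
      intro a ha b hb c hc h1 h2 h3
      have hh := hT1 c (hJ2 hc) b (hJ2 hb) a (hJ2 ha) h3.symm h2.symm h1.symm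
      rw [ecount_comm12, ecount_comm23, ecount_comm12, symF c b, symF c a, symG c a, symG b a,
        A.Psymm c b, A.Psymm c a, A.Psymm b a] at hh
      rw [Finset.inter_comm]
      refine hh.trans (le_of_eq ?_)
      ring
  obtain ⟨H, hH, cH, hT3⟩ := st3
  have hHJ : H ⊆ J := (hH.trans hJ2).trans hJ1
  refine ⟨H, hHJ, cH, ?_⟩
  intro a ha b hb c hc h1 h2 h3
  have perm : ∀ {F G : ℕ → ℕ → Finset ℕ}, (∀ a b, F a b = F b a) → (∀ a b, G a b = G b a) →
      (∀ a ∈ H, ∀ b ∈ H, ∀ c ∈ H, a ≠ b → a ≠ c → b ≠ c →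
      (A.ecount (F a b) (F a c) (G b c) : ℝ) ≤
      μ / 8 * (((A.P a b).card : ℝ) * (A.P a c).card * (A.P b c).card)) →
      (A.ecount (F a b) (G a c) (F b c) : ℝ) ≤
      μ / 8 * (((A.P a b).card : ℝ) * (A.P a c).card * (A.P b c).card) ∧
      (A.ecount (G a b) (F a c) (F b c) : ℝ) ≤
      μ / 8 * (((A.P a b).card : ℝ) * (A.P a c).card * (A.P b c).card) := by
    intro F G symF symG hT
    constructor
    · have hh := hT b hb a ha c hc h1.symm h3 h2
      rw [ecount_comm23, symF b a, A.Psymm b a] at hh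
      refine hh.trans (le_of_eq ?_)
      ring
    · have hh := hT c hc a ha b hb h2.symm h3.symm h1
      rw [ecount_comm23, ecount_comm12, symF c a, symF c b, A.Psymm c a, A.Psymm c b] at hh
      refine hh.trans (le_of_eq ?_)
      ring
  have hT2' : ∀ a ∈ H, ∀ b ∈ H, ∀ c ∈ H, a ≠ b → a ≠ c → b ≠ c →
      (A.ecount (F a b) (F a c) (G b c) : ℝ) ≤
      μ / 8 * (((A.P a b).card : ℝ) * (A.P a c).card * (A.P b c).card) :=
    fun a ha b hb c hc => hT2 a (hH ha) b (hH hb) c (hH hc)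
  have p1 := perm symF symG hT2'
  have p2 := perm symG symF hT3
  have := ecount_union8 A (F a b) (F a c) (F b c) (G a b) (G a c) (G b c)
    (μ / 8 * (((A.P a b).card : ℝ) * (A.P a c).card * (A.P b c).card))
    (upF _ lμ a (hHJ ha) b (hHJ hb) c (hHJ hc) h1 h2 h3)
    (hT2' a ha b hb c hc h1 h2 h3) p1.1 p2.2 p1.2 p2.1
    (hT3 a ha b hb c hc h1 h2 h3)
    (upG _ lμ a (hHJ ha) b (hHJ hb) c (hHJ hc) h1 h2 h3)
  refine this.trans (le_of_eq ?_)
  ring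

/-- Lemma 13 (`lem:union`, union lemma): the union of two `ε`-intersecting
`(ν, 1/3+ε)`-holes in an `ε`-wicked reduced hypergraph is a `(μ, 1/3+ε)`-hole
on a large subset of the indices. -/
theorem union_of_holes :
    ∀ μ ε : ℝ, 0 < μ → 0 < ε → ∃ ν : ℝ, 0 < ν ∧ ∀ t : ℕ, ∃ s : ℕ,
      ∀ (A : ReducedHG) (J : Finset ℕ), A.Wicked ε → J ⊆ A.I → s ≤ J.card →
        ∀ Φ Ψ : Finset ℕ,
          A.IsHoleW ν (1/3 + ε) J Φ → A.IsHoleW ν (1/3 + ε) J Ψ →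
          A.HolesIntersecting ε J Φ Ψ →
          ∃ Js ⊆ J, t ≤ Js.card ∧ A.IsHoleW μ (1/3 + ε) Js (Φ ∪ Ψ) := by
  intro μ ε hμ hε
  obtain ⟨ν, hν, h⟩ := union_core μ ε hμ hε
  refine ⟨ν, hν, ?_⟩
  intro t
  obtain ⟨s, hs⟩ := h t
  refine ⟨s, ?_⟩
  intro A J hA hJ cJ Φ Ψ hΦ hΨ hint
  obtain ⟨H, hH, cH, hole⟩ := hs A J hA hJ cJ (fun a b => Φ ∩ A.P a b) (fun a b => Ψ ∩ A.P a b)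
    (fun _ _ => Finset.inter_subset_right) (fun _ _ => Finset.inter_subset_right)
    (fun a b => by rw [A.Psymm]) (fun a b => by rw [A.Psymm])
    hΦ.1.2 hΨ.1.2 hΦ.2 hΨ.2
    (fun a ha b hb hab => by
      have := hint a ha b hb hab
      rwa [Finset.inter_inter_distrib_right] at this)
  have hsub : ∀ a b, Φ ∩ A.P a b ⊆ (Φ ∪ Ψ) ∩ A.P a b := fun a b =>
    Finset.inter_subset_inter Finset.subset_union_left subset_rfl
  refine ⟨H, hH, cH, ⟨?_, ?_⟩, ?_⟩
  · intro i hi j hj hij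
    exact (hΦ.1.1 i (hH hi) j (hH hj) hij).mono (hsub i j)
  · intro i hi j hj k hk h1 h2 h3
    rw [Finset.union_inter_distrib_right, Finset.union_inter_distrib_right,
      Finset.union_inter_distrib_right]
    exact hole i hi j hj k hk h1 h2 h3
  · intro i hi j hj hij
    refine (hΦ.2 i (hH hi) j (hH hj) hij).trans ?_
    exact_mod_cast Finset.card_le_card (hsub i j)
end
end

section
/- Let ε, ν > 0 and t ∈ ℕ. There exists s ∈ ℕ such that the following holds: if 𝒜 is an ε-wicked reduced hypergraph with index set I, J ⊆ I has size at least s, and 𝒬, ℛ are two J-transversals such that |N(Q^{ik},Q^{jk}) ∩ N(R^{iℓ},R^{jℓ})| ≥ ε|𝒫^{ij}| for all i < j < k < ℓ in J, then there is a set J⋆ ⊆ J of size t such that for all i < j < k < ℓ in J⋆ the number of edges of 𝒜^{jkℓ} with one vertex in each of N(Q^{ij},R^{ik}) ⊆ 𝒫^{jk}, N(Q^{ij},R^{iℓ}) ⊆ 𝒫^{jℓ}, N(Q^{ik},R^{iℓ}) ⊆ 𝒫^{kℓ} is at most ν|𝒫^{jk}||𝒫^{jℓ}||𝒫^{kℓ}|.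 -/
open Finset Classical

noncomputable section

theorem ramsey_set (κ : Type) [Fintype κ] [Nonempty κ] (r : ℕ) : ∀ t : ℕ, ∃ s : ℕ, ∀ (J : Finset ℕ) (c : Finset ℕ → κ),
    s ≤ J.card → ∃ H ⊆ J, H.card = t ∧ ∃ col, ∀ e ⊆ H, e.card = r → c e = col := by
  induction r with
  | zero =>
    intro t
    refine ⟨t, fun J c h => ?_⟩
    obtain ⟨H, hH, hc⟩ := Finset.exists_subset_card_eq h
    refine ⟨H, hH, hc, c ∅, fun e _ he => ?_⟩
    rw [Finset.card_eq_zero.mp he]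
  | succ r ih =>
    have key : ∀ n : ℕ, ∃ s : ℕ, ∀ (J : Finset ℕ) (c : Finset ℕ → κ), s ≤ J.card →
        ∃ H ⊆ J, H.card = n ∧ ∃ d : ℕ → κ, ∀ e ⊆ H, e.card = r + 1 →
          ∀ a ∈ e, (∀ b ∈ e, a ≤ b) → c e = d a := by
      intro n
      induction n with
      | zero =>
        refine ⟨0, fun J c _ => ⟨∅, by simp, rfl, fun _ => Classical.arbitrary κ, ?_⟩⟩
        intro e he hc
        rw [Finset.subset_empty.mp he] at hc
        simp at hc
      | succ n ihn =>
        obtain ⟨s1, h1⟩ := ihn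
        obtain ⟨s2, h2⟩ := ih s1
        refine ⟨s2 + 1, fun J c hJ => ?_⟩
        have hne : J.Nonempty := Finset.card_pos.mp (by omega)
        set a := J.min' hne with ha
        have haJ : a ∈ J := Finset.min'_mem _ _
        obtain ⟨H1, hH1, hc1, col, hcol⟩ := h2 (J.erase a) (fun e => c (insert a e))
          (by rw [Finset.card_erase_of_mem haJ]; omega)
        obtain ⟨H2, hH2, hc2, d, hd⟩ := h1 H1 c hc1.ge
        have hlt : ∀ x ∈ H2, a < x := by
          intro x hx
          have := hH1 (hH2 hx)
          rw [Finset.mem_erase] at this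
          exact lt_of_le_of_ne (Finset.min'_le _ _ this.2) (Ne.symm this.1)
        have haH : a ∉ H2 := fun h => lt_irrefl _ (hlt a h)
        refine ⟨insert a H2, ?_, ?_, fun x => if x = a then col else d x, ?_⟩
        · intro x hx
          rcases Finset.mem_insert.mp hx with rfl | hx
          · exact haJ
          · exact Finset.mem_of_mem_erase (hH1 (hH2 hx))
        · rw [Finset.card_insert_of_notMem haH, hc2]
        · intro e he hce x hx hmin
          by_cases hae : a ∈ e
          · have hxa : x = a := by
              apply le_antisymm (hmin a hae)
              rcases Finset.mem_insert.mp (he hx) with h | h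
              · exact h.ge
              · exact (hlt x h).le
            have := hcol (e.erase a) (by
              intro y hy
              rw [Finset.mem_erase] at hy
              rcases Finset.mem_insert.mp (he hy.2) with h | h
              · exact absurd h hy.1
              · exact hH2 h) (by rw [Finset.card_erase_of_mem hae]; omega)
            simp only [Finset.insert_erase hae] at this
            simp [hxa, this]
          · have heH : e ⊆ H2 := by
              intro y hy
              rcases Finset.mem_insert.mp (he hy) with h | h
              · exact absurd (h ▸ hy) hae
              · exact h
            have hxa : x ≠ a := fun h => hae (h ▸ hx)
            simp only [hxa, if_false]
            exact hd e heH hce x hx hmin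
    intro t
    obtain ⟨s, hs⟩ := key (Fintype.card κ * t)
    refine ⟨s, fun J c hJ => ?_⟩
    obtain ⟨H, hH, hc, d, hd⟩ := hs J c hJ
    obtain ⟨y, -, hy⟩ := Finset.exists_le_card_fiber_of_mul_le_card_of_maps_to
      (s := H) (t := (Finset.univ : Finset κ)) (f := d) (n := t) (fun _ _ => Finset.mem_univ _)
      Finset.univ_nonempty (by rw [hc]; simp)
    obtain ⟨H', hH', hc'⟩ := Finset.exists_subset_card_eq hy
    refine ⟨H', fun x hx => hH (Finset.mem_filter.mp (hH' hx)).1, hc', y, ?_⟩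
    intro e he hce
    have hne : e.Nonempty := Finset.card_pos.mp (by omega)
    rw [hd e (fun x hx => (Finset.mem_filter.mp (hH' (he hx))).1) hce (e.min' hne)
      (Finset.min'_mem _ _) (fun b hb => Finset.min'_le _ _ hb)]
    exact (Finset.mem_filter.mp (hH' (he (Finset.min'_mem e hne)))).2

theorem ramsey_tuple (κ : Type) [Fintype κ] [Nonempty κ] (r t : ℕ) : ∃ s : ℕ,
    ∀ (J : Finset ℕ) (c : (Fin r → ℕ) → κ),
    s ≤ J.card → ∃ H ⊆ J, H.card = t ∧ ∃ col, ∀ x : Fin r → ℕ, StrictMono x →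
      (∀ p, x p ∈ H) → c x = col := by
  obtain ⟨s, hs⟩ := ramsey_set κ r t
  refine ⟨s, fun J c hJ => ?_⟩
  obtain ⟨H, hH, hc, col, hcol⟩ := hs J
    (fun e => if h : e.card = r then c (e.orderEmbOfFin h) else Classical.arbitrary κ) hJ
  refine ⟨H, hH, hc, col, fun x hx hxH => ?_⟩
  have hcard : (Finset.univ.image x).card = r := by
    rw [Finset.card_image_of_injective _ hx.injective]; simp
  have := hcol (Finset.univ.image x) (by
    intro y hy
    obtain ⟨p, -, rfl⟩ := Finset.mem_image.mp hy
    exact hxH p) hcard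
  simp only [hcard, dif_pos] at this
  rw [← this]
  congr 1
  exact Finset.orderEmbOfFin_unique hcard (fun p => Finset.mem_image_of_mem _ (Finset.mem_univ _)) hx

theorem split_lt (J : Finset ℕ) (a b : ℕ) (h : a + b ≤ J.card) : ∃ X ⊆ J, ∃ Y ⊆ J,
    X.card = a ∧ Y.card = b ∧ ∀ x ∈ X, ∀ y ∈ Y, x < y := by
  induction a generalizing J with
  | zero =>
    obtain ⟨H, hH, hc⟩ := Finset.exists_subset_card_eq (show b ≤ J.card by omega)
    exact ⟨∅, by simp, H, hH, rfl, hc, by simp⟩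
  | succ a ih =>
    have hne : J.Nonempty := Finset.card_pos.mp (by omega)
    have haJ := Finset.min'_mem J hne
    obtain ⟨X, hX, Y, hY, h1, h2, h3⟩ := ih (J.erase (J.min' hne)) (by
      rw [Finset.card_erase_of_mem haJ]; omega)
    refine ⟨insert (J.min' hne) X, ?_, Y, fun y hy => Finset.mem_of_mem_erase (hY hy), ?_, h2, ?_⟩
    · intro x hx
      rcases Finset.mem_insert.mp hx with rfl | hx
      · exact haJ
      · exact Finset.mem_of_mem_erase (hX hx)
    · rw [Finset.card_insert_of_notMem, h1]
      intro h
      simpa using hX h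
    · intro x hx y hy
      rcases Finset.mem_insert.mp hx with rfl | hx
      · have := Finset.mem_erase.mp (hY hy)
        exact lt_of_le_of_ne (Finset.min'_le _ _ this.2) (Ne.symm this.1)
      · exact h3 x hx y hy

theorem pigeon {ι : Type} [LinearOrder ι] (ε : ℝ) (s : Finset ι) (F : ι → Finset ℕ) (P : Finset ℕ)
    (hP : P.Nonempty) (hF : ∀ x ∈ s, F x ⊆ P) (hc : ∀ x ∈ s, ε * (P.card : ℝ) ≤ ((F x).card : ℝ))
    (hs : 1 < ε * s.card) : ∃ x ∈ s, ∃ y ∈ s, x < y ∧ ∃ p, p ∈ F x ∧ p ∈ F y := by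
  by_contra hcon
  push Not at hcon
  have hd : ∀ x ∈ s, ∀ y ∈ s, x ≠ y → Disjoint (F x) (F y) := by
    intro x hx y hy hxy
    rw [Finset.disjoint_left]
    intro p hp hq
    rcases lt_or_gt_of_ne hxy with h | h
    · exact hcon x hx y hy h p hp hq
    · exact hcon y hy x hx h p hq hp
  have h1 : (s.biUnion F).card = ∑ x ∈ s, (F x).card := Finset.card_biUnion hd
  have h2 : (s.biUnion F).card ≤ P.card := Finset.card_le_card (Finset.biUnion_subset.mpr hF)
  have h3 : ∑ x ∈ s, ε * (P.card : ℝ) ≤ ∑ x ∈ s, ((F x).card : ℝ) := Finset.sum_le_sum hc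
  have h4 : (∑ x ∈ s, ((F x).card : ℝ)) ≤ P.card := by
    rw [← Nat.cast_sum, ← h1]; exact_mod_cast h2
  rw [Finset.sum_const, nsmul_eq_mul] at h3
  have h5 : (0 : ℝ) < P.card := by exact_mod_cast Finset.card_pos.mpr hP
  nlinarith

theorem three_sets (ε : ℝ) (P F G K : Finset ℕ) (hF : F ⊆ P) (hG : G ⊆ P) (hK : K ⊆ P)
    (cF : (1/3 + ε) * (P.card : ℝ) ≤ F.card) (cG : (1/3 + ε) * (P.card : ℝ) ≤ G.card)
    (cK : (1/3 + ε) * (P.card : ℝ) ≤ K.card)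
    (h1 : ¬ ε * (P.card : ℝ) ≤ ((F ∩ G).card : ℝ)) (h2 : ¬ ε * (P.card : ℝ) ≤ ((F ∩ K).card : ℝ)) :
    ε * (P.card : ℝ) ≤ ((G ∩ K).card : ℝ) := by
  have e1 : ((F ∪ G ∪ K).card : ℝ) ≤ P.card := by
    exact_mod_cast Finset.card_le_card (Finset.union_subset (Finset.union_subset hF hG) hK)
  have e2 := Finset.card_union_add_card_inter (F ∪ G) K
  have e3 := Finset.card_union_add_card_inter F G
  have e4 : ((F ∪ G) ∩ K).card ≤ (F ∩ K).card + (G ∩ K).card := by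
    rw [Finset.union_inter_distrib_right]; exact Finset.card_union_le _ _
  have e2' : ((F ∪ G ∪ K).card : ℝ) + (((F ∪ G) ∩ K).card : ℝ) = (F ∪ G).card + K.card := by exact_mod_cast e2
  have e3' : ((F ∪ G).card : ℝ) + ((F ∩ G).card : ℝ) = F.card + G.card := by exact_mod_cast e3
  have e4' : (((F ∪ G) ∩ K).card : ℝ) ≤ (F ∩ K).card + (G ∩ K).card := by exact_mod_cast e4
  push Not at h1 h2
  nlinarith


theorem kst {τ : Type} (ν : ℝ) (hν : 0 < ν) (M : ℕ) (X : Finset ℕ) (T : Finset τ)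
    (rel : ℕ → τ → Prop) (hX : X.Nonempty) (hT : T.Nonempty)
    (h : ν * X.card * T.card ≤ ∑ x ∈ X, ((T.filter fun t => rel x t).card : ℝ))
    (hM : (M : ℝ) ≤ ν / 2 * X.card) :
    ∃ S ⊆ X, S.card = M ∧
      ν / 2 / 2 ^ X.card * T.card ≤ ((T.filter fun t => ∀ x ∈ S, rel x t).card : ℝ) := by
  have hX0 : (0 : ℝ) < X.card := by exact_mod_cast Finset.card_pos.mpr hX
  set deg : τ → ℕ := fun t => (X.filter fun x => rel x t).card with hdeg
  have hsum : ∑ x ∈ X, ((T.filter fun t => rel x t).card : ℝ) = ∑ t ∈ T, (deg t : ℝ) := by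
    have := Finset.sum_card_bipartiteAbove_eq_sum_card_bipartiteBelow (s := X) (t := T) rel
    simp only [Finset.bipartiteAbove, Finset.bipartiteBelow] at this
    exact_mod_cast this
  rw [hsum] at h
  set G := T.filter fun t => M ≤ deg t with hG
  have h1 : ∑ t ∈ T, (deg t : ℝ) ≤ ∑ t ∈ T, ((if M ≤ deg t then (X.card : ℝ) else 0) + M) := by
    apply Finset.sum_le_sum
    intro t _
    split_ifs with hh
    · have : deg t ≤ X.card := Finset.card_filter_le _ _
      have : (deg t : ℝ) ≤ X.card := by exact_mod_cast this
      have : (0 : ℝ) ≤ M := by positivity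
      linarith
    · have : (deg t : ℝ) ≤ M := by exact_mod_cast (not_le.mp hh).le
      linarith
  rw [Finset.sum_add_distrib, ← Finset.sum_filter, Finset.sum_const, Finset.sum_const,
    nsmul_eq_mul, nsmul_eq_mul, ← hG] at h1
  have h2 : ν / 2 * T.card ≤ G.card := by
    have hT : (0 : ℝ) ≤ T.card := by positivity
    have : (T.card : ℝ) * M ≤ T.card * (ν / 2 * X.card) := by gcongr
    by_contra hc
    push Not at hc
    have := mul_lt_mul_of_pos_right hc hX0
    nlinarith
  have hex : ∀ t : τ, ∃ S : Finset ℕ, t ∈ G → S ⊆ X ∧ S.card = M ∧ ∀ x ∈ S, rel x t := by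
    intro t
    by_cases ht : t ∈ G
    · obtain ⟨S, hS, hc⟩ := Finset.exists_subset_card_eq (Finset.mem_filter.mp ht).2
      exact ⟨S, fun _ => ⟨fun x hx => (Finset.mem_filter.mp (hS hx)).1, hc,
        fun x hx => (Finset.mem_filter.mp (hS hx)).2⟩⟩
    · exact ⟨∅, fun h => absurd h ht⟩
  choose f hf using hex
  have hMX' : M ≤ X.card := by
    have hg : G.Nonempty := by
      rw [← Finset.card_pos]
      have hT0 : (0 : ℝ) < T.card := by exact_mod_cast Finset.card_pos.mpr hT
      have : (0 : ℝ) < G.card := lt_of_lt_of_le (by positivity) h2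
      exact_mod_cast this
    obtain ⟨t, ht⟩ := hg
    obtain ⟨a, b, -⟩ := hf t ht
    exact b ▸ Finset.card_le_card a
  obtain ⟨S, hS, hS2⟩ := Finset.exists_le_card_fiber_of_nsmul_le_card_of_maps_to
    (s := G) (t := X.powersetCard M) (f := f) (b := ν / 2 / 2 ^ X.card * T.card)
    (fun t ht => Finset.mem_powersetCard.mpr ⟨(hf t ht).1, (hf t ht).2.1⟩)
    (Finset.powersetCard_nonempty.mpr hMX') (by
      refine le_trans ?_ h2
      rw [nsmul_eq_mul]
      have hc : ((X.powersetCard M).card : ℝ) ≤ 2 ^ X.card := by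
        have : (X.powersetCard M).card ≤ X.powerset.card :=
          Finset.card_le_card (fun s hs => by
            rw [Finset.mem_powersetCard] at hs
            exact Finset.mem_powerset.mpr hs.1)
        rw [Finset.card_powerset] at this
        exact_mod_cast this
      calc _ ≤ (2 ^ X.card : ℝ) * (ν / 2 / 2 ^ X.card * T.card) := by gcongr
        _ = _ := by field_simp)
  rw [Finset.mem_powersetCard] at hS
  refine ⟨S, hS.1, hS.2, hS2.trans ?_⟩
  norm_cast
  apply Finset.card_le_card
  intro t ht
  rw [Finset.mem_filter] at ht
  rw [Finset.mem_filter]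
  refine ⟨(Finset.mem_filter.mp ht.1).1, ?_⟩
  have := (hf t ht.1).2.2
  rwa [ht.2] at this

def av (S : Finset ℕ) (f : ℕ → ℝ) : ℝ := (∑ a ∈ S, f a) / S.card

theorem av_sum {ι : Type} (S : Finset ℕ) (X : Finset ι) (f : ι → ℕ → ℝ) :
    av S (fun a => ∑ i ∈ X, f i a) = ∑ i ∈ X, av S (f i) := by
  unfold av
  rw [Finset.sum_comm, Finset.sum_div]

theorem av_le (S : Finset ℕ) (hS : S.Nonempty) (f : ℕ → ℝ) : ∃ a ∈ S, av S f ≤ f a := by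
  apply Finset.exists_le_of_sum_le hS
  have h0 : (0 : ℝ) < S.card := by exact_mod_cast Finset.card_pos.mpr hS
  rw [Finset.sum_const, nsmul_eq_mul, av]
  field_simp
  exact le_rfl

theorem av_comm (S T : Finset ℕ) (f : ℕ → ℕ → ℝ) :
    av S (fun a => av T (fun b => f a b)) = av T (fun b => av S (fun a => f a b)) := by
  unfold av
  simp only [← Finset.sum_div]
  rw [Finset.sum_comm, div_right_comm]

theorem select (ν : ℝ) (X Y Z : Finset ℕ) (PA PC : ℕ → Finset ℕ) (PB : ℕ → ℕ → Finset ℕ)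
    (hA : ∀ j ∈ Y, (PA j).Nonempty) (hC : ∀ l ∈ Z, (PC l).Nonempty)
    (hB : ∀ j ∈ Y, ∀ l ∈ Z, (PB j l).Nonempty)
    (e : ℕ → ℕ → ℕ → ℕ → ℕ → ℕ → ℝ)
    (h : ∀ i ∈ X, ∀ j ∈ Y, ∀ l ∈ Z,
      ν ≤ av (PA j) fun a => av (PB j l) fun b => av (PC l) fun c => e i j l a b c) :
    ∃ (a : ℕ → ℕ) (b : ℕ → ℕ → ℕ) (c : ℕ → ℕ), (∀ j ∈ Y, a j ∈ PA j) ∧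
      (∀ j ∈ Y, ∀ l ∈ Z, b j l ∈ PB j l) ∧ (∀ l ∈ Z, c l ∈ PC l) ∧
      ν * X.card * Y.card * Z.card ≤ ∑ j ∈ Y, ∑ l ∈ Z, ∑ i ∈ X, e i j l (a j) (b j l) (c l) := by
  have s1 : ∀ j, ∃ a, j ∈ Y → a ∈ PA j ∧ ∑ l ∈ Z, ∑ i ∈ X, (av (PA j) fun a => av (PB j l) fun b =>
      av (PC l) fun c => e i j l a b c) ≤ ∑ l ∈ Z, ∑ i ∈ X, av (PB j l) fun b =>
      av (PC l) fun c => e i j l a b c := by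
    intro j
    by_cases hj : j ∈ Y
    · obtain ⟨a, ha, hle⟩ := av_le (PA j) (hA j hj) (fun a => ∑ l ∈ Z, ∑ i ∈ X, av (PB j l) fun b =>
        av (PC l) fun c => e i j l a b c)
      refine ⟨a, fun _ => ⟨ha, ?_⟩⟩
      simpa only [av_sum] using hle
    · exact ⟨0, fun h => absurd h hj⟩
  choose a ha using s1
  have s2 : ∀ l, ∃ c, l ∈ Z → c ∈ PC l ∧ ∑ j ∈ Y, ∑ i ∈ X, (av (PC l) fun c => av (PB j l) fun b =>
      e i j l (a j) b c) ≤ ∑ j ∈ Y, ∑ i ∈ X, av (PB j l) fun b => e i j l (a j) b c := by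
    intro l
    by_cases hl : l ∈ Z
    · obtain ⟨c, hc, hle⟩ := av_le (PC l) (hC l hl) (fun c => ∑ j ∈ Y, ∑ i ∈ X, av (PB j l) fun b =>
        e i j l (a j) b c)
      refine ⟨c, fun _ => ⟨hc, ?_⟩⟩
      simpa only [av_sum] using hle
    · exact ⟨0, fun h => absurd h hl⟩
  choose c hc using s2
  have s3 : ∀ j l, ∃ b, j ∈ Y → l ∈ Z → b ∈ PB j l ∧ ∑ i ∈ X, (av (PB j l) fun b =>
      e i j l (a j) b (c l)) ≤ ∑ i ∈ X, e i j l (a j) b (c l) := by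
    intro j l
    by_cases hjl : j ∈ Y ∧ l ∈ Z
    · obtain ⟨b, hb, hle⟩ := av_le (PB j l) (hB j hjl.1 l hjl.2) (fun b => ∑ i ∈ X,
        e i j l (a j) b (c l))
      refine ⟨b, fun _ _ => ⟨hb, ?_⟩⟩
      simpa only [av_sum] using hle
    · exact ⟨0, fun h h' => absurd ⟨h, h'⟩ hjl⟩
  choose b hb using s3
  refine ⟨a, b, c, fun j hj => (ha j hj).1, fun j hj l hl => (hb j l hj hl).1,
    fun l hl => (hc l hl).1, ?_⟩
  calc ν * X.card * Y.card * Z.card = ∑ j ∈ Y, ∑ l ∈ Z, ∑ i ∈ X, ν := by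
        simp only [Finset.sum_const, nsmul_eq_mul]; ring
    _ ≤ ∑ j ∈ Y, ∑ l ∈ Z, ∑ i ∈ X, (av (PA j) fun a => av (PB j l) fun b =>
      av (PC l) fun c => e i j l a b c) := Finset.sum_le_sum fun j hj => Finset.sum_le_sum
        fun l hl => Finset.sum_le_sum fun i hi => h i hi j hj l hl
    _ ≤ ∑ j ∈ Y, ∑ l ∈ Z, ∑ i ∈ X, (av (PB j l) fun b =>
      av (PC l) fun c => e i j l (a j) b c) := Finset.sum_le_sum fun j hj => (ha j hj).2
    _ = ∑ l ∈ Z, ∑ j ∈ Y, ∑ i ∈ X, (av (PC l) fun c => av (PB j l) fun b =>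
      e i j l (a j) b c) := by
        rw [Finset.sum_comm]
        simp only [av_comm (PB _ _)]
    _ ≤ ∑ l ∈ Z, ∑ j ∈ Y, ∑ i ∈ X, (av (PB j l) fun b => e i j l (a j) b (c l)) :=
        Finset.sum_le_sum fun l hl => (hc l hl).2
    _ = ∑ j ∈ Y, ∑ l ∈ Z, ∑ i ∈ X, (av (PB j l) fun b => e i j l (a j) b (c l)) := Finset.sum_comm
    _ ≤ _ := Finset.sum_le_sum fun j hj => Finset.sum_le_sum fun l hl => (hb j l hj hl).2

theorem select2 (ν : ℝ) (hν : 0 < ν) (M nJ nL : ℕ) : ∃ m n p : ℕ, ∀ (X Y Z : Finset ℕ)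
    (PA PC : ℕ → Finset ℕ) (PB : ℕ → ℕ → Finset ℕ)
    (E : ℕ → ℕ → ℕ → ℕ → ℕ → ℕ → Prop), X.card = m → Y.card = n → Z.card = p →
    (∀ j ∈ Y, (PA j).Nonempty) → (∀ l ∈ Z, (PC l).Nonempty) →
    (∀ j ∈ Y, ∀ l ∈ Z, (PB j l).Nonempty) →
    (∀ i ∈ X, ∀ j ∈ Y, ∀ l ∈ Z,
      ν * (((PA j).card : ℝ) * ((PB j l).card : ℝ) * ((PC l).card : ℝ)) ≤
      (((PA j ×ˢ PB j l ×ˢ PC l).filter fun t => E i j l t.1 t.2.1 t.2.2).card : ℝ)) →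
    ∃ X' ⊆ X, ∃ Y' ⊆ Y, ∃ Z' ⊆ Z, X'.card = M ∧ Y'.card = nJ ∧ Z'.card = nL ∧
    ∃ (a : ℕ → ℕ) (b : ℕ → ℕ → ℕ) (c : ℕ → ℕ), (∀ j ∈ Y', a j ∈ PA j) ∧
      (∀ j ∈ Y', ∀ l ∈ Z', b j l ∈ PB j l) ∧ (∀ l ∈ Z', c l ∈ PC l) ∧
      ∀ i ∈ X', ∀ j ∈ Y', ∀ l ∈ Z', E i j l (a j) (b j l) (c l) := by
  obtain ⟨m, hm⟩ := exists_nat_ge ((M + 1) / (ν / 2))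
  set ν1 : ℝ := ν / 2 / 2 ^ m with hν1
  have hν1p : 0 < ν1 := by positivity
  obtain ⟨n, hn⟩ := exists_nat_ge ((nJ + 1) / (ν1 / 2))
  set ν2 : ℝ := ν1 / 2 / 2 ^ n with hν2
  have hν2p : 0 < ν2 := by positivity
  obtain ⟨p, hp⟩ := exists_nat_ge ((nL + 1) / ν2)
  rw [div_le_iff₀ (by positivity)] at hm hn hp
  have hm0 : 0 < m := by
    rcases Nat.eq_zero_or_pos m with h | h
    · exfalso; rw [h] at hm; simp at hm; have : (0:ℝ) ≤ M := by positivity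
      linarith
    · exact h
  have hn0 : 0 < n := by
    rcases Nat.eq_zero_or_pos n with h | h
    · exfalso; rw [h] at hn; simp at hn; have : (0:ℝ) ≤ nJ := by positivity
      linarith
    · exact h
  have hp0 : 0 < p := by
    rcases Nat.eq_zero_or_pos p with h | h
    · exfalso; rw [h] at hp; simp at hp; have : (0:ℝ) ≤ nL := by positivity
      linarith
    · exact h
  refine ⟨m, n, p, ?_⟩
  intro X Y Z PA PC PB E hX hY hZ hA hC hB hE
  have hXn : X.Nonempty := Finset.card_pos.mp (by omega)
  have hYn : Y.Nonempty := Finset.card_pos.mp (by omega)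
  have hZn : Z.Nonempty := Finset.card_pos.mp (by omega)
  obtain ⟨a, b, c, ha, hb, hc, hsum⟩ := select ν X Y Z PA PC PB hA hC hB
    (fun i j l a b c => if E i j l a b c then 1 else 0) (by
      intro i hi j hj l hl
      have h := hE i hi j hj l hl
      have h1 : (0 : ℝ) < (PA j).card := by exact_mod_cast Finset.card_pos.mpr (hA j hj)
      have h2 : (0 : ℝ) < (PB j l).card := by exact_mod_cast Finset.card_pos.mpr (hB j hj l hl)
      have h3 : (0 : ℝ) < (PC l).card := by exact_mod_cast Finset.card_pos.mpr (hC l hl)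
      rw [Finset.card_filter] at h
      push_cast at h
      rw [Finset.sum_product] at h
      simp only [Finset.sum_product] at h
      unfold av
      simp only [← Finset.sum_div]
      rw [le_div_iff₀ h1, le_div_iff₀ h2, le_div_iff₀ h3]
      refine le_trans (le_of_eq ?_) h
      ring)
  obtain ⟨X', hX', hXc, hX2⟩ := kst ν hν M X (Y ×ˢ Z)
    (fun i q => E i q.1 q.2 (a q.1) (b q.1 q.2) (c q.2)) hXn (hYn.product hZn) (by
      simp only [Finset.card_filter, Finset.sum_product]
      push_cast
      rw [Finset.sum_comm' (t' := Y) (s' := fun _ => X) (by simp)]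
      rw [Finset.card_product]
      push_cast
      rw [← mul_assoc]
      refine hsum.trans (le_of_eq ?_)
      refine Finset.sum_congr rfl fun j _ => ?_
      rw [Finset.sum_comm]) (by rw [hX]; linarith)
  rw [hX, ← hν1] at hX2
  obtain ⟨Y', hY', hYc, hY2⟩ := kst ν1 hν1p nJ Y Z
    (fun j l => ∀ i ∈ X', E i j l (a j) (b j l) (c l)) hYn hZn (by
      rw [Finset.card_product] at hX2
      push_cast at hX2
      rw [← mul_assoc] at hX2
      refine hX2.trans (le_of_eq ?_)
      simp only [Finset.card_filter, Finset.sum_product]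
      push_cast
      rfl) (by rw [hY]; linarith)
  rw [hY, ← hν2, hZ] at hY2
  obtain ⟨Z', hZ', hZc⟩ := Finset.exists_subset_card_eq (n := nL)
    (s := Z.filter fun l => ∀ j ∈ Y', ∀ i ∈ X', E i j l (a j) (b j l) (c l)) (by
      have : (nL : ℝ) ≤ ((Z.filter fun l => ∀ j ∈ Y', ∀ i ∈ X', E i j l (a j) (b j l) (c l)).card : ℝ) := by
        have h3 : (nL : ℝ) ≤ ν2 * p := by linarith
        have h4 := h3.trans hY2
        refine h4.trans (le_of_eq ?_)
        congr!
      exact_mod_cast this)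
  have hZZ : Z' ⊆ Z := fun l hl => (Finset.mem_filter.mp (hZ' hl)).1
  exact ⟨X', hX', Y', hY', Z', hZZ, hXc, hYc, hZc, a, b, c, fun j hj => ha j (hY' hj),
    fun j hj l hl => hb j (hY' hj) l (hZZ hl), fun l hl => hc l (hZZ hl),
    fun i hi j hj l hl => (Finset.mem_filter.mp (hZ' hl)).2 j hj i hi⟩

namespace ReducedHG

theorem mem_nbhd (A : ReducedHG) {j k a b c : ℕ} : c ∈ A.nbhd j k a b ↔ c ∈ A.P j k ∧ A.Edge a b c := by
  unfold nbhd; exact Finset.mem_filter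

theorem nbhd_sub (A : ReducedHG) (j k a b : ℕ) : A.nbhd j k a b ⊆ A.P j k := Finset.filter_subset _ _

theorem rot (A : ReducedHG) {a b c : ℕ} (h : A.Edge a b c) : A.Edge c a b :=
  A.EdgeSymm _ _ _ (A.EdgeSymm' _ _ _ h)

theorem k5_aux (A : ReducedHG) (x : Fin 5 → ℕ) (hx : StrictMono x) (g : Fin 5 → Fin 5 → ℕ)
    (hI : ∀ p, x p ∈ A.I) (hg : ∀ p q, p < q → g p q ∈ A.P (x p) (x q))
    (hE : ∀ p q r, p < q → q < r → A.Edge (g p q) (g p r) (g q r)) : A.SupportsK5 := by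
  have hinv : ∀ p, Function.invFun x (x p) = p := Function.leftInverse_invFun hx.injective
  refine ⟨Finset.univ.image x, ?_, ?_, fun i j => g (Function.invFun x (min i j)) (Function.invFun x (max i j)), ?_, ?_, ?_⟩
  · intro y hy
    obtain ⟨p, -, rfl⟩ := Finset.mem_image.mp hy
    exact hI p
  · rw [Finset.card_image_of_injective _ hx.injective]; simp
  · intro i _ j _
    simp only [min_comm, max_comm]
  · intro i hi j hj hij
    obtain ⟨p, -, rfl⟩ := Finset.mem_image.mp hi
    obtain ⟨q, -, rfl⟩ := Finset.mem_image.mp hj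
    rcases lt_trichotomy p q with h | h | h
    · have := hx h
      simp only [min_eq_left this.le, max_eq_right this.le, hinv]
      exact hg p q h
    · exact absurd (congrArg x h) hij
    · have := hx h
      simp only [min_eq_right this.le, max_eq_left this.le, hinv]
      rw [A.Psymm]
      exact hg q p h
  · intro i hi j hj k hk hij hik hjk
    obtain ⟨p, -, rfl⟩ := Finset.mem_image.mp hi
    obtain ⟨q, -, rfl⟩ := Finset.mem_image.mp hj
    obtain ⟨r, -, rfl⟩ := Finset.mem_image.mp hk
    have e1 : ∀ p q, p < q → Function.invFun x (min (x p) (x q)) = p := by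
      intro p q h; rw [min_eq_left (hx h).le, hinv]
    have e2 : ∀ p q, p < q → Function.invFun x (max (x p) (x q)) = q := by
      intro p q h; rw [max_eq_right (hx h).le, hinv]
    have e3 : ∀ p q, q < p → Function.invFun x (min (x p) (x q)) = q := by
      intro p q h; rw [min_eq_right (hx h).le, hinv]
    have e4 : ∀ p q, q < p → Function.invFun x (max (x p) (x q)) = p := by
      intro p q h; rw [max_eq_left (hx h).le, hinv]
    have npq : p ≠ q := fun h => hij (congrArg x h)
    have npr : p ≠ r := fun h => hik (congrArg x h)
    have nqr : q ≠ r := fun h => hjk (congrArg x h)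
    rcases lt_or_gt_of_ne npq with h1 | h1 <;> rcases lt_or_gt_of_ne npr with h2 | h2 <;>
      rcases lt_or_gt_of_ne nqr with h3 | h3
    · simp only [e1 _ _ h1, e1 _ _ h2, e1 _ _ h3, e2 _ _ h1, e2 _ _ h2, e2 _ _ h3]
      exact hE p q r h1 h3
    · simp only [e1 _ _ h1, e1 _ _ h2, e3 _ _ h3, e2 _ _ h1, e2 _ _ h2, e4 _ _ h3]
      exact A.EdgeSymm _ _ _ (hE p r q h2 h3)
    · exact absurd (h1.trans h3) (not_lt.mpr h2.le)
    · simp only [e1 _ _ h1, e3 _ _ h2, e3 _ _ h3, e2 _ _ h1, e4 _ _ h2, e4 _ _ h3]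
      exact A.rot (hE r p q h2 h1)
    · simp only [e3 _ _ h1, e1 _ _ h2, e1 _ _ h3, e4 _ _ h1, e2 _ _ h2, e2 _ _ h3]
      exact A.EdgeSymm' _ _ _ (hE q p r h1 h2)
    · exact absurd (h3.trans h1) (not_lt.mpr h2.le)
    · simp only [e3 _ _ h1, e3 _ _ h2, e1 _ _ h3, e4 _ _ h1, e4 _ _ h2, e2 _ _ h3]
      exact A.rot (A.rot (hE q r p h3 h2))
    · simp only [e3 _ _ h1, e3 _ _ h2, e3 _ _ h3, e4 _ _ h1, e4 _ _ h2, e4 _ _ h3]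
      exact A.EdgeSymm' _ _ _ (A.rot (hE r q p h3 h1))

theorem k5 (A : ReducedHG) {a b c d e : ℕ} (hab : a < b) (hbc : b < c) (hcd : c < d) (hde : d < e)
    (ha : a ∈ A.I) (hb : b ∈ A.I) (hc : c ∈ A.I) (hd : d ∈ A.I) (he : e ∈ A.I)
    {ab ac ad ae bc bd be cd ce de : ℕ}
    (mab : ab ∈ A.P a b) (mac : ac ∈ A.P a c) (mad : ad ∈ A.P a d) (mae : ae ∈ A.P a e)
    (mbc : bc ∈ A.P b c) (mbd : bd ∈ A.P b d) (mbe : be ∈ A.P b e)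
    (mcd : cd ∈ A.P c d) (mce : ce ∈ A.P c e) (mde : de ∈ A.P d e)
    (h1 : A.Edge ab ac bc) (h2 : A.Edge ab ad bd) (h3 : A.Edge ab ae be)
    (h4 : A.Edge ac ad cd) (h5 : A.Edge ac ae ce) (h6 : A.Edge ad ae de)
    (h7 : A.Edge bc bd cd) (h8 : A.Edge bc be ce) (h9 : A.Edge bd be de)
    (h10 : A.Edge cd ce de) : A.SupportsK5 := by
  refine A.k5_aux ![a, b, c, d, e] ?_
    ![![0, ab, ac, ad, ae], ![0, 0, bc, bd, be], ![0, 0, 0, cd, ce], ![0, 0, 0, 0, de], ![0,0,0,0,0]] ?_ ?_ ?_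
  · rw [Fin.strictMono_iff_lt_succ]
    intro i
    fin_cases i <;> simpa
  · intro p
    fin_cases p <;> simpa
  · intro p q hpq
    fin_cases p <;> fin_cases q <;> first | (exact absurd hpq (by decide)) | assumption
  · intro p q r hpq hqr
    fin_cases p <;> fin_cases q <;> first | (exact absurd hpq (by decide)) | (fin_cases r <;> first | (exact absurd hqr (by decide)) | assumption)

end ReducedHG

namespace ReducedHG

theorem claim1 (A : ReducedHG) (ε : ℝ) (m0 : ℕ) (hm0 : 1 < ε * m0) (hε : 0 < ε) (hK : ¬ A.SupportsK5)
    (X : Finset ℕ) (hX : X ⊆ A.I) (y l l' : ℕ) (hy : y ∈ A.I) (hl : l ∈ A.I) (hl' : l' ∈ A.I)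
    (hXy : ∀ i ∈ X, i < y) (hyl : y < l) (hll : l < l') (Q R : ℕ → ℕ → ℕ) (b b' : ℕ)
    (hb : b ∈ A.P y l) (hb' : b' ∈ A.P y l')
    (mQ : ∀ i ∈ X, Q i y ∈ A.P i y) (mR : ∀ i ∈ X, R i l ∈ A.P i l)
    (mR' : ∀ i ∈ X, R i l' ∈ A.P i l')
    (e1 : ∀ i ∈ X, A.Edge (Q i y) (R i l) b) (e2 : ∀ i ∈ X, A.Edge (Q i y) (R i l') b')
    (hT : ∀ i ∈ X, ∀ i' ∈ X, i < i' → ∃ p ∈ A.P i i', A.Edge (Q i y) (Q i' y) p ∧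
      A.Edge (R i l) (R i' l) p ∧ A.Edge (R i l') (R i' l') p) :
    (X.filter fun i => ε * ((A.P l l').card : ℝ) ≤
      ((A.nbhd l l' (R i l) (R i l') ∩ A.nbhd l l' b b').card : ℝ)).card < m0 := by
  by_contra hcon
  push Not at hcon
  obtain ⟨i, hi, i', hi', hii, p, hp, hp'⟩ := pigeon ε _
    (fun i => A.nbhd l l' (R i l) (R i l') ∩ A.nbhd l l' b b') (A.P l l')
    (A.Pnonempty _ _ hl hl' hll.ne)
    (fun i _ => Finset.inter_subset_left.trans (A.nbhd_sub _ _ _ _))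
    (fun i hi => (Finset.mem_filter.mp hi).2) (lt_of_lt_of_le hm0 (by gcongr))
  rw [Finset.mem_inter, mem_nbhd, mem_nbhd] at hp hp'
  have hi := (Finset.mem_filter.mp hi).1
  have hi' := (Finset.mem_filter.mp hi').1
  obtain ⟨q, hq, q1, q2, q3⟩ := hT i hi i' hi' hii
  exact hK (A.k5 hii (hXy i' hi') hyl hll (hX hi) (hX hi') hy hl hl' hq (mQ i hi) (mR i hi) (mR' i hi)
    (mQ i' hi') (mR i' hi') (mR' i' hi') hb hb' hp.1.1 (A.rot q1) (A.rot q2) (A.rot q3)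
    (e1 i hi) (e2 i hi) hp.1.2 (e1 i' hi') (e2 i' hi') hp'.1.2 hp.2.2)

theorem claim2 (A : ReducedHG) (ε : ℝ) (m0 : ℕ) (hm0 : 1 < ε * m0) (hε : 0 < ε) (hK : ¬ A.SupportsK5)
    (X : Finset ℕ) (hX : X ⊆ A.I) (j j' z : ℕ) (hj : j ∈ A.I) (hj' : j' ∈ A.I) (hz : z ∈ A.I)
    (hXj : ∀ i ∈ X, i < j) (hjj : j < j') (hjz : j' < z) (Q R : ℕ → ℕ → ℕ) (a a' : ℕ)
    (ha : a ∈ A.P j z) (ha' : a' ∈ A.P j' z)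
    (mQ : ∀ i ∈ X, Q i j ∈ A.P i j) (mQ' : ∀ i ∈ X, Q i j' ∈ A.P i j')
    (mR : ∀ i ∈ X, R i z ∈ A.P i z)
    (e1 : ∀ i ∈ X, A.Edge (Q i j) (R i z) a) (e2 : ∀ i ∈ X, A.Edge (Q i j') (R i z) a')
    (hT : ∀ i ∈ X, ∀ i' ∈ X, i < i' → ∃ p ∈ A.P i i', A.Edge (Q i j) (Q i' j) p ∧
      A.Edge (Q i j') (Q i' j') p ∧ A.Edge (R i z) (R i' z) p) :
    (X.filter fun i => ε * ((A.P j j').card : ℝ) ≤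
      ((A.nbhd j j' (Q i j) (Q i j') ∩ A.nbhd j j' a a').card : ℝ)).card < m0 := by
  by_contra hcon
  push Not at hcon
  obtain ⟨i, hi, i', hi', hii, p, hp, hp'⟩ := pigeon ε _
    (fun i => A.nbhd j j' (Q i j) (Q i j') ∩ A.nbhd j j' a a') (A.P j j')
    (A.Pnonempty _ _ hj hj' hjj.ne)
    (fun i _ => Finset.inter_subset_left.trans (A.nbhd_sub _ _ _ _))
    (fun i hi => (Finset.mem_filter.mp hi).2) (lt_of_lt_of_le hm0 (by gcongr))
  rw [Finset.mem_inter, mem_nbhd, mem_nbhd] at hp hp'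
  have hi := (Finset.mem_filter.mp hi).1
  have hi' := (Finset.mem_filter.mp hi').1
  obtain ⟨q, hq, q1, q2, q3⟩ := hT i hi i' hi' hii
  exact hK (A.k5 hii (hXj i' hi') hjj hjz (hX hi) (hX hi') hj hj' hz hq (mQ i hi) (mQ' i hi) (mR i hi)
    (mQ i' hi') (mQ' i' hi') (mR i' hi') hp.1.1 ha ha' (A.rot q1) (A.rot q2) (A.rot q3)
    hp.1.2 (e1 i hi) (e2 i hi) hp'.1.2 (e1 i' hi') (e2 i' hi') (A.rot hp.2.2))

theorem exists_outside (X : Finset ℕ) (m0 : ℕ) (p q : ℕ → Prop) (hX : 2 * m0 ≤ X.card)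
    (h1 : (X.filter p).card < m0) (h2 : (X.filter q).card < m0) : ∃ i ∈ X, ¬ p i ∧ ¬ q i := by
  by_contra hcon
  push Not at hcon
  have : X ⊆ X.filter p ∪ X.filter q := by
    intro i hi
    rw [Finset.mem_union, Finset.mem_filter, Finset.mem_filter]
    by_cases hp : p i
    · exact Or.inl ⟨hi, hp⟩
    · exact Or.inr ⟨hi, hcon i hi hp⟩
  have := (Finset.card_le_card this).trans (Finset.card_union_le _ _)
  omega

theorem core (A : ReducedHG) (ε : ℝ) (m0 : ℕ) (hm0 : 1 < ε * m0) (hε : 0 < ε) (hW : A.Wicked ε)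
    (X Y Z : Finset ℕ) (k : ℕ) (hX : X ⊆ A.I) (hY : Y ⊆ A.I) (hk : k ∈ A.I) (hZ : Z ⊆ A.I)
    (hXY : ∀ i ∈ X, ∀ j ∈ Y, i < j) (hXk : ∀ i ∈ X, i < k) (hYk : ∀ j ∈ Y, j < k)
    (hkZ : ∀ l ∈ Z, k < l)
    (cX : 2 * m0 ≤ X.card) (cZ : Z.card = m0)
    (hRam : ∀ c : (Fin 2 → ℕ) → Fin m0 × Fin m0, ∃ H ⊆ Y, H.card = m0 ∧ ∃ col, ∀ x : Fin 2 → ℕ,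
      StrictMono x → (∀ p, x p ∈ H) → c x = col)
    (Q R : ℕ → ℕ → ℕ) (a : ℕ → ℕ) (b : ℕ → ℕ → ℕ) (c : ℕ → ℕ) (V : Finset ℕ)
    (hYV : Y ⊆ V) (hkV : k ∈ V) (hZV : Z ⊆ V)
    (mQ : ∀ i ∈ X, ∀ x ∈ V, Q i x ∈ A.P i x) (mR : ∀ i ∈ X, ∀ x ∈ V, R i x ∈ A.P i x)
    (ma : ∀ j ∈ Y, a j ∈ A.P j k) (mb : ∀ j ∈ Y, ∀ l ∈ Z, b j l ∈ A.P j l)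
    (mc : ∀ l ∈ Z, c l ∈ A.P k l)
    (ea : ∀ i ∈ X, ∀ j ∈ Y, A.Edge (Q i j) (R i k) (a j))
    (eb : ∀ i ∈ X, ∀ j ∈ Y, ∀ l ∈ Z, A.Edge (Q i j) (R i l) (b j l))
    (ec : ∀ i ∈ X, ∀ l ∈ Z, A.Edge (Q i k) (R i l) (c l))
    (eabc : ∀ j ∈ Y, ∀ l ∈ Z, A.Edge (a j) (b j l) (c l))
    (hT : ∀ i ∈ X, ∀ i' ∈ X, i < i' → ∀ x ∈ V, ∀ y ∈ V, ∀ z ∈ V, x < y → y < z →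
      (∃ p ∈ A.P i i', A.Edge (Q i x) (Q i' x) p ∧
        A.Edge (Q i y) (Q i' y) p ∧ A.Edge (R i z) (R i' z) p) ∧
      (∃ p ∈ A.P i i', A.Edge (Q i x) (Q i' x) p ∧
        A.Edge (R i y) (R i' y) p ∧ A.Edge (R i z) (R i' z) p)) : False := by
  obtain ⟨hD, hK⟩ := hW
  have hYZ : ∀ j ∈ Y, ∀ l ∈ Z, j < l := fun j hj l hl => (hYk j hj).trans (hkZ l hl)
  have hXZ : ∀ j ∈ X, ∀ l ∈ Z, j < l := fun j hj l hl => (hXk j hj).trans (hkZ l hl)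
  have D : ∀ j ∈ Y, ∀ l ∈ Z, ∀ l' ∈ Z, l < l' → ε * ((A.P l l').card : ℝ) ≤
      ((A.nbhd l l' (b j l) (b j l') ∩ A.nbhd l l' (c l) (c l')).card : ℝ) := by
    intro j hj l hl l' hl' hll
    have c1 := A.claim1 ε m0 hm0 hε hK X hX j l l' (hY hj) (hZ hl) (hZ hl')
      (fun i hi => hXY i hi j hj) (hYZ j hj l hl) hll Q R (b j l) (b j l')
      (mb j hj l hl) (mb j hj l' hl') (fun i hi => mQ i hi j (hYV hj))
      (fun i hi => mR i hi l (hZV hl)) (fun i hi => mR i hi l' (hZV hl'))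
      (fun i hi => eb i hi j hj l hl) (fun i hi => eb i hi j hj l' hl')
      (fun i hi i' hi' hii => (hT i hi i' hi' hii j (hYV hj) l (hZV hl) l' (hZV hl')
        (hYZ j hj l hl) hll).2)
    have c2 := A.claim1 ε m0 hm0 hε hK X hX k l l' hk (hZ hl) (hZ hl')
      (fun i hi => hXk i hi) (hkZ l hl) hll Q R (c l) (c l')
      (mc l hl) (mc l' hl') (fun i hi => mQ i hi k hkV)
      (fun i hi => mR i hi l (hZV hl)) (fun i hi => mR i hi l' (hZV hl'))
      (fun i hi => ec i hi l hl) (fun i hi => ec i hi l' hl')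
      (fun i hi i' hi' hii => (hT i hi i' hi' hii k hkV l (hZV hl) l' (hZV hl')
        (hkZ l hl) hll).2)
    obtain ⟨i, hi, n1, n2⟩ := exists_outside X m0 _ _ cX c1 c2
    refine three_sets ε (A.P l l') _ _ _ (A.nbhd_sub _ _ _ _) (A.nbhd_sub _ _ _ _)
      (A.nbhd_sub _ _ _ _) ?_ ?_ ?_ n1 n2
    · exact hD i l l' (hX hi) (hZ hl) (hZ hl') (hXZ i hi l hl).ne (hXZ i hi l' hl').ne hll.ne
        _ (mR i hi l (hZV hl)) _ (mR i hi l' (hZV hl'))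
    · exact hD j l l' (hY hj) (hZ hl) (hZ hl') (hYZ j hj l hl).ne (hYZ j hj l' hl').ne hll.ne
        _ (mb j hj l hl) _ (mb j hj l' hl')
    · exact hD k l l' hk (hZ hl) (hZ hl') (hkZ l hl).ne (hkZ l' hl').ne hll.ne
        _ (mc l hl) _ (mc l' hl')
  have E : ∀ j ∈ Y, ∀ j' ∈ Y, j < j' → ∀ l ∈ Z, ε * ((A.P j j').card : ℝ) ≤
      ((A.nbhd j j' (a j) (a j') ∩ A.nbhd j j' (b j l) (b j' l)).card : ℝ) := by
    intro j hj j' hj' hjj l hl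
    have c1 := A.claim2 ε m0 hm0 hε hK X hX j j' k (hY hj) (hY hj') hk
      (fun i hi => hXY i hi j hj) hjj (hYk j' hj') Q R (a j) (a j')
      (ma j hj) (ma j' hj') (fun i hi => mQ i hi j (hYV hj)) (fun i hi => mQ i hi j' (hYV hj'))
      (fun i hi => mR i hi k hkV)
      (fun i hi => ea i hi j hj) (fun i hi => ea i hi j' hj')
      (fun i hi i' hi' hii => (hT i hi i' hi' hii j (hYV hj) j' (hYV hj') k hkV
        hjj (hYk j' hj')).1)
    have c2 := A.claim2 ε m0 hm0 hε hK X hX j j' l (hY hj) (hY hj') (hZ hl)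
      (fun i hi => hXY i hi j hj) hjj (hYZ j' hj' l hl) Q R (b j l) (b j' l)
      (mb j hj l hl) (mb j' hj' l hl) (fun i hi => mQ i hi j (hYV hj))
      (fun i hi => mQ i hi j' (hYV hj'))
      (fun i hi => mR i hi l (hZV hl))
      (fun i hi => eb i hi j hj l hl) (fun i hi => eb i hi j' hj' l hl)
      (fun i hi i' hi' hii => (hT i hi i' hi' hii j (hYV hj) j' (hYV hj') l (hZV hl)
        hjj (hYZ j' hj' l hl)).1)
    obtain ⟨i, hi, n1, n2⟩ := exists_outside X m0 _ _ cX c1 c2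
    refine three_sets ε (A.P j j') _ _ _ (A.nbhd_sub _ _ _ _) (A.nbhd_sub _ _ _ _)
      (A.nbhd_sub _ _ _ _) ?_ ?_ ?_ n1 n2
    · exact hD i j j' (hX hi) (hY hj) (hY hj') (hXY i hi j hj).ne (hXY i hi j' hj').ne hjj.ne
        _ (mQ i hi j (hYV hj)) _ (mQ i hi j' (hYV hj'))
    · exact hD k j j' hk (hY hj) (hY hj') (hYk j hj).ne' (hYk j' hj').ne' hjj.ne
        _ (A.Psymm j k ▸ ma j hj) _ (A.Psymm j' k ▸ ma j' hj')
    · exact hD l j j' (hZ hl) (hY hj) (hY hj') (hYZ j hj l hl).ne' (hYZ j' hj' l hl).ne' hjj.ne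
        _ (A.Psymm j l ▸ mb j hj l hl) _ (A.Psymm j' l ▸ mb j' hj' l hl)
  set z := Z.orderEmbOfFin cZ with hz
  have hzZ : ∀ u, z u ∈ Z := fun u => Finset.orderEmbOfFin_mem Z cZ u
  have hm0' : 0 < m0 := by
    rcases Nat.eq_zero_or_pos m0 with h | h
    · rw [h] at hm0; norm_num at hm0
    · exact h
  have G : ∀ x : Fin 2 → ℕ, ∃ uv : Fin m0 × Fin m0, x 0 ∈ Y → x 1 ∈ Y → x 0 < x 1 →
      uv.1 < uv.2 ∧ ∃ q ∈ A.P (x 0) (x 1), A.Edge (a (x 0)) (a (x 1)) q ∧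
        A.Edge (b (x 0) (z uv.1)) (b (x 1) (z uv.1)) q ∧
        A.Edge (b (x 0) (z uv.2)) (b (x 1) (z uv.2)) q := by
    intro x
    by_cases h : x 0 ∈ Y ∧ x 1 ∈ Y ∧ x 0 < x 1
    · obtain ⟨h0, h1, h01⟩ := h
      obtain ⟨u, -, v, -, huv, q, hq, hq'⟩ := pigeon ε (Finset.univ : Finset (Fin m0))
        (fun u => A.nbhd (x 0) (x 1) (a (x 0)) (a (x 1)) ∩
          A.nbhd (x 0) (x 1) (b (x 0) (z u)) (b (x 1) (z u))) (A.P (x 0) (x 1))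
        (A.Pnonempty _ _ (hY h0) (hY h1) h01.ne)
        (fun i _ => Finset.inter_subset_left.trans (A.nbhd_sub _ _ _ _))
        (fun u _ => E _ h0 _ h1 h01 _ (hzZ u)) (by simpa using hm0)
      rw [Finset.mem_inter, mem_nbhd, mem_nbhd] at hq hq'
      exact ⟨(u, v), fun _ _ _ => ⟨huv, q, hq.1.1, hq.1.2, hq.2.2, hq'.2.2⟩⟩
    · exact ⟨(⟨0, hm0'⟩, ⟨0, hm0'⟩), fun h0 h1 h2 => absurd ⟨h0, h1, h2⟩ h⟩
  choose col hcol using G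
  obtain ⟨H, hHY, hHc, ⟨u, v⟩, hH⟩ := hRam col
  have hH2 : ∀ j ∈ H, ∀ j' ∈ H, j < j' → u < v ∧ ∃ q ∈ A.P j j', A.Edge (a j) (a j') q ∧
        A.Edge (b j (z u)) (b j' (z u)) q ∧ A.Edge (b j (z v)) (b j' (z v)) q := by
    intro j hj j' hj' hjj
    have h1 := hcol ![j, j'] (hHY hj) (hHY hj') hjj
    rw [hH ![j, j'] (by
      rw [Fin.strictMono_iff_lt_succ]
      intro i
      fin_cases i; simpa) (by intro p; fin_cases p <;> simpa)] at h1
    exact h1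
  by_cases huv : u < v
  swap
  · have hHn : 1 < H.card := by
      by_contra hc
      have h2 : H.card ≤ 1 := by omega
      rw [hHc] at h2
      -- then `m0 = 1`, so `Fin m0` is a subsingleton and `ε > 1`
      have h3 : (m0 : ℝ) = 1 := by exact_mod_cast le_antisymm h2 hm0'
      rw [h3, mul_one] at hm0
      obtain ⟨i, hi⟩ : X.Nonempty := Finset.card_pos.mp (by omega)
      obtain ⟨j, hj⟩ : H.Nonempty := Finset.card_pos.mp (by omega)
      have hj := hHY hj
      have h5 := hD i j k (hX hi) (hY hj) hk (hXY i hi j hj).ne (hXk i hi).ne (hYk j hj).ne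
        _ (mQ i hi j (hYV hj)) _ (mQ i hi k hkV)
      have h6 := Finset.card_le_card (A.nbhd_sub j k (Q i j) (Q i k))
      have h7 : (0 : ℝ) < (A.P j k).card := by
        exact_mod_cast Finset.card_pos.mpr (A.Pnonempty _ _ (hY hj) hk (hYk j hj).ne)
      have h8 : ((A.nbhd j k (Q i j) (Q i k)).card : ℝ) ≤ (A.P j k).card := by exact_mod_cast h6
      nlinarith
    obtain ⟨x, hx, y, hy, hxy⟩ := Finset.one_lt_card.mp hHn
    rcases lt_or_gt_of_ne hxy with h | h
    · exact huv (hH2 x hx y hy h).1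
    · exact huv (hH2 y hy x hx h).1
  have hll : z u < z v := z.strictMono huv
  obtain ⟨j, hj, j', hj', hjj, p, hp, hp'⟩ := pigeon ε H
    (fun j => A.nbhd (z u) (z v) (b j (z u)) (b j (z v)) ∩ A.nbhd (z u) (z v) (c (z u)) (c (z v)))
    (A.P (z u) (z v)) (A.Pnonempty _ _ (hZ (hzZ u)) (hZ (hzZ v)) hll.ne)
    (fun i _ => Finset.inter_subset_left.trans (A.nbhd_sub _ _ _ _))
    (fun j hj => D j (hHY hj) _ (hzZ u) _ (hzZ v) hll) (by rw [hHc]; exact hm0)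
  rw [Finset.mem_inter, mem_nbhd, mem_nbhd] at hp hp'
  obtain ⟨-, q, hq, q1, q2, q3⟩ := hH2 j hj j' hj' hjj
  have hj := hHY hj
  have hj' := hHY hj'
  exact hK (A.k5 hjj (hYk j' hj') (hkZ _ (hzZ u)) hll (hY hj) (hY hj') hk (hZ (hzZ u)) (hZ (hzZ v))
    hq (ma j hj) (mb j hj _ (hzZ u)) (mb j hj _ (hzZ v)) (ma j' hj') (mb j' hj' _ (hzZ u))
    (mb j' hj' _ (hzZ v)) (mc _ (hzZ u)) (mc _ (hzZ v)) hp.1.1 (A.rot q1) (A.rot q2) (A.rot q3)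
    (eabc j hj _ (hzZ u)) (eabc j hj _ (hzZ v)) hp.1.2
    (eabc j' hj' _ (hzZ u)) (eabc j' hj' _ (hzZ v)) hp'.1.2 hp.2.2)

end ReducedHG

/-- Lemma (`lem:2148`): holes derived from two transversals, first case. -/
theorem holes_from_two_transversals_left :
    ∀ (ε ν : ℝ) (t : ℕ), 0 < ε → 0 < ν → ∃ s : ℕ,
      ∀ (A : ReducedHG) (J : Finset ℕ), A.Wicked ε → J ⊆ A.I → s ≤ J.card →
        ∀ Q R : ℕ → ℕ → ℕ, A.IsTransversal J Q → A.IsTransversal J R →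
          (∀ i ∈ J, ∀ j ∈ J, ∀ k ∈ J, ∀ l ∈ J, i < j → j < k → k < l →
            ε * ((A.P i j).card : ℝ) ≤
              ((A.nbhd i j (Q i k) (Q j k) ∩ A.nbhd i j (R i l) (R j l)).card : ℝ)) →
          ∃ Js ⊆ J, Js.card = t ∧
            ∀ i ∈ Js, ∀ j ∈ Js, ∀ k ∈ Js, ∀ l ∈ Js, i < j → j < k → k < l →
              (A.ecount (A.nbhd j k (Q i j) (R i k)) (A.nbhd j l (Q i j) (R i l))
                  (A.nbhd k l (Q i k) (R i l)) : ℝ) ≤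
                ν * (((A.P j k).card : ℝ) * ((A.P j l).card : ℝ) *
                  ((A.P k l).card : ℝ)) := by
  intro ε ν t hε hν
  obtain ⟨m0, hm0⟩ := exists_nat_gt (1 / ε)
  rw [div_lt_iff₀ hε, mul_comm] at hm0
  have hm0' : 0 < m0 := by
    rcases Nat.eq_zero_or_pos m0 with h | h
    · rw [h] at hm0; norm_num at hm0
    · exact h
  have : Nonempty (Fin m0 × Fin m0) := ⟨(⟨0, hm0'⟩, ⟨0, hm0'⟩)⟩
  obtain ⟨nJ, hnJ⟩ := ramsey_tuple (Fin m0 × Fin m0) 2 m0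
  obtain ⟨m, n, p, hsel⟩ := select2 ν hν (2 * m0) nJ m0
  obtain ⟨s5, hs5⟩ := ramsey_tuple (Prop × Prop) 5 (max (m + (n + (1 + p))) (2 + 2 * m0))
  obtain ⟨s4, hs4⟩ := ramsey_tuple Prop 4 (max t s5)
  refine ⟨s4, ?_⟩
  intro A J hW hJI hJ Q R hQ hR hyp
  obtain ⟨H4, hH4, cH4, col, hcol⟩ := hs4 J (fun x =>
    (A.ecount (A.nbhd (x 1) (x 2) (Q (x 0) (x 1)) (R (x 0) (x 2)))
      (A.nbhd (x 1) (x 3) (Q (x 0) (x 1)) (R (x 0) (x 3)))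
      (A.nbhd (x 2) (x 3) (Q (x 0) (x 2)) (R (x 0) (x 3))) : ℝ) ≤
      ν * (((A.P (x 1) (x 2)).card : ℝ) * ((A.P (x 1) (x 3)).card : ℝ) *
        ((A.P (x 2) (x 3)).card : ℝ))) hJ
  have hcol' : ∀ i ∈ H4, ∀ j ∈ H4, ∀ k ∈ H4, ∀ l ∈ H4, i < j → j < k → k < l →
      ((A.ecount (A.nbhd j k (Q i j) (R i k)) (A.nbhd j l (Q i j) (R i l))
          (A.nbhd k l (Q i k) (R i l)) : ℝ) ≤
        ν * (((A.P j k).card : ℝ) * ((A.P j l).card : ℝ) *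
          ((A.P k l).card : ℝ))) = col := by
    intro i hi j hj k hk l hl hij hjk hkl
    exact hcol ![i, j, k, l] (by
      rw [Fin.strictMono_iff_lt_succ]
      intro u
      fin_cases u <;> simpa) (by intro u; fin_cases u <;> simpa)
  by_cases hc : col
  · obtain ⟨Js, hJs, cJs⟩ := Finset.exists_subset_card_eq (s := H4) (n := t) (by
      rw [cH4]; exact le_max_left _ _)
    refine ⟨Js, hJs.trans hH4, cJs, ?_⟩
    intro i hi j hj k hk l hl hij hjk hkl
    rw [hcol' i (hJs hi) j (hJs hj) k (hJs hk) l (hJs hl) hij hjk hkl]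
    exact hc
  exfalso
  obtain ⟨H, hH, cH, ⟨col1, col2⟩, hcol5⟩ := hs5 H4 (fun x =>
    ((∃ p ∈ A.P (x 0) (x 1), A.Edge (Q (x 0) (x 2)) (Q (x 1) (x 2)) p ∧
        A.Edge (Q (x 0) (x 3)) (Q (x 1) (x 3)) p ∧ A.Edge (R (x 0) (x 4)) (R (x 1) (x 4)) p),
      (∃ p ∈ A.P (x 0) (x 1), A.Edge (Q (x 0) (x 2)) (Q (x 1) (x 2)) p ∧
        A.Edge (R (x 0) (x 3)) (R (x 1) (x 3)) p ∧ A.Edge (R (x 0) (x 4)) (R (x 1) (x 4)) p)))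
    (by rw [cH4]; exact le_max_right _ _)
  have hcolT : ∀ i ∈ H, ∀ i' ∈ H, ∀ x ∈ H, ∀ y ∈ H, ∀ z ∈ H, i < i' → i' < x → x < y → y < z →
      (∃ p ∈ A.P i i', A.Edge (Q i x) (Q i' x) p ∧
        A.Edge (Q i y) (Q i' y) p ∧ A.Edge (R i z) (R i' z) p) = col1 ∧
      (∃ p ∈ A.P i i', A.Edge (Q i x) (Q i' x) p ∧
        A.Edge (R i y) (R i' y) p ∧ A.Edge (R i z) (R i' z) p) = col2 := by
    intro i hi i' hi' x hx y hy z hz h1 h2 h3 h4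
    have := hcol5 ![i, i', x, y, z] (by
      rw [Fin.strictMono_iff_lt_succ]
      intro u
      fin_cases u <;> simpa) (by intro u; fin_cases u <;> simpa)
    exact Prod.mk.injEq _ _ _ _ ▸ this
  have hHJ : H ⊆ J := hH.trans hH4
  have hHI : H ⊆ A.I := hHJ.trans hJI
  have hcc : col1 ∧ col2 := by
    obtain ⟨e, heH, hem⟩ : ∃ e : ℕ → ℕ, (∀ u < 2 + 2 * m0, e u ∈ H) ∧
        ∀ u v, u < v → v < 2 + 2 * m0 → e u < e v := by
      have hle : 2 + 2 * m0 ≤ H.card := by rw [cH]; exact le_max_right _ _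
      refine ⟨fun u => if h : u < H.card then H.orderEmbOfFin rfl ⟨u, h⟩ else 0, ?_, ?_⟩
      · intro u hu
        simp only
        rw [dif_pos (show u < H.card by omega)]
        exact Finset.orderEmbOfFin_mem _ _ _
      · intro u v huv hv
        simp only
        rw [dif_pos (show u < H.card by omega), dif_pos (show v < H.card by omega)]
        exact (H.orderEmbOfFin rfl).strictMono huv
    have h01 : e 0 < e 1 := hem 0 1 (by omega) (by omega)
    have h0 := heH 0 (by omega)
    have h1 := heH 1 (by omega)
    obtain ⟨u, hu, v, hv, huv, q, hq, hq'⟩ := pigeon ε (Finset.range m0)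
      (fun u => A.nbhd (e 0) (e 1) (Q (e 0) (e (2 + 2 * u))) (Q (e 1) (e (2 + 2 * u))) ∩
        A.nbhd (e 0) (e 1) (R (e 0) (e (3 + 2 * u))) (R (e 1) (e (3 + 2 * u)))) (A.P (e 0) (e 1))
      (A.Pnonempty _ _ (hHI h0) (hHI h1) h01.ne)
      (fun i _ => Finset.inter_subset_left.trans (A.nbhd_sub _ _ _ _))
      (by
        intro u hu
        rw [Finset.mem_range] at hu
        exact hyp _ (hHJ h0) _ (hHJ h1) _ (hHJ (heH _ (by omega))) _ (hHJ (heH _ (by omega))) h01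
          (hem _ _ (by omega) (by omega)) (hem _ _ (by omega) (by omega)))
      (by rw [Finset.card_range]; exact hm0)
    rw [Finset.mem_range] at hu hv
    rw [Finset.mem_inter, ReducedHG.mem_nbhd, ReducedHG.mem_nbhd] at hq hq'
    constructor
    · rw [← (hcolT _ h0 _ h1 (e (2 + 2 * u)) (heH _ (by omega)) (e (2 + 2 * v)) (heH _ (by omega))
        (e (3 + 2 * v)) (heH _ (by omega)) h01 (hem _ _ (by omega) (by omega))
        (hem _ _ (by omega) (by omega)) (hem _ _ (by omega) (by omega))).1]
      exact ⟨q, hq.1.1, hq.1.2, hq'.1.2, hq'.2.2⟩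
    · rw [← (hcolT _ h0 _ h1 (e (2 + 2 * u)) (heH _ (by omega)) (e (3 + 2 * u)) (heH _ (by omega))
        (e (3 + 2 * v)) (heH _ (by omega)) h01 (hem _ _ (by omega) (by omega))
        (hem _ _ (by omega) (by omega)) (hem _ _ (by omega) (by omega))).2]
      exact ⟨q, hq.1.1, hq.1.2, hq.2.2, hq'.2.2⟩
  obtain ⟨X, hX, V, hV, cX, cV, hXV⟩ := split_lt H m (n + (1 + p)) (by
    rw [cH]; exact le_max_left _ _)
  obtain ⟨Y, hY, V', hV', cY, cV', hYV'⟩ := split_lt V n (1 + p) cV.ge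
  obtain ⟨K, hK, Z, hZ, cK, cZ, hKZ⟩ := split_lt V' 1 p cV'.ge
  obtain ⟨k, rfl⟩ := Finset.card_eq_one.mp cK
  have hkV' : k ∈ V' := hK (Finset.mem_singleton_self k)
  have hkV : k ∈ V := hV' hkV'
  have hZV : Z ⊆ V := hZ.trans hV'
  have hkZ : ∀ l ∈ Z, k < l := fun l hl => hKZ k (Finset.mem_singleton_self k) l hl
  have hYk : ∀ j ∈ Y, j < k := fun j hj => hYV' j hj k hkV'
  have hYZ : ∀ j ∈ Y, ∀ l ∈ Z, j < l := fun j hj l hl => hYV' j hj l (hZ hl)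
  have iV : ∀ x ∈ V, x ∈ A.I := fun x hx => hHI (hV hx)
  obtain ⟨X', hX', Y', hY', Z', hZ', cX', cY', cZ', a, b, c, ma, mb, mc, hE⟩ :=
    hsel X Y Z (fun j => A.P j k) (fun l => A.P k l) (fun j l => A.P j l)
    (fun i j l a b c => A.Edge (Q i j) (R i k) a ∧ A.Edge (Q i j) (R i l) b ∧
      A.Edge (Q i k) (R i l) c ∧ A.Edge a b c) cX cY cZ
    (fun j hj => A.Pnonempty _ _ (iV j (hY hj)) (iV k hkV) (hYk j hj).ne)
    (fun l hl => A.Pnonempty _ _ (iV k hkV) (iV l (hZV hl)) (hkZ l hl).ne)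
    (fun j hj l hl => A.Pnonempty _ _ (iV j (hY hj)) (iV l (hZV hl)) (hYZ j hj l hl).ne)
    (by
      intro i hi j hj l hl
      have h1 := hcol' i (hH (hX hi)) j (hH (hV (hY hj))) k (hH (hV hkV)) l (hH (hV (hZV hl)))
        (hXV i hi j (hY hj)) (hYk j hj) (hkZ l hl)
      have h2 := h1 ▸ hc
      push Not at h2
      refine h2.le.trans ?_
      norm_cast
      unfold ReducedHG.ecount
      apply Finset.card_le_card
      intro w hw
      simp only [Finset.mem_filter, Finset.mem_product, ReducedHG.mem_nbhd] at hw ⊢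
      obtain ⟨⟨⟨w1, w2⟩, ⟨w3, w4⟩, w5, w6⟩, w7⟩ := hw
      exact ⟨⟨w1, w3, w5⟩, w2, w4, w6, w7⟩)
  have hne : ∀ T : Finset ℕ, 0 < T.card → ∃ x, x ∈ T := fun T h => Finset.card_pos.mp h
  obtain ⟨l0, hl0⟩ := hne Z' (by omega)
  obtain ⟨i0, hi0⟩ := hne X' (by omega)
  by_cases hYe : Y'.Nonempty
  swap
  · obtain ⟨T, hT1, hT2, -⟩ := hnJ Y' (fun _ => Classical.arbitrary _) cY'.ge
    rw [Finset.not_nonempty_iff_eq_empty.mp hYe, Finset.subset_empty] at hT1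
    rw [hT1] at hT2
    simp at hT2
    omega
  obtain ⟨j0, hj0⟩ := hYe
  refine A.core ε m0 hm0 hε hW X' Y' Z' k (hX'.trans (hX.trans hHI)) (fun j hj => iV j (hY (hY' hj)))
    (iV k hkV) (fun l hl => iV l (hZV (hZ' hl))) (fun i hi j hj => hXV i (hX' hi) j (hY (hY' hj)))
    (fun i hi => hXV i (hX' hi) k hkV) (fun j hj => hYk j (hY' hj)) (fun l hl => hkZ l (hZ' hl))
    cX'.ge cZ' (fun c => hnJ Y' c cY'.ge) Q R a b c V (hY'.trans hY) hkV (hZ'.trans hZV)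
    ?_ ?_ ma mb mc (fun i hi j hj => (hE i hi j hj l0 hl0).1)
    (fun i hi j hj l hl => (hE i hi j hj l hl).2.1)
    (fun i hi l hl => (hE i hi j0 hj0 l hl).2.2.1)
    (fun j hj l hl => (hE i0 hi0 j hj l hl).2.2.2) ?_
  · intro i hi x hx
    exact hQ.2 i (hHJ (hX (hX' hi))) x (hHJ (hV hx)) (hXV i (hX' hi) x hx).ne
  · intro i hi x hx
    exact hR.2 i (hHJ (hX (hX' hi))) x (hHJ (hV hx)) (hXV i (hX' hi) x hx).ne
  · intro i hi i' hi' hii x hx y hy z hz hxy hyz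
    have h := hcolT i (hX (hX' hi)) i' (hX (hX' hi')) x (hV hx) y (hV hy) z (hV hz) hii
      (hXV i' (hX' hi') x hx) hxy hyz
    rw [h.1, h.2]
    exact hcc
end
end
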